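/- Let K be a number field and let R be a finitely generated subring of K whose field of fractions is K (i.e., every element of K can be written as r/s with r, s ∈ R and s ≠ 0). Then R has a universal definition in K: there exist n ∈ ℕ and a polynomial F ∈ K[X, Y₁, …, Yₙ] such that R = { x ∈ K : for all y₁, …, yₙ ∈ K, F(x, y₁, …, yₙ) ≠ 0 }. -/

import Mathlib

section
set_option linter.all false
open IsDedekindDomain NumberField WithZero
namespace UD
variable {K : Type*} [Field K] [NumberField K]

/-- the valuation attached to a finite prime -/
noncomputable abbrev vl (v : HeightOneSpectrum (𝓞 K)) : Valuation K ℤᵐ⁰ := v.valuation K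

lemma vl4_le (v : HeightOneSpectrum (𝓞 K)) : vl v 4 ≤ 1 := by
  have : vl v (algebraMap (𝓞 K) K 4) ≤ 1 := v.valuation_le_one 4
  rwa [map_ofNat] at this

lemma vl2_le (v : HeightOneSpectrum (𝓞 K)) : vl v 2 ≤ 1 := by
  have : vl v (algebraMap (𝓞 K) K 2) ≤ 1 := v.valuation_le_one 2
  rwa [map_ofNat] at this

lemma vl4_eq (v : HeightOneSpectrum (𝓞 K)) : vl v 4 = vl v 2 ^ 2 := by
  rw [← map_pow]; norm_num

lemma vl4_pos (v : HeightOneSpectrum (𝓞 K)) : 0 < vl v 4 := by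
  rw [Valuation.pos_iff]; norm_num

lemma vl_eq_one_of_sub_lt {v : HeightOneSpectrum (𝓞 K)} {x : K} (h : vl v (x - 1) < 1) :
    vl v x = 1 := by
  have := Valuation.map_one_add_of_lt (v := vl v) h
  simpa using this

/-- locally a square -/
def LS (v : HeightOneSpectrum (𝓞 K)) : Subgroup Kˣ where
  carrier := {x | ∃ z : Kˣ, vl v ((x : K) * z ^ 2 - 1) < vl v 4}
  one_mem' := ⟨1, by simpa using vl4_pos v⟩
  mul_mem' := by
    rintro x y ⟨z, hz⟩ ⟨w, hw⟩
    refine ⟨z * w, ?_⟩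
    have h1 : vl v ((y : K) * w ^ 2) = 1 := vl_eq_one_of_sub_lt (hw.trans_le (vl4_le v))
    have : ((x * y : Kˣ) : K) * (z * w : Kˣ) ^ 2 - 1 =
      (x * z ^ 2 - 1) * (y * w ^ 2) + (y * w ^ 2 - 1) := by push_cast; ring
    rw [this]
    refine Valuation.map_add_lt _ ?_ hw
    rw [map_mul, h1, mul_one]; exact hz
  inv_mem' := by
    rintro x ⟨z, hz⟩
    refine ⟨x * z, ?_⟩
    have : ((x⁻¹ : Kˣ) : K) * (x * z : Kˣ) ^ 2 - 1 = x * z ^ 2 - 1 := by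
      push_cast; field_simp
    rw [this]; exact hz

lemma mem_LS {v : HeightOneSpectrum (𝓞 K)} {x : Kˣ} :
    x ∈ LS v ↔ ∃ z : Kˣ, vl v ((x : K) * z ^ 2 - 1) < vl v 4 := Iff.rfl

lemma mem_LS_of {v : HeightOneSpectrum (𝓞 K)} {x : Kˣ} {z : K}
    (h : vl v ((x : K) * z ^ 2 - 1) < vl v 4) : x ∈ LS v := by
  have hz : z ≠ 0 := by
    rintro rfl
    simp at h
    exact absurd h (not_lt.2 (vl4_le v))
  exact ⟨Units.mk0 z hz, h⟩

/-- even valuation -/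
def EV (v : HeightOneSpectrum (𝓞 K)) : Subgroup Kˣ where
  carrier := {x | ∃ z : Kˣ, vl v ((x : K) * z ^ 2) = 1}
  one_mem' := ⟨1, by simp⟩
  mul_mem' := by
    rintro x y ⟨z, hz⟩ ⟨w, hw⟩
    refine ⟨z * w, ?_⟩
    have : ((x * y : Kˣ) : K) * (z * w : Kˣ) ^ 2 =
      (x * z ^ 2) * (y * w ^ 2) := by push_cast; ring
    rw [this, map_mul, hz, hw, one_mul]
  inv_mem' := by
    rintro x ⟨z, hz⟩
    refine ⟨z⁻¹, ?_⟩
    have : ((x⁻¹ : Kˣ) : K) * (z⁻¹ : Kˣ) ^ 2 = ((x : K) * (z : K) ^ 2)⁻¹ := by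
      push_cast; field_simp
    rw [this, map_inv₀, hz, inv_one]

lemma mem_EV {v : HeightOneSpectrum (𝓞 K)} {x : Kˣ} :
    x ∈ EV v ↔ ∃ z : Kˣ, vl v ((x : K) * z ^ 2) = 1 := Iff.rfl

/-- unramified (or split) -/
def UR (v : HeightOneSpectrum (𝓞 K)) : Subgroup Kˣ where
  carrier := {x | ∃ z : Kˣ, vl v ((x : K) * z ^ 2) = 1 ∧ vl v ((x : K) * z ^ 2 - 1) ≤ vl v 4}
  one_mem' := ⟨1, by simp⟩
  mul_mem' := by
    rintro x y ⟨z, hz, hz'⟩ ⟨w, hw, hw'⟩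
    refine ⟨z * w, ?_, ?_⟩
    · have : ((x * y : Kˣ) : K) * (z * w : Kˣ) ^ 2 =
        (x * z ^ 2) * (y * w ^ 2) := by push_cast; ring
      rw [this, map_mul, hz, hw, one_mul]
    · have : ((x * y : Kˣ) : K) * (z * w : Kˣ) ^ 2 - 1 =
        (x * z ^ 2 - 1) * (y * w ^ 2) + (y * w ^ 2 - 1) := by push_cast; ring
      rw [this]
      refine Valuation.map_add_le _ ?_ hw'
      rw [map_mul, hw, mul_one]; exact hz'
  inv_mem' := by
    rintro x ⟨z, hz, hz'⟩
    refine ⟨x * z, ?_⟩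
    have : ((x⁻¹ : Kˣ) : K) * (x * z : Kˣ) ^ 2 = x * z ^ 2 := by
      push_cast; field_simp
    rw [this]; exact ⟨hz, hz'⟩

lemma mem_UR {v : HeightOneSpectrum (𝓞 K)} {x : Kˣ} :
    x ∈ UR v ↔ ∃ z : Kˣ, vl v ((x : K) * z ^ 2) = 1 ∧ vl v ((x : K) * z ^ 2 - 1) ≤ vl v 4 :=
  Iff.rfl

lemma LS_le_UR (v : HeightOneSpectrum (𝓞 K)) : LS v ≤ UR v := by
  rintro x ⟨z, hz⟩
  exact ⟨z, vl_eq_one_of_sub_lt (hz.trans_le (vl4_le v)), hz.le⟩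

lemma UR_le_EV (v : HeightOneSpectrum (𝓞 K)) : UR v ≤ EV v := by
  rintro x ⟨z, hz, _⟩
  exact ⟨z, hz⟩

lemma LS_le_EV (v : HeightOneSpectrum (𝓞 K)) : LS v ≤ EV v := (LS_le_UR v).trans (UR_le_EV v)

lemma sq_mem_LS (v : HeightOneSpectrum (𝓞 K)) (x : Kˣ) : x ^ 2 ∈ LS v := by
  refine ⟨x⁻¹, ?_⟩
  have : ((x ^ 2 : Kˣ) : K) * (x⁻¹ : Kˣ) ^ 2 - 1 = 0 := by
    push_cast; field_simp; simp
  rw [this, map_zero]; exact vl4_pos v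

/-- odd prime -/
def Odd' (v : HeightOneSpectrum (𝓞 K)) : Prop := vl v 2 = 1

lemma Odd'.four {v : HeightOneSpectrum (𝓞 K)} (h : Odd' v) : vl v 4 = 1 := by
  rw [vl4_eq, h, one_pow]

lemma Odd'.UR_eq {v : HeightOneSpectrum (𝓞 K)} (h : Odd' v) : UR v = EV v := by
  refine le_antisymm (UR_le_EV v) ?_
  rintro x ⟨z, hz⟩
  refine ⟨z, hz, ?_⟩
  rw [h.four]
  exact Valuation.map_sub_le _ hz.le (by simp)

/-- the additive valuation (sign: `log`) -/
lemma vl_unit_eq (v : HeightOneSpectrum (𝓞 K)) (x : Kˣ) : ∃ n : ℤ, vl v (x : K) = exp n :=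
  ⟨WithZero.log (vl v (x : K)), (WithZero.exp_log ((Valuation.ne_zero_iff _).2 x.ne_zero)).symm⟩

lemma exists_unif (v : HeightOneSpectrum (𝓞 K)) : ∃ p : Kˣ, vl v (p : K) = exp (-1 : ℤ) := by
  obtain ⟨π, h⟩ := v.valuation_exists_uniformizer K
  have : π ≠ 0 := by
    rintro rfl
    rw [map_zero] at h
    exact exp_ne_zero h.symm
  exact ⟨Units.mk0 π this, h⟩

lemma mem_EV_iff {v : HeightOneSpectrum (𝓞 K)} {x : Kˣ} {n : ℤ} (h : vl v (x : K) = exp n) :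
    x ∈ EV v ↔ Even n := by
  constructor
  · rintro ⟨z, hz⟩
    obtain ⟨m, hm⟩ := vl_unit_eq v z
    rw [map_mul, map_pow, h, hm, ← exp_nsmul, ← exp_add, ← exp_zero, exp_inj] at hz
    exact ⟨-m, by simp at hz; omega⟩
  · rintro ⟨m, rfl⟩
    obtain ⟨p, hp⟩ := exists_unif v
    refine ⟨p ^ m, ?_⟩
    rw [map_mul, h]
    push_cast
    rw [map_pow, map_zpow₀, hp, ← exp_zsmul, ← exp_nsmul, ← exp_add, ← exp_zero, exp_inj]
    simp; ring

lemma mul_mem_EV {v : HeightOneSpectrum (𝓞 K)} {x y : Kˣ} (hx : x ∉ EV v) (hy : y ∉ EV v) :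
    x * y ∈ EV v := by
  obtain ⟨n, hn⟩ := vl_unit_eq v x
  obtain ⟨m, hm⟩ := vl_unit_eq v y
  rw [mem_EV_iff hn] at hx
  rw [mem_EV_iff hm] at hy
  have : vl v ((x * y : Kˣ) : K) = exp (n + m) := by
    push_cast; rw [map_mul, hn, hm, exp_add]
  rw [mem_EV_iff this]
  rw [Int.not_even_iff_odd] at hx hy
  exact hx.add_odd hy

end UD

end

section
set_option linter.all false
open IsDedekindDomain NumberField WithZero
namespace UD
variable {K : Type*} [Field K] [NumberField K]

lemma relIndex_le_of_fun {G : Type*} [Group G] (H L : Subgroup G) {X : Type*} [Finite X]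
    (f : L → X) (hf : ∀ a b : L, f a = f b → (a : G)⁻¹ * b ∈ H) :
    H.relIndex L ≠ 0 ∧ H.relIndex L ≤ Nat.card X := by
  let g : L ⧸ (H.subgroupOf L) → X := fun q => f q.out
  have hg : Function.Injective g := by
    intro a b hab
    have := hf _ _ hab
    rw [← QuotientGroup.out_eq' a, ← QuotientGroup.out_eq' b]
    rw [QuotientGroup.eq]
    rw [Subgroup.mem_subgroupOf]
    simpa using this
  have : Finite (L ⧸ (H.subgroupOf L)) := Finite.of_injective g hg
  refine ⟨?_, ?_⟩
  · rw [Subgroup.relIndex]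
    exact Subgroup.index_ne_zero_of_finite
  · rw [Subgroup.relIndex, Subgroup.index_eq_card]
    exact Nat.card_le_card_of_injective g hg

/-- exponent of `2` at `v` -/
noncomputable def e2 (v : HeightOneSpectrum (𝓞 K)) : ℕ := (-(WithZero.log (vl v 2))).toNat

lemma vl_two (v : HeightOneSpectrum (𝓞 K)) : vl v 2 = exp (-(e2 v : ℤ)) := by
  have h0 : vl v 2 ≠ 0 := (Valuation.ne_zero_iff _).2 two_ne_zero
  have h1 := vl2_le v
  rw [← exp_log h0, ← exp_zero, exp_le_exp] at h1
  rw [e2, Int.toNat_of_nonneg (by omega), neg_neg, exp_log h0]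

lemma vl_algebraMap_le_iff (v : HeightOneSpectrum (𝓞 K)) (a : 𝓞 K) (n : ℕ) :
    vl v (algebraMap (𝓞 K) K a) ≤ exp (-(n : ℤ)) ↔ a ∈ v.asIdeal ^ n := by
  rw [← v.intValuation_le_pow_iff_mem]
  rw [show vl v (algebraMap (𝓞 K) K a) = v.intValuation a from v.valuation_of_algebraMap a]

lemma lt_vl4_iff (v : HeightOneSpectrum (𝓞 K)) (x : K) :
    vl v x < vl v 4 ↔ vl v x ≤ exp (-((2 * e2 v + 1 : ℕ) : ℤ)) := by
  rw [vl4_eq, vl_two, ← exp_nsmul]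
  rcases eq_or_ne x 0 with rfl | hx
  · simp
  obtain ⟨n, hn⟩ := vl_unit_eq v (Units.mk0 x hx)
  simp only [Units.val_mk0] at hn
  rw [hn, exp_lt_exp, exp_le_exp]
  simp only [nsmul_eq_mul, Nat.cast_add, Nat.cast_mul]
  push_cast
  constructor <;> intro h <;> linarith

lemma card_pow_quot (v : HeightOneSpectrum (𝓞 K)) (n : ℕ) :
    Nat.card (𝓞 K ⧸ v.asIdeal ^ n) = (Ideal.absNorm v.asIdeal) ^ n := by
  rw [← map_pow Ideal.absNorm v.asIdeal n, Ideal.absNorm_apply, Submodule.cardQuot_apply]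

lemma card_ker_mul {R S : Type*} [CommRing R] [CommRing S] (φ : R →+* S)
    (hφ : Function.Surjective φ) : Nat.card (RingHom.ker φ) * Nat.card S = Nat.card R := by
  have h3 := AddSubgroup.card_mul_index (φ.toAddMonoidHom.ker)
  rw [AddSubgroup.index_ker, AddMonoidHom.range_eq_top.2 (by exact hφ),
    AddSubgroup.card_top] at h3
  rw [← h3]
  congr 1

lemma card_factor_ker (v : HeightOneSpectrum (𝓞 K)) (e : ℕ)
    (h : v.asIdeal ^ (2 * e + 1) ≤ v.asIdeal ^ (e + 1)) :
    Nat.card (RingHom.ker (Ideal.Quotient.factor h)) = (Ideal.absNorm v.asIdeal) ^ e := by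
  have h3 := card_ker_mul (Ideal.Quotient.factor h) (Ideal.Quotient.factor_surjective h)
  rw [card_pow_quot, card_pow_quot] at h3
  have hpos : 0 < Ideal.absNorm v.asIdeal := by
    rw [Nat.pos_iff_ne_zero, Ne, Ideal.absNorm_eq_zero_iff]; exact v.ne_bot
  have h5 : Ideal.absNorm v.asIdeal ^ (2 * e + 1) =
      Ideal.absNorm v.asIdeal ^ e * Ideal.absNorm v.asIdeal ^ (e + 1) := by
    rw [← pow_add]; congr 1; ring
  rw [h5] at h3
  exact Nat.eq_of_mul_eq_mul_right (pow_pos hpos _) h3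

lemma card_sq_one (v : HeightOneSpectrum (𝓞 K)) :
    Nat.card (powMonoidHom 2 : (𝓞 K ⧸ v.asIdeal ^ (2 * e2 v + 1))ˣ →* _).ker ≤
      2 * (Ideal.absNorm v.asIdeal) ^ (e2 v) := by
  set e := e2 v with he
  set I := v.asIdeal ^ (2 * e + 1) with hI
  set J := v.asIdeal ^ (e + 1) with hJ
  have hIJ : I ≤ J := Ideal.pow_le_pow_right (by omega)
  have hI0 : I ≠ ⊥ := pow_ne_zero _ v.ne_bot
  have hJ0 : J ≠ ⊥ := pow_ne_zero _ v.ne_bot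
  haveI : Finite (𝓞 K ⧸ I) := Ideal.finiteQuotientOfFreeOfNeBot I hI0
  haveI : Finite (𝓞 K ⧸ J) := Ideal.finiteQuotientOfFreeOfNeBot J hJ0
  let φ : (𝓞 K ⧸ I) →+* (𝓞 K ⧸ J) := Ideal.Quotient.factor hIJ
  have hφ : Function.Surjective φ := Ideal.Quotient.factor_surjective hIJ
  have hcard : Nat.card (RingHom.ker φ) = (Ideal.absNorm v.asIdeal) ^ e :=
    card_factor_ker v e hIJ
  -- the injection
  have key : ∀ u : (𝓞 K ⧸ I)ˣ, u ∈ (powMonoidHom 2 : (𝓞 K ⧸ I)ˣ →* _).ker →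
      (u : 𝓞 K ⧸ I) - 1 ∈ RingHom.ker φ ∨ (u : 𝓞 K ⧸ I) + 1 ∈ RingHom.ker φ := by
    intro u hu
    rw [MonoidHom.mem_ker] at hu
    have hu' : (u : 𝓞 K ⧸ I) ^ 2 = 1 := by
      have := congrArg Units.val hu
      simpa using this
    obtain ⟨a, ha⟩ := Ideal.Quotient.mk_surjective (u : 𝓞 K ⧸ I)
    rw [← ha] at hu' ⊢
    have h1 : (a - 1) * (a + 1) ∈ I := by
      rw [← Ideal.Quotient.eq_zero_iff_mem]
      have : (a - 1) * (a + 1) = a ^ 2 - 1 := by ring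
      rw [this, map_sub, map_pow, hu', map_one, sub_self]
    have h2 : a - 1 ∈ J ∨ a + 1 ∈ J := by
      by_contra hcon
      push Not at hcon
      rw [hJ, ← vl_algebraMap_le_iff, ← vl_algebraMap_le_iff] at hcon
      have h3 := (vl_algebraMap_le_iff v _ _).2 h1
      rw [map_mul, map_mul] at h3
      obtain ⟨h4, h5⟩ := hcon
      have aux : ∀ x : K, ¬ (vl v x ≤ exp (-((e + 1 : ℕ) : ℤ))) → ∃ n : ℤ, vl v x = exp n ∧ -(e:ℤ) ≤ n := by
        intro x hx
        rcases eq_or_ne x 0 with rfl | hx0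
        · simp at hx
        obtain ⟨n, hn⟩ := vl_unit_eq v (Units.mk0 x hx0)
        simp only [Units.val_mk0] at hn
        rw [hn, exp_le_exp] at hx
        exact ⟨n, hn, by push_cast at hx; omega⟩
      obtain ⟨n, hn, hn'⟩ := aux _ h4
      obtain ⟨m, hm, hm'⟩ := aux _ h5
      rw [hn, hm, ← exp_add, exp_le_exp] at h3
      push_cast at h3
      omega
    rcases h2 with h | h
    · left
      rw [RingHom.mem_ker, ← map_one (Ideal.Quotient.mk I), ← map_sub]
      exact Ideal.Quotient.eq_zero_iff_mem.2 h
    · right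
      rw [RingHom.mem_ker, ← map_one (Ideal.Quotient.mk I), ← map_add]
      exact Ideal.Quotient.eq_zero_iff_mem.2 h
  classical
  let g : (powMonoidHom 2 : (𝓞 K ⧸ I)ˣ →* _).ker → Bool × RingHom.ker φ := fun u =>
    if h : (u.1 : 𝓞 K ⧸ I) - 1 ∈ RingHom.ker φ then (true, ⟨_, h⟩)
    else (false, ⟨_, (key u.1 u.2).resolve_left h⟩)
  have hg : Function.Injective g := by
    intro a b hab
    simp only [g] at hab
    split_ifs at hab with h1 h2 h2
    · simp only [Prod.mk.injEq, Subtype.mk.injEq, true_and] at hab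
      exact Subtype.ext (Units.ext (by simpa using hab))
    · simp at hab
    · simp at hab
    · simp only [Prod.mk.injEq, Subtype.mk.injEq, true_and] at hab
      exact Subtype.ext (Units.ext (by simpa using hab))
  have := Nat.card_le_card_of_injective g hg
  rwa [Nat.card_prod, hcard, Nat.card_eq_fintype_card (α := Bool), Fintype.card_bool] at this

lemma relIndex_LS_EV (v : HeightOneSpectrum (𝓞 K)) :
    (LS v).relIndex (EV v) ≠ 0 ∧
      (LS v).relIndex (EV v) ≤ 2 * (Ideal.absNorm v.asIdeal) ^ (e2 v) := by
  set I := v.asIdeal ^ (2 * e2 v + 1) with hI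
  have hI0 : I ≠ ⊥ := pow_ne_zero _ v.ne_bot
  haveI : Finite (𝓞 K ⧸ I) := Ideal.finiteQuotientOfFreeOfNeBot I hI0
  let U := (𝓞 K ⧸ I)ˣ
  let Q := U ⧸ (powMonoidHom 2 : U →* U).range
  have hQ : Nat.card Q ≤ 2 * (Ideal.absNorm v.asIdeal) ^ (e2 v) := by
    refine le_trans (le_of_eq ?_) (card_sq_one v)
    have h1 := Subgroup.card_mul_index (powMonoidHom 2 : U →* U).ker
    rw [Subgroup.index_ker] at h1
    have h2 := Subgroup.card_mul_index (powMonoidHom 2 : U →* U).range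
    rw [← h2, mul_comm] at h1
    exact (Nat.eq_of_mul_eq_mul_left Nat.card_pos h1).symm
  have hrep : ∀ x : EV v, ∃ (z : Kˣ) (a : 𝓞 K) (u : U), vl v ((x : Kˣ) * (z : K) ^ 2) = 1 ∧
      vl v ((x : Kˣ) * (z : K) ^ 2 - algebraMap (𝓞 K) K a) < vl v 4 ∧
      (u : 𝓞 K ⧸ I) = Ideal.Quotient.mk I a := by
    rintro ⟨x, z, hz⟩
    obtain ⟨a, ha⟩ := v.exists_valuation_sub_lt_of_integer (K := K) hz.le
      (γ := Units.mk0 (vl v 4) (vl4_pos v).ne')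
    have ha2 : vl v ((x : K) * (z : K) ^ 2 - algebraMap (𝓞 K) K a) < vl v 4 := by
      rw [← Valuation.map_neg, neg_sub]; exact ha
    have hua : IsUnit (Ideal.Quotient.mk I a) := by
      have h1 : vl v (algebraMap (𝓞 K) K a) = 1 := by
        have h3 : vl v (algebraMap (𝓞 K) K a - (x : K) * (z : K) ^ 2) < vl v ((x : K) * (z : K) ^ 2) := by
          rw [hz]; exact lt_of_lt_of_le ha (vl4_le v)
        rw [Valuation.map_eq_of_sub_lt _ h3, hz]
      have h2 : a ∉ v.asIdeal := by
        intro h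
        have := (v.valuation_lt_one_iff_mem (K := K) a).2 h
        exact this.ne h1
      have h3 : IsCoprime (Ideal.span {a}) I := by
        apply IsCoprime.pow_right
        rw [Ideal.isCoprime_iff_sup_eq]
        haveI := v.isMaximal
        refine (v.isMaximal.1.2 _ ?_)
        refine lt_of_le_of_ne le_sup_right ?_
        intro h
        apply h2
        rw [h]
        exact Ideal.mem_sup_left (Ideal.mem_span_singleton_self a)
      rw [Ideal.isCoprime_iff_exists] at h3
      obtain ⟨i, hi, j, hj, hij⟩ := h3
      obtain ⟨c, rfl⟩ := Ideal.mem_span_singleton'.1 hi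
      refine IsUnit.of_mul_eq_one (Ideal.Quotient.mk I c) ?_
      rw [← map_mul, ← map_one (Ideal.Quotient.mk I), Ideal.Quotient.eq]
      have : a * c - 1 = - j := by rw [← hij]; ring
      rw [this]
      exact I.neg_mem hj
    exact ⟨z, a, hua.unit, hz, ha2, rfl⟩
  choose z a u h1 h2 h3 using hrep
  have := relIndex_le_of_fun (LS v) (EV v) (X := Q) (fun x => QuotientGroup.mk (u x)) ?_
  · exact ⟨this.1, this.2.trans hQ⟩
  intro x y hxy
  rw [QuotientGroup.eq] at hxy
  obtain ⟨c, hc⟩ := hxy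
  -- u y = u x * c^2
  have hc' : u y = u x * c ^ 2 := by
    rw [eq_comm, ← eq_inv_mul_iff_mul_eq]; simpa using hc
  obtain ⟨b, hb⟩ := Ideal.Quotient.mk_surjective (c : 𝓞 K ⧸ I)
  have h4 : a y - a x * b ^ 2 ∈ I := by
    rw [← Ideal.Quotient.eq, map_mul, map_pow, ← h3, ← h3, hb, hc', Units.val_mul, Units.val_pow_eq_pow_val]
  have h5 := (vl_algebraMap_le_iff v _ _).2 h4
  rw [← lt_vl4_iff] at h5
  rw [map_sub, map_mul, map_pow] at h5
  set Y : K := (y : Kˣ) * (z y : K) ^ 2 with hY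
  set X : K := (x : Kˣ) * (z x : K) ^ 2 with hX
  set β : K := algebraMap (𝓞 K) K b
  have hβ : vl v β ≤ 1 := v.valuation_le_one b
  have h6 : vl v (Y - X * β ^ 2) < vl v 4 := by
    have : Y - X * β ^ 2 = (Y - algebraMap (𝓞 K) K (a y)) +
      ((algebraMap (𝓞 K) K (a y) - algebraMap (𝓞 K) K (a x) * β ^ 2) -
        (X - algebraMap (𝓞 K) K (a x)) * β ^ 2) := by ring
    rw [this]
    refine Valuation.map_add_lt _ (h2 y) (Valuation.map_sub_lt _ h5 ?_)
    rw [map_mul, map_pow]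
    exact lt_of_le_of_lt (mul_le_of_le_one_right' (pow_le_one' hβ 2)) (h2 x)
  -- now X⁻¹ Y ≡ β ^ 2
  have hY1 : vl v Y = 1 := h1 y
  have hX0 : X ≠ 0 := by
    have := h1 x
    rw [← hX] at this
    intro h
    rw [h, map_zero] at this
    exact zero_ne_one this
  have hY0 : Y ≠ 0 := by
    intro h
    rw [h, map_zero] at hY1
    exact zero_ne_one hY1
  -- (x⁻¹ y) * (z y * β⁻¹ ...)
  have e1 : (((x : Kˣ)⁻¹ * (y : Kˣ) : Kˣ) : K) * ((z y : K) * (x : Kˣ) * z x * β / Y) ^ 2 - 1 =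
      -((Y - X * β ^ 2) / Y) := by
    have : (((x : Kˣ)⁻¹ * (y : Kˣ) : Kˣ) : K) * ((z y : K) * (x : Kˣ) * z x * β / Y) ^ 2 =
      X * Y * β ^ 2 / Y ^ 2 := by
      rw [hX, hY]; push_cast; field_simp
    rw [this]; field_simp; ring
  apply mem_LS_of (z := (z y : K) * (x : Kˣ) * z x * β / Y)
  rw [e1, Valuation.map_neg, map_div₀, hY1, div_one]
  exact h6

lemma Odd'.e2_eq {v : HeightOneSpectrum (𝓞 K)} (h : Odd' v) : e2 v = 0 := by
  have := vl_two v
  rw [h, ← exp_zero, exp_inj] at this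
  omega

lemma mul_mem_LS_of_EV {v : HeightOneSpectrum (𝓞 K)} (h : Odd' v) {x y : Kˣ} (hx : x ∈ EV v)
    (hy : y ∈ EV v) (hx' : x ∉ LS v) (hy' : y ∉ LS v) : x * y ∈ LS v := by
  obtain ⟨h1, h2⟩ := relIndex_LS_EV v
  rw [h.e2_eq, pow_zero, mul_one] at h2
  have h3 : (LS v).relIndex (EV v) = 2 := by
    have : (LS v).relIndex (EV v) ≠ 1 := by
      rw [Ne, Subgroup.relIndex_eq_one]
      intro h; exact hx' (h hx)
    omega
  have h4 := (Subgroup.mul_mem_iff_of_index_two (H := (LS v).subgroupOf (EV v)) h3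
    (a := ⟨x, hx⟩) (b := ⟨y, hy⟩))
  simp only [Subgroup.mem_subgroupOf] at h4
  exact h4.2 (by simp [hx', hy'])

end UD

end

section
set_option linter.all false
open IsDedekindDomain NumberField WithZero
namespace UD
variable {K : Type*} [Field K] [NumberField K]

open Classical in
/-- the local norm group of `B` at `v` -/
noncomputable def LN (v : HeightOneSpectrum (𝓞 K)) (B : Kˣ) : Subgroup Kˣ :=
  if B ∈ LS v then ⊤ else if B ∈ UR v then EV v else LS v ⊔ Subgroup.zpowers (-B)

lemma LN_of_LS {v : HeightOneSpectrum (𝓞 K)} {B : Kˣ} (h : B ∈ LS v) : LN v B = ⊤ := by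
  rw [LN, if_pos h]

lemma LN_of_UR {v : HeightOneSpectrum (𝓞 K)} {B : Kˣ} (h : B ∉ LS v) (h' : B ∈ UR v) :
    LN v B = EV v := by
  rw [LN, if_neg h, if_pos h']

lemma LN_of_RAM {v : HeightOneSpectrum (𝓞 K)} {B : Kˣ} (h' : B ∉ UR v) :
    LN v B = LS v ⊔ Subgroup.zpowers (-B) := by
  rw [LN, if_neg (fun h => h' (LS_le_UR v h)), if_neg h']

lemma mul_self_mem_LS (v : HeightOneSpectrum (𝓞 K)) (x : Kˣ) : x * x ∈ LS v := by
  rw [← sq]; exact sq_mem_LS v x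

lemma mem_sup_zpowers {v : HeightOneSpectrum (𝓞 K)} {A C : Kˣ} :
    A ∈ LS v ⊔ Subgroup.zpowers C ↔ A ∈ LS v ∨ A * C ∈ LS v := by
  constructor
  · intro h
    obtain ⟨y, hy, z, hz, rfl⟩ := Subgroup.mem_sup.1 h
    obtain ⟨n, rfl⟩ := hz
    rcases Int.even_or_odd' n with ⟨m, rfl | rfl⟩
    · left
      refine mul_mem hy ?_
      simp only [zpow_mul, zpow_two]
      exact Subgroup.zpow_mem _ (mul_self_mem_LS v C) m
    · right
      have : y * C ^ (2 * m + 1) * C = y * ((C * C) ^ (m + 1)) := by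
        rw [mul_assoc, ← zpow_add_one, ← zpow_two, ← zpow_mul]; congr 2; ring
      simp only []
      rw [this]
      exact mul_mem hy (Subgroup.zpow_mem _ (mul_self_mem_LS v C) _)
  · rintro (h | h)
    · exact Subgroup.mem_sup_left h
    · have : A = (A * C) * C⁻¹ := by group
      rw [this]
      exact Subgroup.mul_mem_sup h (inv_mem (Subgroup.mem_zpowers C))

lemma LS_le_LN (v : HeightOneSpectrum (𝓞 K)) (B : Kˣ) : LS v ≤ LN v B := by
  rw [LN]
  split_ifs
  · exact le_top
  · exact LS_le_EV v
  · exact le_sup_left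

lemma mem_LN_RAM {v : HeightOneSpectrum (𝓞 K)} {A B : Kˣ} (h' : B ∉ UR v) :
    A ∈ LN v B ↔ A ∈ LS v ∨ -(A * B) ∈ LS v := by
  rw [LN_of_RAM h', mem_sup_zpowers, mul_neg]

lemma neg_mem_EV {v : HeightOneSpectrum (𝓞 K)} {x : Kˣ} : -x ∈ EV v ↔ x ∈ EV v := by
  simp only [mem_EV, Units.val_neg, neg_mul, Valuation.map_neg]

/-- symmetric description at odd primes -/
lemma Odd'.mem_LN {v : HeightOneSpectrum (𝓞 K)} (h : Odd' v) {A B : Kˣ} :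
    A ∈ LN v B ↔ A ∈ LS v ∨ B ∈ LS v ∨ -(A * B) ∈ LS v ∨ (A ∈ EV v ∧ B ∈ EV v) := by
  by_cases hB : B ∈ LS v
  · simp [LN_of_LS hB, hB]
  by_cases hU : B ∈ EV v
  · rw [LN_of_UR hB (h.UR_eq ▸ hU)]
    constructor
    · intro hA; exact Or.inr (Or.inr (Or.inr ⟨hA, hU⟩))
    · rintro (h1 | h1 | h1 | h1)
      · exact LS_le_EV v h1
      · exact absurd h1 hB
      · have := neg_mem_EV.1 (LS_le_EV v h1)
        exact (Subgroup.mul_mem_cancel_right _ hU).1 this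
      · exact h1.1
  · rw [mem_LN_RAM (h.UR_eq ▸ hU)]
    simp [hB, hU]

lemma Odd'.LN_symm {v : HeightOneSpectrum (𝓞 K)} (h : Odd' v) {A B : Kˣ} :
    A ∈ LN v B ↔ B ∈ LN v A := by
  rw [h.mem_LN, h.mem_LN, mul_comm]; tauto

/-- admissible: odd prime or `B` unramified -/
def Adm (v : HeightOneSpectrum (𝓞 K)) (B : Kˣ) : Prop := Odd' v ∨ B ∈ UR v

lemma mul_mem_LN {v : HeightOneSpectrum (𝓞 K)} {B : Kˣ} (hB : Adm v B) {x y : Kˣ}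
    (hx : x ∉ LN v B) (hy : y ∉ LN v B) : x * y ∈ LN v B := by
  by_cases hLS : B ∈ LS v
  · rw [LN_of_LS hLS] at hx; exact absurd trivial hx
  by_cases hUR : B ∈ UR v
  · rw [LN_of_UR hLS hUR] at *
    exact mul_mem_EV hx hy
  have hodd : Odd' v := hB.resolve_right hUR
  rw [mem_LN_RAM hUR] at *
  push Not at hx hy
  rw [hodd.UR_eq] at hUR
  -- x or -xB is EV non LS
  have key : ∀ x : Kˣ, x ∈ EV v ∨ -(x * B) ∈ EV v := by
    intro x
    by_cases h : x ∈ EV v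
    · exact Or.inl h
    · exact Or.inr (neg_mem_EV.2 (mul_mem_EV h hUR))
  have hBB : B * B ∈ LS v := mul_self_mem_LS v B
  have can : ∀ z : Kˣ, z * (B * B) ∈ LS v → z ∈ LS v := fun z h =>
    (Subgroup.mul_mem_cancel_right _ hBB).1 h
  rcases key x with h1 | h1 <;> rcases key y with h2 | h2
  · left; exact mul_mem_LS_of_EV hodd h1 h2 hx.1 hy.1
  · right
    have := mul_mem_LS_of_EV hodd h1 h2 hx.1 hy.2
    rwa [mul_neg, ← mul_assoc] at this
  · right
    have := mul_mem_LS_of_EV hodd h1 h2 hx.2 hy.1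
    rw [neg_mul, mul_assoc, mul_comm B, ← mul_assoc] at this
    exact this
  · left
    have := mul_mem_LS_of_EV hodd h1 h2 hx.2 hy.2
    rw [neg_mul_neg] at this
    apply can
    rwa [mul_mul_mul_comm]

lemma mul_mem_LN_iff {v : HeightOneSpectrum (𝓞 K)} {B : Kˣ} (hB : Adm v B) {x y : Kˣ} :
    x * y ∈ LN v B ↔ (x ∈ LN v B ↔ y ∈ LN v B) := by
  by_cases hx : x ∈ LN v B
  · simp [hx, Subgroup.mul_mem_cancel_left _ hx]
  · by_cases hy : y ∈ LN v B
    · simp [hx, hy, Subgroup.mul_mem_cancel_right _ hy]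
    · simp [hx, hy, mul_mem_LN hB hx hy]

/-- global norms are local norms -/
lemma norm_mem_LN {v : HeightOneSpectrum (𝓞 K)} {B : Kˣ} (hB : Adm v B) {N : Kˣ} {x y : K}
    (hN : (N : K) = x ^ 2 - B * y ^ 2) : N ∈ LN v B := by
  by_cases hLS : B ∈ LS v
  · rw [LN_of_LS hLS]; trivial
  by_cases hUR : B ∈ UR v
  · rw [LN_of_UR hLS hUR]
    obtain ⟨w, hw1, hw2⟩ := hUR
    -- B w² = 1 + 4 b
    set b : K := ((B : K) * w ^ 2 - 1) / 4 with hb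
    have h4 : (4 : K) ≠ 0 := by norm_num
    have h2 : (2 : K) ≠ 0 := by norm_num
    have hb1 : vl v b ≤ 1 := by
      rw [hb, map_div₀]
      exact div_le_one_of_le₀ hw2 zero_le'
    have hBw : (B : K) * w ^ 2 = 1 + 4 * b := by rw [hb]; field_simp; ring
    set y' : K := y / w with hy'
    have hyy : y = y' * w := by rw [hy']; field_simp
    set X : K := x - y' with hX
    set Y : K := 2 * y' with hY
    have hNXY : (N : K) = X ^ 2 + X * Y - b * Y ^ 2 := by
      rw [hN, hyy, mul_pow, show (B : K) * (y' ^ 2 * (w : K) ^ 2) = (B * w ^ 2) * y' ^ 2 by ring, hBw, hX, hY]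
      ring
    have fin : ∀ t : K, t ≠ 0 → vl v (N : K) = vl v t ^ 2 → N ∈ EV v := by
      intro t ht h
      refine ⟨(Units.mk0 t ht)⁻¹, ?_⟩
      rw [map_mul, h]
      simp only [Units.val_inv_eq_inv_val, Units.val_mk0, map_pow, map_inv₀]
      rw [← mul_pow, mul_inv_cancel₀ ((Valuation.ne_zero_iff _).2 ht), one_pow]
    rcases lt_or_ge (vl v Y) (vl v X) with hlt | hge
    · have hX0 : X ≠ 0 := by
        intro h; rw [h, map_zero] at hlt; exact not_lt_zero hlt
      apply fin X hX0
      have hXpos : 0 < vl v X := (Valuation.pos_iff _).2 hX0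
      rw [hNXY, add_sub_assoc, ← map_pow]
      apply Valuation.map_add_eq_of_lt_left
      apply Valuation.map_sub_lt
      · rw [map_mul, map_pow, sq]
        exact mul_lt_mul_of_pos_left hlt hXpos
      · rw [map_mul, map_pow, map_pow]
        refine lt_of_le_of_lt (mul_le_of_le_one_left' hb1) ?_
        exact pow_lt_pow_left₀ hlt zero_le' two_ne_zero
    · have hY0 : Y ≠ 0 := by
        intro h
        rw [h, map_zero] at hge
        have hX0 : X = 0 := (Valuation.zero_iff (vl v)).1 (le_antisymm hge zero_le')
        apply N.ne_zero
        rw [hNXY, h, hX0]; ring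
      apply fin Y hY0
      set t : K := X / Y with ht
      have ht1 : vl v t ≤ 1 := by
        rw [ht, map_div₀]; exact div_le_one_of_le₀ hge zero_le'
      have hNt : (N : K) = (t ^ 2 + t - b) * Y ^ 2 := by
        rw [hNXY, ht]; field_simp
      rw [hNt, map_mul, map_pow]
      have hle : vl v (t ^ 2 + t - b) ≤ 1 := by
        apply Valuation.map_sub_le _ (Valuation.map_add_le _ _ ht1) hb1
        rw [map_pow]; exact pow_le_one' ht1 2
      rcases hle.lt_or_eq with hlt | heq
      · exfalso
        apply hLS
        have hid : (B : K) * ((w : K) * (2 * t + 1) / (B * w ^ 2)) ^ 2 - 1 =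
            4 * (t ^ 2 + t - b) / (B * w ^ 2) := by
          have hw0 : (w : K) ≠ 0 := w.ne_zero
          have hB0 : (B : K) ≠ 0 := B.ne_zero
          have : (B : K) * ((w : K) * (2 * t + 1) / (B * w ^ 2)) ^ 2 = (2 * t + 1) ^ 2 / (B * w ^ 2) := by
            field_simp
          rw [this, div_sub_one (by simp), hBw]
          congr 1; ring
        apply mem_LS_of (z := (w : K) * (2 * t + 1) / (B * w ^ 2))
        rw [hid, map_div₀, hw1, div_one, map_mul]
        calc vl v 4 * vl v (t ^ 2 + t - b) < vl v 4 * 1 :=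
              mul_lt_mul_of_pos_left hlt (vl4_pos v)
          _ = vl v 4 := mul_one _
      · rw [heq, one_mul]
  have hodd : Odd' v := hB.resolve_right hUR
  rw [mem_LN_RAM hUR]
  rw [hodd.UR_eq] at hUR
  rcases lt_trichotomy (vl v (B * y ^ 2)) (vl v (x ^ 2)) with h | h | h
  · left
    have hx0 : x ≠ 0 := by rintro rfl; simp at h
    apply mem_LS_of (z := x⁻¹)
    have : (N : K) * x⁻¹ ^ 2 - 1 = - ((B * y ^ 2) / x ^ 2) := by rw [hN]; field_simp; ring
    rw [this, Valuation.map_neg, map_div₀, hodd.four]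
    exact (div_lt_one₀ (lt_of_le_of_lt zero_le' h)).2 h
  · exfalso
    have hx0 : x ≠ 0 := by
      rintro rfl
      have hy0 : y ≠ 0 := by
        rintro rfl
        apply N.ne_zero; rw [hN]; ring
      simp [hy0] at h
    apply hUR
    have hy0 : y ≠ 0 := by
      rintro rfl
      rw [zero_pow two_ne_zero, mul_zero, map_zero] at h
      exact (Valuation.ne_zero_iff _).2 (pow_ne_zero 2 hx0) h.symm
    refine ⟨Units.mk0 (y / x) (div_ne_zero hy0 hx0), ?_⟩
    have : (B : K) * (Units.mk0 (y / x) (div_ne_zero hy0 hx0) : Kˣ) ^ 2 = B * y ^ 2 / x ^ 2 := by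
      simp; ring
    rw [this, map_div₀, h, div_self]
    exact (Valuation.ne_zero_iff _).2 (pow_ne_zero 2 hx0)
  · right
    have hy0 : y ≠ 0 := by rintro rfl; simp at h
    apply mem_LS_of (z := (B * y)⁻¹)
    have : ((-(N * B) : Kˣ) : K) * (B * y)⁻¹ ^ 2 - 1 = - (x ^ 2 / (B * y ^ 2)) := by
      push_cast; rw [hN]; field_simp; ring
    rw [this, Valuation.map_neg, map_div₀, hodd.four]
    exact (div_lt_one₀ (lt_of_le_of_lt zero_le' h)).2 h

/-- anisotropy -/
lemma aniso {v : HeightOneSpectrum (𝓞 K)} {A B : Kˣ} (hB : Adm v B) (hA : A ∉ LN v B)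
    (α β γ : K) : vl v 4 ≤ vl v (1 - (A * α ^ 2 + B * β ^ 2 - A * B * γ ^ 2)) := by
  by_contra hcon
  push Not at hcon
  set ε : K := 1 - (A * α ^ 2 + B * β ^ 2 - A * B * γ ^ 2) with hε
  have hLS : B ∉ LS v := by
    intro h; apply hA; rw [LN_of_LS h]; trivial
  have h1 : vl v 4 ≤ vl v (1 - B * β ^ 2) := by
    by_contra h
    push Not at h
    apply hLS
    apply mem_LS_of (z := β)
    rwa [Valuation.map_sub_swap]
  have hlt : vl v ε < vl v (1 - B * β ^ 2) := lt_of_lt_of_le hcon h1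
  have hN1 : (1 - B * β ^ 2 : K) ≠ 0 := by
    intro h; rw [h, map_zero] at hlt; exact not_lt_zero hlt
  have hmul : (1 - B * β ^ 2 : K) * (1 - ε / (1 - B * β ^ 2)) = A * (α ^ 2 - B * γ ^ 2) := by
    field_simp; rw [hε]; ring
  have hu : vl v (ε / (1 - B * β ^ 2)) < 1 := by
    rw [map_div₀]
    exact (div_lt_one₀ (lt_of_le_of_lt zero_le' hlt)).2 hlt
  have hval : vl v (1 - ε / (1 - B * β ^ 2)) = 1 := Valuation.map_one_sub_of_lt _ hu
  have hu0 : (1 - ε / (1 - B * β ^ 2)) ≠ 0 := by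
    intro h; rw [h, map_zero] at hval; exact zero_ne_one hval
  have hN2 : (α ^ 2 - B * γ ^ 2 : K) ≠ 0 := by
    intro h
    rw [h, mul_zero] at hmul
    exact (mul_ne_zero hN1 hu0) hmul
  have e : A = Units.mk0 _ hN1 * Units.mk0 _ hu0 * (Units.mk0 _ hN2)⁻¹ := by
    rw [eq_mul_inv_iff_mul_eq]
    ext
    push_cast
    simp only [Units.val_mk0]
    exact hmul.symm
  apply hA
  rw [e]
  refine mul_mem (mul_mem ?_ ?_) (inv_mem ?_)
  · exact norm_mem_LN hB (x := 1) (y := β) (by simp)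
  · by_cases hUR : B ∈ UR v
    · rw [LN_of_UR hLS hUR]
      exact ⟨1, by simpa using hval⟩
    · apply LS_le_LN
      have hodd : Odd' v := hB.resolve_right hUR
      apply mem_LS_of (z := 1)
      simp only [Units.val_mk0, one_pow, mul_one]
      rw [hodd.four, sub_right_comm, sub_self, zero_sub, Valuation.map_neg]
      exact hu
  · exact norm_mem_LN hB (x := α) (y := γ) (by simp)

end UD

end

section
set_option linter.all false
open IsDedekindDomain NumberField WithZero
namespace UD

/-- index of the subgroup of squares -/
noncomputable def sqi (G : Type*) [CommGroup G] : ℕ := (powMonoidHom 2 : G →* G).range.index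

lemma sqi_ext {G H : Type*} [CommGroup G] [CommGroup H] (f : G →* H)
    (hf : Function.Surjective f) (hH : ∀ h : H, h ^ 2 = 1 → h = 1) :
    sqi G = sqi f.ker * sqi H := by
  have h1 : ((powMonoidHom 2 : H →* H).range.comap f) =
      (powMonoidHom 2 : G →* G).range ⊔ f.ker := by
    ext x
    rw [Subgroup.mem_comap, Subgroup.mem_sup]
    constructor
    · rintro ⟨h, hh⟩
      obtain ⟨g, rfl⟩ := hf h
      refine ⟨g ^ 2, ⟨g, rfl⟩, (g ^ 2)⁻¹ * x, ?_, by simp⟩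
      rw [MonoidHom.mem_ker, map_mul, ← hh]
      simp
    · rintro ⟨y, ⟨g, rfl⟩, z, hz, rfl⟩
      rw [MonoidHom.mem_ker] at hz
      exact ⟨f g, by simp [hz]⟩
  have h2 : (powMonoidHom 2 : G →* G).range.subgroupOf f.ker =
      (powMonoidHom 2 : f.ker →* f.ker).range := by
    ext ⟨x, hx⟩
    rw [Subgroup.mem_subgroupOf]
    constructor
    · rintro ⟨g, hg⟩
      have hg' : g ^ 2 = x := hg
      have : g ∈ f.ker := by
        rw [MonoidHom.mem_ker]
        apply hH
        rw [← map_pow, hg']; exact hx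
      exact ⟨⟨g, this⟩, Subtype.ext hg'⟩
    · rintro ⟨g, hg⟩
      exact ⟨g, congrArg Subtype.val hg⟩
  have h3 := Subgroup.relIndex_mul_index
    (le_sup_left : (powMonoidHom 2 : G →* G).range ≤ (powMonoidHom 2 : G →* G).range ⊔ f.ker)
  rw [Subgroup.relIndex_sup_left, ← h1, Subgroup.index_comap_of_surjective _ hf] at h3
  rw [sqi, ← h3, Subgroup.relIndex, h2]
  rfl

lemma sqi_congr {G H : Type*} [CommGroup G] [CommGroup H] (e : G ≃* H) : sqi G = sqi H := by
  rw [sqi, sqi, ← Subgroup.index_map_equiv _ e]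
  congr 1
  ext x
  constructor
  · rintro ⟨y, ⟨g, rfl⟩, rfl⟩
    exact ⟨e g, by simp⟩
  · rintro ⟨g, rfl⟩
    exact ⟨(e.symm g) ^ 2, ⟨e.symm g, rfl⟩, by simp⟩

lemma sqi_int_pi (n : ℕ) : sqi (Multiplicative (Fin n → ℤ)) = 2 ^ n := by
  rw [sqi, ← Subgroup.index_toAddSubgroup]
  have h : (AddSubgroup.pi Set.univ (fun _ : Fin n => AddSubgroup.zmultiples (2 : ℤ))).index = 2 ^ n := by
    rw [AddSubgroup.index_pi]
    simp [Int.index_zmultiples]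
  rw [← h]
  have e : (AddSubgroup.pi Set.univ (fun _ : Fin n => AddSubgroup.zmultiples (2 : ℤ))) =
     (AddSubgroup.toSubgroup.symm (powMonoidHom 2 : Multiplicative (Fin n → ℤ) →* _).range) := by
    ext x
    constructor
    · intro hx
      rw [AddSubgroup.mem_pi] at hx
      choose g hg using fun i => Int.mem_zmultiples_iff.1 (hx i trivial)
      refine ⟨Multiplicative.ofAdd g, ?_⟩
      ext i
      change (2 • g) i = x i
      rw [hg i]; simp
    · rintro ⟨g, hg⟩
      rw [AddSubgroup.mem_pi]
      intro i _
      rw [Int.mem_zmultiples_iff]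
      have : (2 • (Multiplicative.toAdd g)) = x := hg
      rw [← this]
      simp
  rw [e]
  rfl

lemma sqi_range_int {G : Type*} [CommGroup G] (f : G →* Multiplicative ℤ) (hf : f ≠ 1) :
    sqi f.range = 2 := by
  obtain ⟨g, hg⟩ := IsCyclic.exists_generator (α := f.range)
  have hg1 : g ≠ 1 := by
    rintro rfl
    apply hf
    ext x
    have := hg ⟨f x, x, rfl⟩
    rw [Subgroup.zpowers_one_eq_bot, Subgroup.mem_bot] at this
    have h2 := congrArg Subtype.val this
    simpa using congrArg Multiplicative.toAdd h2
  have hinj : ∀ n : ℤ, g ^ n = 1 → n = 0 := by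
    intro n hn
    have h1 := congrArg Subtype.val hn
    have h2 := congrArg Multiplicative.toAdd h1
    simp only [SubgroupClass.coe_zpow, toAdd_zpow, OneMemClass.coe_one, toAdd_one, smul_eq_mul] at h2
    rcases mul_eq_zero.1 h2 with h | h
    · exact h
    · exfalso; apply hg1; apply Subtype.ext; exact h
  rw [sqi, Subgroup.index_eq_two_iff_exists_notMem_and]
  refine ⟨g, ?_, ?_⟩
  · rintro ⟨y, hy⟩
    obtain ⟨n, rfl⟩ := hg y
    have : (g ^ n) ^ 2 = g := hy
    have h1 : g ^ (n * 2 - 1) = 1 := by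
      rw [zpow_sub, zpow_mul, zpow_one, zpow_two, ← sq, this, mul_inv_cancel]
    have := hinj _ h1
    omega
  · intro b
    obtain ⟨n, rfl⟩ := hg b
    rcases Int.even_or_odd' n with ⟨m, rfl | rfl⟩
    · right
      refine ⟨g ^ m, ?_⟩
      change (g ^ m) ^ 2 = g ^ (2 * m)
      rw [mul_comm, zpow_mul, zpow_two, sq]
    · left
      refine ⟨g ^ (m + 1), ?_⟩
      change (g ^ (m + 1)) ^ 2 = g ^ (2 * m + 1) * g
      rw [← zpow_add_one, sq, ← zpow_add]; congr 1; ring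

variable {K : Type*} [Field K] [NumberField K]

lemma sqi_torsion : sqi (Units.torsion K) = 2 := by
  have h1 := Subgroup.card_mul_index (powMonoidHom 2 : Units.torsion K →* Units.torsion K).ker
  rw [Subgroup.index_ker] at h1
  have h2 := Subgroup.card_mul_index (powMonoidHom 2 : Units.torsion K →* Units.torsion K).range
  rw [← h2, mul_comm] at h1
  have h3 := (Nat.eq_of_mul_eq_mul_left Nat.card_pos h1).symm
  rw [sqi, h3]
  have hm : (-1 : (𝓞 K)ˣ) ∈ Units.torsion K := by
    rw [Units.torsion, CommGroup.mem_torsion]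
    exact isOfFinOrder_iff_pow_eq_one.2 ⟨2, by norm_num, by simp⟩
  rw [Nat.card_eq_two_iff]
  refine ⟨1, ⟨⟨-1, hm⟩, ?_⟩, ?_, ?_⟩
  · rw [MonoidHom.mem_ker]; ext; simp
  · intro h
    have h1 : (1 : (𝓞 K)ˣ) = -1 := congrArg (fun x => (x.1.1 : (𝓞 K)ˣ)) h
    have h2 : (1 : 𝓞 K) = -1 := by
      have := congrArg Units.val h1; simpa using this
    have h3 : (1 : K) = -1 := by
      have := congrArg (algebraMap (𝓞 K) K) h2; simpa using this
    norm_num at h3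
  · rw [Set.eq_univ_iff_forall]
    rintro ⟨⟨x, hx⟩, hx2⟩
    have h1 : x ^ 2 = 1 := congrArg Subtype.val hx2
    have h2 : (x : 𝓞 K) ^ 2 = 1 := by
      have := congrArg Units.val h1; simpa using this
    rcases sq_eq_one_iff.1 h2 with h | h
    · left; apply Subtype.ext; apply Subtype.ext; exact Units.ext h
    · right; apply Subtype.ext; apply Subtype.ext; exact Units.ext (by simpa using h)

lemma sqi_of_basis {G : Type*} [CommGroup G] (T : Subgroup G) (n : ℕ)
    (b : Module.Basis (Fin n) ℤ (Additive (G ⧸ T))) (hT : sqi T = 2) : sqi G = 2 ^ (n + 1) := by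
  have e : (G ⧸ T) ≃* Multiplicative (Fin n → ℤ) :=
    AddEquiv.toMultiplicativeRight b.equivFun.toAddEquiv
  have htf : ∀ h : G ⧸ T, h ^ 2 = 1 → h = 1 := by
    intro h hh
    apply e.injective
    rw [map_one]
    have h1 : (e h) ^ 2 = 1 := by rw [← map_pow, hh, map_one]
    have h2 : 2 • Multiplicative.toAdd (e h) = 0 := h1
    rw [two_nsmul] at h2
    apply Multiplicative.toAdd.injective
    ext i
    have := congrFun h2 i
    simp at this
    simpa using this
  rw [sqi_ext (QuotientGroup.mk' T) (QuotientGroup.mk'_surjective _) htf,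
    sqi_congr e, sqi_int_pi, QuotientGroup.ker_mk', hT, ← pow_succ']

lemma sqi_units : sqi (𝓞 K)ˣ = 2 ^ Fintype.card (InfinitePlace K) := by
  rw [sqi_of_basis (NumberField.Units.torsion K) _ (NumberField.Units.basisModTorsion K) sqi_torsion]
  congr 1
  rw [NumberField.Units.rank]
  have : 0 < Fintype.card (InfinitePlace K) := Fintype.card_pos
  omega

end UD

end

section
set_option linter.all false
open IsDedekindDomain NumberField WithZero
open scoped nonZeroDivisors
namespace UD
variable {K : Type*} [Field K] [NumberField K]

/-- `T`-units -/
def KT (T : Finset (HeightOneSpectrum (𝓞 K))) : Subgroup Kˣ where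
  carrier := {x | ∀ v ∉ T, vl v (x : K) = 1}
  one_mem' := by intro v _; simp
  mul_mem' := by
    intro a b ha hb v hv
    rw [Units.val_mul, map_mul, ha v hv, hb v hv, mul_one]
  inv_mem' := by
    intro a ha v hv
    rw [Units.val_inv_eq_inv_val, map_inv₀, ha v hv, inv_one]

lemma mem_KT {T : Finset (HeightOneSpectrum (𝓞 K))} {x : Kˣ} :
    x ∈ KT T ↔ ∀ v ∉ T, vl v (x : K) = 1 := Iff.rfl

lemma KT_mono {S T : Finset (HeightOneSpectrum (𝓞 K))} (h : S ⊆ T) : KT S ≤ KT T :=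
  fun _ hx v hv => hx v (fun h' => hv (h h'))

/-- squares -/
def Sq (K : Type*) [Field K] : Subgroup Kˣ := (powMonoidHom 2 : Kˣ →* Kˣ).range

lemma mem_Sq {x : Kˣ} : x ∈ Sq K ↔ ∃ y, y ^ 2 = x := Iff.rfl

lemma Sq_le_LS (v : HeightOneSpectrum (𝓞 K)) : Sq K ≤ LS v := by
  rintro x ⟨y, rfl⟩; exact sq_mem_LS v y

lemma KT_of_sq {T : Finset (HeightOneSpectrum (𝓞 K))} {x : Kˣ} (h : x ^ 2 ∈ KT T) : x ∈ KT T := by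
  intro v hv
  have := h v hv
  rw [Units.val_pow_eq_pow_val, map_pow] at this
  exact (pow_eq_one_iff.1 this).resolve_right (by norm_num)

lemma relIndex_Sq_KT (T : Finset (HeightOneSpectrum (𝓞 K))) :
    (Sq K).relIndex (KT T) = sqi (KT T) := by
  rw [Subgroup.relIndex, sqi]
  congr 1
  ext ⟨x, hx⟩
  rw [Subgroup.mem_subgroupOf]
  constructor
  · rintro ⟨y, hy⟩
    have hy' : y ^ 2 = x := hy
    exact ⟨⟨y, KT_of_sq (hy' ▸ hx)⟩, Subtype.ext hy⟩
  · rintro ⟨y, hy⟩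
    exact ⟨y.1, congrArg Subtype.val hy⟩

lemma exists_pow_principal (q : HeightOneSpectrum (𝓞 K)) :
    ∃ h : ℕ, 0 < h ∧ ∃ a : 𝓞 K, a ≠ 0 ∧ q.asIdeal ^ h = Ideal.span {a} := by
  have hq : q.asIdeal ∈ (Ideal (𝓞 K))⁰ := mem_nonZeroDivisors_of_ne_zero q.ne_bot
  refine ⟨Fintype.card (ClassGroup (𝓞 K)), Fintype.card_pos, ?_⟩
  have h1 : ClassGroup.mk0 ((⟨q.asIdeal, hq⟩ : (Ideal (𝓞 K))⁰) ^ Fintype.card (ClassGroup (𝓞 K))) = 1 := by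
    rw [map_pow, pow_card_eq_one]
  rw [ClassGroup.mk0_eq_one_iff] at h1
  obtain ⟨a, ha⟩ := h1
  have ha' : q.asIdeal ^ Fintype.card (ClassGroup (𝓞 K)) = Ideal.span {a} := ha
  refine ⟨a, ?_, ha'⟩
  rintro rfl
  rw [Ideal.span_singleton_eq_bot.2 rfl] at ha'
  exact q.ne_bot (pow_eq_zero_iff (n := Fintype.card (ClassGroup (𝓞 K))) Fintype.card_ne_zero |>.1 ha')

lemma vl_eq_one_iff (v : HeightOneSpectrum (𝓞 K)) (a : 𝓞 K) :
    vl v (algebraMap (𝓞 K) K a) = 1 ↔ a ∉ v.asIdeal :=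
  HeightOneSpectrum.valuation_eq_one_iff_notMem (K := K) v

lemma hos_eq_of_le {v q : HeightOneSpectrum (𝓞 K)} (h : q.asIdeal ≤ v.asIdeal) : v = q := by
  apply HeightOneSpectrum.ext
  exact (q.isMaximal.eq_of_le v.isPrime.ne_top h).symm

lemma exists_KT_single (q : HeightOneSpectrum (𝓞 K)) :
    ∃ x : Kˣ, x ∈ KT {q} ∧ vl q (x : K) ≠ 1 := by
  obtain ⟨h, h0, a, ha, hq⟩ := exists_pow_principal q
  have ha' : algebraMap (𝓞 K) K a ≠ 0 := by simpa using ha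
  have hmem : a ∈ q.asIdeal ^ h := hq ▸ Ideal.mem_span_singleton_self a
  refine ⟨Units.mk0 _ ha', ?_, ?_⟩
  · intro v hv
    rw [Units.val_mk0, vl_eq_one_iff]
    intro hav
    have h1 : q.asIdeal ^ h ≤ v.asIdeal := by rw [hq, Ideal.span_singleton_le_iff_mem]; exact hav
    have h2 := v.isPrime.le_of_pow_le h1
    exact hv (Finset.mem_singleton.2 (hos_eq_of_le h2))
  · rw [Units.val_mk0, Ne, vl_eq_one_iff, not_not]
    exact Ideal.pow_le_self h0.ne' hmem

lemma sqi_KT_empty : sqi (KT (∅ : Finset (HeightOneSpectrum (𝓞 K)))) = sqi (𝓞 K)ˣ := by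
  symm
  refine sqi_congr (MulEquiv.ofBijective
    ((Units.map (algebraMap (𝓞 K) K).toMonoidHom).codRestrict (KT ∅) ?_) ⟨?_, ?_⟩)
  · intro u v _
    change vl v (algebraMap (𝓞 K) K u) = 1
    rw [vl_eq_one_iff]
    intro h
    exact v.isPrime.ne_top (Ideal.eq_top_of_isUnit_mem _ h u.isUnit)
  · intro a b h
    have this : algebraMap (𝓞 K) K a = algebraMap (𝓞 K) K b :=
      Units.ext_iff.1 (Subtype.ext_iff.1 h)
    exact Units.ext (FaithfulSMul.algebraMap_injective (𝓞 K) K this)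
  · rintro ⟨x, hx⟩
    have h1 : ∀ v : HeightOneSpectrum (𝓞 K), v.valuation K (x : K) ≤ 1 := fun v => (hx v (by simp)).le
    have h2 : ∀ v : HeightOneSpectrum (𝓞 K), v.valuation K ((x⁻¹ : Kˣ) : K) ≤ 1 := fun v =>
      ((KT ∅).inv_mem hx v (by simp)).le
    obtain ⟨a, ha⟩ := HeightOneSpectrum.mem_integers_of_valuation_le_one K _ h1
    obtain ⟨b, hb⟩ := HeightOneSpectrum.mem_integers_of_valuation_le_one K _ h2
    have hab : a * b = 1 := by
      apply FaithfulSMul.algebraMap_injective (𝓞 K) K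
      rw [map_mul, ha, hb, map_one, ← Units.val_mul, mul_inv_cancel, Units.val_one]
    refine ⟨⟨a, b, hab, by rw [mul_comm, hab]⟩, ?_⟩
    apply Subtype.ext; apply Units.ext
    exact ha

lemma vnz_eq_one (v : HeightOneSpectrum (𝓞 K)) (x : Kˣ) :
    v.valuationOfNeZero x = 1 ↔ vl v (x : K) = 1 := by
  rw [vl, ← HeightOneSpectrum.valuationOfNeZero_eq]
  exact ⟨fun h => by rw [h]; rfl, fun h => WithZero.coe_injective h⟩

lemma sqi_step {A : Type*} [CommGroup A] (G H : Subgroup A) (φ : A →* Multiplicative ℤ)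
    (key : ∀ x, x ∈ H ↔ x ∈ G ∧ φ x = 1) (hne : ∃ x ∈ G, φ x ≠ 1) : sqi G = sqi H * 2 := by
  set f : G →* Multiplicative ℤ := φ.comp G.subtype with hf
  have hne : f ≠ 1 := by
    obtain ⟨x, hx, hx1⟩ := hne
    intro h
    exact hx1 (DFunLike.congr_fun h ⟨x, hx⟩)
  have hrange : ∀ h : f.range, h ^ 2 = 1 → h = 1 := by
    rintro ⟨h, hh⟩ h2
    have h3 : h ^ 2 = 1 := congrArg Subtype.val h2
    apply Subtype.ext
    change h = 1
    have h4 := congrArg Multiplicative.toAdd h3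
    rw [toAdd_pow, toAdd_one, two_nsmul] at h4
    apply Multiplicative.toAdd.injective
    rw [toAdd_one]; omega
  rw [sqi_ext f.rangeRestrict f.rangeRestrict_surjective hrange, sqi_range_int f hne,
    MonoidHom.ker_rangeRestrict]
  congr 1
  refine sqi_congr (MulEquiv.ofBijective
    (((G.subtype.comp f.ker.subtype)).codRestrict H ?_) ⟨?_, ?_⟩)
  · rintro ⟨⟨x, hx⟩, hx2⟩
    exact (key x).2 ⟨hx, hx2⟩
  · intro a b h
    have := congrArg Subtype.val h
    exact Subtype.ext (Subtype.ext this)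
  · rintro ⟨x, hx⟩
    have := (key x).1 hx
    exact ⟨⟨⟨x, this.1⟩, this.2⟩, rfl⟩

open Classical in
lemma sqi_KT (T : Finset (HeightOneSpectrum (𝓞 K))) :
    sqi (KT T) = 2 ^ (Fintype.card (InfinitePlace K) + T.card) := by
  induction T using Finset.induction_on with
  | empty => rw [sqi_KT_empty, sqi_units]; simp
  | insert q T hq ih =>
    rw [Finset.card_insert_of_notMem hq, ← add_assoc, pow_succ, ← ih]
    refine sqi_step (KT (insert q T)) (KT T) (q.valuationOfNeZero (K := K)) ?_ ?_
    · intro x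
      rw [vnz_eq_one]
      constructor
      · intro h; exact ⟨KT_mono (by simp) h, h q hq⟩
      · rintro ⟨h1, h2⟩ v hv
        by_cases hvq : v = q
        · rw [hvq]; exact h2
        · exact h1 v (by simp [hvq, hv])
    · obtain ⟨x, hx, hx1⟩ := exists_KT_single q
      refine ⟨x, KT_mono (by simp) hx, ?_⟩
      rwa [Ne, vnz_eq_one]

lemma relIndex_Sq (T : Finset (HeightOneSpectrum (𝓞 K))) :
    (Sq K).relIndex (KT T) = 2 ^ (Fintype.card (InfinitePlace K) + T.card) := by
  rw [relIndex_Sq_KT, sqi_KT]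

/-! Large sets -/

def Large (T : Finset (HeightOneSpectrum (𝓞 K))) : Prop :=
  (∀ v, ¬ Odd' v → v ∈ T) ∧ ∀ q ∉ T, ∃ w : Kˣ, vl q (w : K) = exp (-1 : ℤ) ∧
    ∀ v ∉ T, v ≠ q → vl v (w : K) = 1

lemma Large.mono {S T : Finset (HeightOneSpectrum (𝓞 K))} (h : Large S) (hST : S ⊆ T) :
    Large T := by
  refine ⟨fun v hv => hST (h.1 v hv), fun q hq => ?_⟩
  obtain ⟨w, hw, hw'⟩ := h.2 q (fun h' => hq (hST h'))
  exact ⟨w, hw, fun v hv hvq => hw' v (fun h' => hv (hST h')) hvq⟩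

lemma finite_vl_ne_one (x : Kˣ) : {v : HeightOneSpectrum (𝓞 K) | vl v (x : K) ≠ 1}.Finite := by
  obtain ⟨a, b, hb, hab⟩ := IsFractionRing.div_surjective (A := 𝓞 K) (x : K)
  have hb0 : b ≠ 0 := nonZeroDivisors.ne_zero hb
  have ha0 : a ≠ 0 := by
    rintro rfl
    rw [map_zero, zero_div] at hab
    exact x.ne_zero hab.symm
  have h1 := Ideal.finite_factors (I := Ideal.span {a}) (by simpa using ha0)
  have h2 := Ideal.finite_factors (I := Ideal.span {b}) (by simpa using hb0)
  refine (h1.union h2).subset ?_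
  intro v hv
  by_contra hcon
  simp only [Set.mem_union, Set.mem_setOf_eq, Ideal.dvd_span_singleton, not_or] at hcon
  apply hv
  rw [← hab, map_div₀, (vl_eq_one_iff v a).2 hcon.1, (vl_eq_one_iff v b).2 hcon.2, div_one]

lemma finite_not_odd : {v : HeightOneSpectrum (𝓞 K) | ¬ Odd' v}.Finite := by
  have := finite_vl_ne_one (K := K) (Units.mk0 2 two_ne_zero)
  exact this

lemma vl_of_prod {q v : HeightOneSpectrum (𝓞 K)} {J : Ideal (𝓞 K)} {a : 𝓞 K}
    (ha : q.asIdeal * J = Ideal.span {a}) (hv : ¬ J ≤ v.asIdeal) (hvq : v ≠ q) :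
    vl v (algebraMap (𝓞 K) K a) = 1 := by
  rw [vl_eq_one_iff]
  intro hav
  have h2 : q.asIdeal * J ≤ v.asIdeal := by
    rw [ha, Ideal.span_singleton_le_iff_mem]; exact hav
  rcases v.isPrime.mul_le.1 h2 with h | h
  · exact hvq (hos_eq_of_le h)
  · exact hv h

lemma vl_of_prod_self {q : HeightOneSpectrum (𝓞 K)} {J : Ideal (𝓞 K)} {a : 𝓞 K} (ha0 : a ≠ 0)
    (ha' : q.asIdeal * J = Ideal.span {a}) (hv : ¬ J ≤ q.asIdeal) :
    vl q (algebraMap (𝓞 K) K a) = exp (-1 : ℤ) := by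
  have hmem : a ∈ q.asIdeal * J := ha' ▸ Ideal.mem_span_singleton_self a
  have hak : algebraMap (𝓞 K) K a ≠ 0 := by simpa using ha0
  have h2 : vl q (algebraMap (𝓞 K) K a) ≤ exp (-((1 : ℕ) : ℤ)) := by
    have hq1 : a ∈ q.asIdeal := by
      have hle : q.asIdeal * J ≤ q.asIdeal := Ideal.mul_le_left
      exact hle hmem
    rw [vl_algebraMap_le_iff, pow_one]
    exact hq1
  have hq0 : q.asIdeal ≠ 0 := q.ne_bot
  have h3 : ¬ vl q (algebraMap (𝓞 K) K a) ≤ exp (-((2 : ℕ) : ℤ)) := by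
    rw [vl_algebraMap_le_iff]
    intro h
    have h4 : q.asIdeal * J ≤ q.asIdeal * q.asIdeal := by
      rw [ha', Ideal.span_singleton_le_iff_mem, ← sq]; exact h
    have h5 : q.asIdeal * q.asIdeal ∣ q.asIdeal * J := Ideal.dvd_iff_le.2 h4
    have h6 : q.asIdeal ∣ J := by
      obtain ⟨L, hL⟩ := h5
      rw [mul_assoc] at hL
      exact ⟨L, mul_left_cancel₀ hq0 hL⟩
    exact hv (Ideal.dvd_iff_le.1 h6)
  obtain ⟨n, hn⟩ := vl_unit_eq q (Units.mk0 _ hak)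
  rw [Units.val_mk0] at hn
  rw [hn] at h2 h3 ⊢
  rw [WithZero.exp_le_exp] at h2 h3
  congr 1
  push_cast at h2 h3; omega

open Classical in
lemma exists_Large (T0 : Finset (HeightOneSpectrum (𝓞 K))) : ∃ T, T0 ⊆ T ∧ Large T := by
  choose J hJ using fun c : ClassGroup (𝓞 K) => ClassGroup.mk0_surjective (R := 𝓞 K) c
  have hfin : ∀ c, {v : HeightOneSpectrum (𝓞 K) | v.asIdeal ∣ (J c : Ideal (𝓞 K))}.Finite :=
    fun c => Ideal.finite_factors (nonZeroDivisors.ne_zero (J c).2)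
  obtain ⟨T, hT⟩ : ∃ T : Finset (HeightOneSpectrum (𝓞 K)),
      T = T0 ∪ finite_not_odd.toFinset ∪ Finset.univ.biUnion (fun c => (hfin c).toFinset) := ⟨_, rfl⟩
  have hmem : ∀ v c, (J c : Ideal (𝓞 K)) ≤ v.asIdeal → v ∈ T := by
    intro v c h
    rw [hT]
    refine Finset.mem_union_right _ (Finset.mem_biUnion.2 ⟨c, Finset.mem_univ _, ?_⟩)
    exact (Set.Finite.mem_toFinset _).2 (Ideal.dvd_iff_le.2 h)
  refine ⟨T, ?_, ?_, ?_⟩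
  · rw [hT]; exact Finset.subset_union_left.trans Finset.subset_union_left
  · intro v hv
    rw [hT]
    exact Finset.mem_union_left _ (Finset.mem_union_right _ ((Set.Finite.mem_toFinset _).2 hv))
  · intro q hq
    have hq0 : q.asIdeal ∈ (Ideal (𝓞 K))⁰ := mem_nonZeroDivisors_of_ne_zero q.ne_bot
    have h1 : ClassGroup.mk0 (⟨q.asIdeal, hq0⟩ * J (ClassGroup.mk0 ⟨q.asIdeal, hq0⟩)⁻¹) = 1 := by
      rw [map_mul, hJ, mul_inv_cancel]
    rw [ClassGroup.mk0_eq_one_iff] at h1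
    generalize (ClassGroup.mk0 (⟨q.asIdeal, hq0⟩ : (Ideal (𝓞 K))⁰))⁻¹ = c at h1
    obtain ⟨a, ha⟩ := h1
    have ha' : q.asIdeal * (J c : Ideal (𝓞 K)) = Ideal.span {a} := ha
    have hJ0 : (J c : Ideal (𝓞 K)) ≠ 0 := nonZeroDivisors.ne_zero (J c).2
    have ha0 : a ≠ 0 := by
      rintro rfl
      rw [Ideal.span_singleton_eq_bot.2 rfl] at ha'
      rcases mul_eq_zero.1 ha' with h | h
      · exact q.ne_bot h
      · exact hJ0 h
    have hak : algebraMap (𝓞 K) K a ≠ 0 := by simpa using ha0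
    refine ⟨Units.mk0 _ hak, ?_, ?_⟩
    · exact vl_of_prod_self ha0 ha' (fun h => hq (hmem _ _ h))
    · intro v hv hvq
      exact vl_of_prod ha' (fun h => hv (hmem _ _ h)) hvq

open Classical in
lemma Large.approx {T : Finset (HeightOneSpectrum (𝓞 K))} (hT : Large T) {x : Kˣ}
    (hx : ∀ v ∉ T, x ∈ EV v) : ∃ c : Kˣ, ∀ v ∉ T, vl v (x : K) = vl v (c : K) ^ 2 := by
  choose w hw hw' using hT.2
  have hk : ∀ v : HeightOneSpectrum (𝓞 K), ∃ k : ℤ, v ∉ T → vl v (x : K) = exp (-2 * k) := by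
    intro v
    by_cases hv : v ∈ T
    · exact ⟨0, fun h => absurd hv h⟩
    · obtain ⟨n, hn⟩ := vl_unit_eq v x
      obtain ⟨m, hm⟩ := (mem_EV_iff hn).1 (hx v hv)
      exact ⟨-m, fun _ => by rw [hn, hm]; congr 1; ring⟩
  choose k hk using hk
  set S := (finite_vl_ne_one x).toFinset with hS
  set c : Kˣ := ∏ q ∈ S, (if h : q ∈ T then 1 else w q h ^ (k q)) with hc
  refine ⟨c, fun v hv => ?_⟩
  have hval : vl v (c : K) = ∏ q ∈ S, (if q = v then exp (- k v) else 1) := by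
    rw [hc, Units.coe_prod, map_prod]
    refine Finset.prod_congr rfl fun q _ => ?_
    by_cases hq : q ∈ T
    · rw [dif_pos hq, if_neg (by rintro rfl; exact hv hq)]; simp
    · rw [dif_neg hq, Units.val_zpow_eq_zpow_val, map_zpow₀]
      by_cases hqv : q = v
      · subst hqv
        rw [if_pos rfl, hw q hq, ← WithZero.exp_zsmul, smul_eq_mul]; congr 1; ring
      · rw [if_neg hqv, hw' q hq v hv (Ne.symm hqv), one_zpow]
  rw [hval, Finset.prod_ite_eq']
  split_ifs with hvS
  · rw [hk v hv, ← WithZero.exp_nsmul]; congr 1; simp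
  · have : vl v (x : K) = 1 := by
      by_contra h
      exact hvS ((Set.Finite.mem_toFinset _).2 h)
    rw [this, one_pow]

lemma Large.exists_KT {T : Finset (HeightOneSpectrum (𝓞 K))} (hT : Large T) {x : Kˣ}
    (hx : ∀ v ∉ T, x ∈ EV v) : ∃ κ ∈ KT T, ∃ c : Kˣ, x = κ * c ^ 2 := by
  obtain ⟨c, hc⟩ := hT.approx hx
  refine ⟨x * (c ^ 2)⁻¹, ?_, c, by simp⟩
  intro v hv
  have : vl v (c : K) ^ 2 ≠ 0 := pow_ne_zero _ ((Valuation.ne_zero_iff _).2 c.ne_zero)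
  rw [Units.val_mul, Units.val_inv_eq_inv_val, map_mul, map_inv₀, Units.val_pow_eq_pow_val,
    map_pow, hc v hv, mul_inv_cancel₀ this]

end UD

end

section
set_option linter.all false
open IsDedekindDomain NumberField WithZero
namespace UD

/-- a quadratic extension `M = K(√B)` -/
structure Quad (K M : Type*) [Field K] [Field M] [Algebra K M] (B : Kˣ) where
  β : Mˣ
  sq : (β : M) ^ 2 = algebraMap K M B
  σ : M ≃ₐ[K] M
  σβ : σ β = - β
  rep : ∀ z : M, ∃ a b : K, z = algebraMap K M a + algebraMap K M b * β
  nsq : B ∉ Sq K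

lemma not_sq_of {K : Type*} [Field K] {B : Kˣ} (h : B ∉ Sq K) (r : K) : r ^ 2 ≠ B := by
  intro hr
  have : r ≠ 0 := by
    rintro rfl
    exact B.ne_zero (by rw [← hr]; simp)
  exact h ⟨Units.mk0 r this, Units.ext (by simpa using hr)⟩

universe u in
lemma exists_quad {K : Type u} [Field K] [NumberField K] (B : Kˣ) (hB : B ∉ Sq K) :
    ∃ (M : Type u) (_ : Field M) (_ : NumberField M) (_ : Algebra K M), Nonempty (Quad K M B) := by
  haveI : Fact (∀ r : K, r ^ 2 ≠ (B : K) + 0 * r) :=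
    ⟨fun r => by rw [zero_mul, add_zero]; exact not_sq_of hB r⟩
  haveI : FiniteDimensional ℚ (QuadraticAlgebra K (B : K) 0) := Module.Finite.trans K _
  have hN : NumberField (QuadraticAlgebra K (B : K) 0) := ⟨⟩
  refine ⟨QuadraticAlgebra K (B : K) 0, inferInstance, hN, inferInstance, ⟨?_⟩⟩
  have hω : (QuadraticAlgebra.omega : QuadraticAlgebra K (B : K) 0) ≠ 0 := by
    intro h
    have := congrArg QuadraticAlgebra.im h
    simp at this
  refine ⟨Units.mk0 QuadraticAlgebra.omega hω, ?_,
    AlgEquiv.ofRingEquiv (f := ⟨⟨star, star, fun x => star_star x, fun x => star_star x⟩,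
      fun x y => by change star (x * y) = star x * star y; rw [star_mul, mul_comm],
      fun x y => star_add x y⟩) ?_, ?_, ?_, hB⟩
  · rw [Units.val_mk0, sq]
    ext <;> simp
  · intro r
    change star (algebraMap K (QuadraticAlgebra K (B : K) 0) r) = algebraMap K _ r
    ext <;> simp
  · change star (QuadraticAlgebra.omega : QuadraticAlgebra K (B : K) 0) = - QuadraticAlgebra.omega
    ext <;> simp
  · intro z
    refine ⟨z.re, z.im, ?_⟩
    ext <;> simp

section up
variable (K : Type*) {M : Type*} [Field K] [NumberField K] [Field M] [NumberField M] [Algebra K M]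

variable (M) in
/-- the inclusion on units -/
noncomputable def up : Kˣ →* Mˣ := Units.map (algebraMap K M).toMonoidHom

@[simp] lemma up_val (x : Kˣ) : ((up K M x : Mˣ) : M) = algebraMap K M x := rfl

lemma up_inj : Function.Injective (up K M) := by
  intro a b h
  exact Units.ext ((algebraMap K M).injective (Units.ext_iff.1 h))

/-- the prime below -/
noncomputable def dn (w : HeightOneSpectrum (𝓞 M)) : HeightOneSpectrum (𝓞 K) := w.under (𝓞 K)

lemma vl_up (w : HeightOneSpectrum (𝓞 M)) : ∃ e : ℕ, e ≠ 0 ∧ ∀ x : K,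
    vl w (algebraMap K M x) = vl (dn K w) x ^ e := by
  haveI : w.asIdeal.LiesOver (dn K w).asIdeal := ⟨rfl⟩
  refine ⟨(dn K w).asIdeal.ramificationIdx' w.asIdeal, ?_, fun x => ?_⟩
  · exact Ideal.IsDedekindDomain.ramificationIdx'_ne_zero_of_liesOver w.asIdeal (dn K w).ne_bot
  · exact (HeightOneSpectrum.valuation_liesOver M (dn K w) w x).symm

lemma vl_up_lt_iff (w : HeightOneSpectrum (𝓞 M)) (x y : K) :
    vl w (algebraMap K M x) < vl w (algebraMap K M y) ↔ vl (dn K w) x < vl (dn K w) y := by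
  obtain ⟨e, he, h⟩ := vl_up K w
  rw [h, h]
  exact pow_lt_pow_iff_left₀ zero_le' zero_le' he

lemma vl_up_le_iff (w : HeightOneSpectrum (𝓞 M)) (x y : K) :
    vl w (algebraMap K M x) ≤ vl w (algebraMap K M y) ↔ vl (dn K w) x ≤ vl (dn K w) y := by
  rw [← not_lt, vl_up_lt_iff, not_lt]

lemma vl_up_eq_one_iff (w : HeightOneSpectrum (𝓞 M)) (x : K) :
    vl w (algebraMap K M x) = 1 ↔ vl (dn K w) x = 1 := by
  have h1 := vl_up_le_iff K w x 1
  have h2 := vl_up_le_iff K w 1 x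
  simp only [map_one] at h1 h2
  rw [le_antisymm_iff, h1, h2, ← le_antisymm_iff]

lemma Odd'.up {w : HeightOneSpectrum (𝓞 M)} : Odd' w ↔ Odd' (dn K w) := by
  have := vl_up_eq_one_iff K w 2
  rwa [map_ofNat] at this

lemma LS.up {w : HeightOneSpectrum (𝓞 M)} {x : Kˣ} (h : x ∈ LS (dn K w)) : up K M x ∈ LS w := by
  obtain ⟨z, hz⟩ := h
  refine ⟨UD.up K M z, ?_⟩
  rw [← vl_up_lt_iff K w, map_ofNat (algebraMap K M) 4] at hz
  simpa using hz

lemma EV.up {w : HeightOneSpectrum (𝓞 M)} {x : Kˣ} (h : x ∈ EV (dn K w)) : up K M x ∈ EV w := by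
  obtain ⟨z, hz⟩ := h
  refine ⟨UD.up K M z, ?_⟩
  rw [← vl_up_eq_one_iff K w] at hz
  simpa using hz

lemma UR.up {w : HeightOneSpectrum (𝓞 M)} {x : Kˣ} (h : x ∈ UR (dn K w)) : up K M x ∈ UR w := by
  obtain ⟨z, hz, hz'⟩ := h
  refine ⟨UD.up K M z, ?_, ?_⟩
  · rw [← vl_up_eq_one_iff K w] at hz
    simpa using hz
  · rw [← vl_up_le_iff K w, map_ofNat (algebraMap K M) 4] at hz'
    simpa using hz'

variable (M) in
lemma exists_over (v : HeightOneSpectrum (𝓞 K)) : ∃ w : HeightOneSpectrum (𝓞 M), dn K w = v := by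
  haveI := v.isMaximal
  obtain ⟨Q, hQ, hQ'⟩ := Ideal.exists_maximal_ideal_liesOver_of_isIntegral (S := 𝓞 M) v.asIdeal
  have hne : Q ≠ ⊥ := by
    rintro rfl
    have h := hQ'.over
    rw [Ideal.under_bot] at h
    exact v.ne_bot h
  exact ⟨⟨Q, hQ.isPrime, hne⟩, HeightOneSpectrum.ext hQ'.over.symm⟩

variable (M) in
lemma finite_over (v : HeightOneSpectrum (𝓞 K)) :
    {w : HeightOneSpectrum (𝓞 M) | dn K w = v}.Finite := by
  obtain ⟨x, hx, hx1⟩ := exists_KT_single v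
  refine (finite_vl_ne_one (up K M x)).subset ?_
  intro w hw
  have hw' : dn K w = v := hw
  rw [Set.mem_setOf_eq, up_val, Ne, vl_up_eq_one_iff, hw']
  exact hx1

lemma hos_equiv (w : HeightOneSpectrum (𝓞 M)) (σ : M ≃ₐ[K] M) :
    ∃ w' : HeightOneSpectrum (𝓞 M), dn K w' = dn K w ∧ ∀ z : M, vl w' z = vl w (σ z) := by
  let s : 𝓞 M ≃+* 𝓞 M := RingOfIntegers.mapRingEquiv σ.toRingEquiv
  have hs : ∀ a : 𝓞 M, algebraMap (𝓞 M) M (s a) = σ (algebraMap (𝓞 M) M a) := fun a => rfl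
  let w' : HeightOneSpectrum (𝓞 M) := HeightOneSpectrum.equivOfRingEquiv s.symm w
  have hw' : w'.asIdeal = w.asIdeal.map s.symm := (Ideal.map_symm s).symm
  have hInt : ∀ (a : 𝓞 M) (n : ℕ), vl w' (algebraMap (𝓞 M) M a) ≤ exp (-(n : ℤ)) ↔
      vl w (algebraMap (𝓞 M) M (s a)) ≤ exp (-(n : ℤ)) := by
    intro a n
    rw [vl_algebraMap_le_iff, vl_algebraMap_le_iff, hw', ← Ideal.map_pow, Ideal.map_symm,
      Ideal.mem_comap]
  have hInt' : ∀ a : 𝓞 M, vl w' (algebraMap (𝓞 M) M a) = vl w (algebraMap (𝓞 M) M (s a)) := by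
    intro a
    by_cases ha : a = 0
    · simp [ha]
    have key : ∀ (u : HeightOneSpectrum (𝓞 M)) (b : 𝓞 M), b ≠ 0 → ∃ n : ℕ,
        vl u (algebraMap (𝓞 M) M b) = exp (-(n : ℤ)) := by
      intro u b hb
      obtain ⟨n, hn⟩ := vl_unit_eq u (Units.mk0 (algebraMap (𝓞 M) M b) (by simpa using hb))
      have h1 : vl u (algebraMap (𝓞 M) M b) ≤ 1 := u.valuation_le_one b
      rw [Units.val_mk0] at hn
      rw [hn, ← WithZero.exp_zero, WithZero.exp_le_exp] at h1
      exact ⟨n.natAbs, by rw [hn]; congr 1; omega⟩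
    obtain ⟨n, hn⟩ := key w' a ha
    obtain ⟨m, hm⟩ := key w (s a) (by simpa using ha)
    have h1 := (hInt a n).1 hn.le
    have h2 := (hInt a m).2 hm.le
    rw [hm, WithZero.exp_le_exp] at h1
    rw [hn, WithZero.exp_le_exp] at h2
    rw [hn, hm]; congr 1; omega
  refine ⟨w', ?_, ?_⟩
  · apply HeightOneSpectrum.ext
    ext a
    change algebraMap (𝓞 K) (𝓞 M) a ∈ w'.asIdeal ↔ algebraMap (𝓞 K) (𝓞 M) a ∈ w.asIdeal
    rw [hw', Ideal.map_symm, Ideal.mem_comap]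
    have : s (algebraMap (𝓞 K) (𝓞 M) a) = algebraMap (𝓞 K) (𝓞 M) a := by
      apply FaithfulSMul.algebraMap_injective (𝓞 M) M
      rw [hs]
      exact σ.commutes (a : K)
    change s (algebraMap (𝓞 K) (𝓞 M) a) ∈ w.asIdeal ↔ _
    rw [this]
  · intro z
    obtain ⟨a, b, hb, rfl⟩ := IsFractionRing.div_surjective (A := 𝓞 M) z
    rw [map_div₀, map_div₀, map_div₀, hInt', hInt', hs, hs]

end up
end UD

end

section
set_option linter.all false
open IsDedekindDomain NumberField WithZero
namespace UD

/-- totally positive -/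
def TP (K : Type*) [Field K] : Subgroup Kˣ where
  carrier := {x | ∀ φ : K →+* ℝ, 0 < φ x}
  one_mem' := by intro φ; simp
  mul_mem' := by
    intro a b ha hb φ
    rw [Units.val_mul, map_mul]; exact mul_pos (ha φ) (hb φ)
  inv_mem' := by
    intro a ha φ
    rw [Units.val_inv_eq_inv_val, map_inv₀]; exact inv_pos.2 (ha φ)

lemma mem_TP {K : Type*} [Field K] {x : Kˣ} : x ∈ TP K ↔ ∀ φ : K →+* ℝ, 0 < φ x := Iff.rfl

lemma Sq_le_TP {K : Type*} [Field K] : Sq K ≤ TP K := by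
  rintro x ⟨y, rfl⟩ φ
  change 0 < φ ((y ^ 2 : Kˣ) : K)
  rw [Units.val_pow_eq_pow_val, map_pow]
  exact pow_pos_of_ne φ y
where
  pow_pos_of_ne {K : Type _} [Field K] (φ : K →+* ℝ) (y : Kˣ) : 0 < φ y ^ 2 :=
    lt_of_le_of_ne (sq_nonneg _) (Ne.symm (pow_ne_zero _ ((map_ne_zero φ).2 y.ne_zero)))

lemma TP_index {K : Type*} [Field K] [NumberField K] :
    (TP K).relIndex ⊤ ≠ 0 ∧ (TP K).relIndex ⊤ ≤ 2 ^ InfinitePlace.nrRealPlaces K := by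
  classical
  let ι : (K →+* ℝ) → {φ : K →+* ℂ // ComplexEmbedding.IsReal φ} := fun f =>
    ⟨Complex.ofRealHom.comp f, by
      rw [ComplexEmbedding.isReal_iff]
      ext x
      simp⟩
  have hι : Function.Injective ι := by
    intro f g h
    ext x
    have := RingHom.congr_fun (congrArg Subtype.val h) x
    exact Complex.ofReal_injective this
  haveI : Finite (K →+* ℝ) := Finite.of_injective ι hι
  have hcard : Nat.card (K →+* ℝ) ≤ InfinitePlace.nrRealPlaces K := by
    rw [← InfinitePlace.card_real_embeddings, ← Nat.card_eq_fintype_card]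
    exact Nat.card_le_card_of_injective ι hι
  have h := relIndex_le_of_fun (H := TP K) (L := ⊤) (X := (K →+* ℝ) → Bool)
    (fun a φ => decide (0 < φ (a.1 : K))) (by
      intro a b hab φ
      have h1 := congrFun hab φ
      simp only [decide_eq_decide] at h1
      have ha : φ (a.1 : K) ≠ 0 := (map_ne_zero φ).2 a.1.ne_zero
      have hb : φ (b.1 : K) ≠ 0 := (map_ne_zero φ).2 b.1.ne_zero
      rw [Units.val_mul, Units.val_inv_eq_inv_val, map_mul, map_inv₀]
      rcases lt_or_gt_of_ne ha with h | h
      · have h' : φ (b.1 : K) < 0 := lt_of_le_of_ne (not_lt.1 (fun hh => (h1.2 hh).not_gt h)) hb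
        exact mul_pos_of_neg_of_neg (inv_lt_zero.2 h) h'
      · exact mul_pos (inv_pos.2 h) (h1.1 h))
  refine ⟨h.1, h.2.trans ?_⟩
  rw [Nat.card_fun, Nat.card_eq_fintype_card, Fintype.card_bool]
  exact Nat.pow_le_pow_right (by norm_num) hcard

lemma TP.up {K M : Type*} [Field K] [NumberField K] [Field M] [NumberField M] [Algebra K M] {x : Kˣ} (h : x ∈ TP K) :
    up K M x ∈ TP M := fun φ => h (φ.comp (algebraMap K M))

namespace Quad
variable {K M : Type*} [Field K] [NumberField K] [Field M] [NumberField M] [Algebra K M] {B : Kˣ}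
  (Q : Quad K M B)

lemma indep {a b : K} (h : algebraMap K M a + algebraMap K M b * Q.β = 0) : a = 0 ∧ b = 0 := by
  have hb : b = 0 := by
    by_contra hb
    apply not_sq_of Q.nsq (a / b)
    apply (algebraMap K M).injective
    have hb' : algebraMap K M b ≠ 0 := (map_ne_zero _).2 hb
    have h1 : algebraMap K M a = - (algebraMap K M b * Q.β) := eq_neg_of_add_eq_zero_left h
    rw [map_pow, map_div₀, h1, ← Q.sq]; field_simp
  subst hb
  simpa using h

lemma σ_rep (a b : K) : Q.σ (algebraMap K M a + algebraMap K M b * Q.β) =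
    algebraMap K M a - algebraMap K M b * Q.β := by
  rw [map_add, map_mul, Q.σ.commutes, Q.σ.commutes, Q.σβ]; ring

lemma σσ (z : M) : Q.σ (Q.σ z) = z := by
  obtain ⟨a, b, rfl⟩ := Q.rep z
  rw [Q.σ_rep, sub_eq_add_neg, ← neg_mul, ← map_neg, Q.σ_rep]; simp

lemma mul_σ (a b : K) : (algebraMap K M a + algebraMap K M b * Q.β) *
    Q.σ (algebraMap K M a + algebraMap K M b * Q.β) = algebraMap K M (a ^ 2 - B * b ^ 2) := by
  rw [Q.σ_rep]
  simp only [map_sub, map_mul, map_pow, ← Q.sq]; ring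

lemma exists_nm (z : Mˣ) : ∃ n : Kˣ, algebraMap K M n = z * Q.σ z := by
  obtain ⟨a, b, hz⟩ := Q.rep z
  have h := Q.mul_σ a b
  rw [← hz] at h
  have hne : a ^ 2 - B * b ^ 2 ≠ 0 := by
    intro h0
    rw [h0, map_zero] at h
    rcases mul_eq_zero.1 h with h | h
    · exact z.ne_zero h
    · exact z.ne_zero ((map_eq_zero Q.σ).1 h)
  exact ⟨Units.mk0 _ hne, h.symm⟩

/-- the norm -/
noncomputable def nm : Mˣ →* Kˣ where
  toFun z := (Q.exists_nm z).choose
  map_one' := by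
    apply Units.ext; apply (algebraMap K M).injective
    rw [(Q.exists_nm 1).choose_spec]; simp
  map_mul' := by
    intro x y
    apply Units.ext; apply (algebraMap K M).injective
    change algebraMap K M (Q.exists_nm (x * y)).choose.val =
      algebraMap K M ((Q.exists_nm x).choose.val * (Q.exists_nm y).choose.val)
    rw [map_mul (algebraMap K M), (Q.exists_nm (x * y)).choose_spec, (Q.exists_nm x).choose_spec,
      (Q.exists_nm y).choose_spec, Units.val_mul, map_mul]; ring

lemma nm_spec (z : Mˣ) : algebraMap K M (Q.nm z) = z * Q.σ z := (Q.exists_nm z).choose_spec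

lemma nm_rep (z : Mˣ) : ∃ a b : K, (z : M) = algebraMap K M a + algebraMap K M b * Q.β ∧
    (Q.nm z : K) = a ^ 2 - B * b ^ 2 := by
  obtain ⟨a, b, hz⟩ := Q.rep z
  refine ⟨a, b, hz, ?_⟩
  apply (algebraMap K M).injective
  rw [Q.nm_spec, hz, Q.mul_σ]

lemma nm_up (x : Kˣ) : Q.nm (up K M x) = x ^ 2 := by
  apply Units.ext; apply (algebraMap K M).injective
  rw [Q.nm_spec, up_val, Q.σ.commutes]; simp [_root_.sq]

lemma fixed {z : M} (h : Q.σ z = z) : ∃ a : K, z = algebraMap K M a := by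
  obtain ⟨a, b, rfl⟩ := Q.rep z
  refine ⟨a, ?_⟩
  rw [Q.σ_rep] at h
  have h2 : algebraMap K M 0 + algebraMap K M (2 * b) * Q.β = 0 := by
    rw [map_zero, map_mul, map_ofNat]; linear_combination -h
  have := (Q.indep h2).2
  have hb : b = 0 := by simpa using this
  simp [hb]

lemma sq_descend (Q : Quad K M B) {x : Kˣ} : up K M x ∈ Sq M ↔ x ∈ Sq K ∨ x * B ∈ Sq K := by
  constructor
  · rintro ⟨y, hy⟩
    have hy' : (y : M) ^ 2 = algebraMap K M x := by
      have := Units.ext_iff.1 hy; simpa using this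
    obtain ⟨a, b, hab⟩ := Q.rep y
    rw [hab] at hy'
    have h0 : algebraMap K M (a ^ 2 + B * b ^ 2 - x) + algebraMap K M (2 * a * b) * Q.β = 0 := by
      simp only [map_sub, map_add, map_mul, map_pow, ← Q.sq, map_ofNat]
      linear_combination hy'
    obtain ⟨h1, h2⟩ := Q.indep h0
    have h3 : a = 0 ∨ b = 0 := by simpa using h2
    rcases h3 with rfl | rfl
    · right
      have hx : (x : K) = B * b ^ 2 := by linear_combination -h1
      have hb : b ≠ 0 := by
        rintro rfl; exact x.ne_zero (by rw [hx]; ring)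
      refine ⟨B * Units.mk0 b hb, Units.ext ?_⟩
      change ((B * Units.mk0 b hb) ^ 2 : Kˣ).val = _
      push_cast
      rw [Units.val_mk0, hx]; ring
    · left
      have hx : (x : K) = a ^ 2 := by linear_combination -h1
      have hb : a ≠ 0 := by
        rintro rfl; exact x.ne_zero (by rw [hx]; ring)
      refine ⟨Units.mk0 a hb, Units.ext ?_⟩
      change ((Units.mk0 a hb) ^ 2 : Kˣ).val = _
      push_cast
      rw [Units.val_mk0, hx]
  · have hBsq : up K M B ∈ Sq M := ⟨Q.β, Units.ext (by change ((Q.β ^ 2 : Mˣ) : M) = _; push_cast; rw [Q.sq]; rfl)⟩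
    have hup : ∀ y : Kˣ, y ∈ Sq K → up K M y ∈ Sq M := by
      rintro y ⟨u, rfl⟩
      exact ⟨up K M u, (map_pow (up K M) u 2).symm⟩
    rintro (h | h)
    · exact hup _ h
    · have := hup _ h
      rw [map_mul] at this
      exact (Subgroup.mul_mem_cancel_right _ hBsq).1 this

lemma hilbert90 {z : Mˣ} (h : Q.nm z = 1) : ∃ x : Mˣ, (z : M) * x = Q.σ x := by
  have hz : (z : M) * Q.σ z = 1 := by rw [← Q.nm_spec, h]; simp
  by_cases h1 : (1 : M) + Q.σ z = 0
  · have h2 : Q.σ z = -1 := by linear_combination h1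
    have h3 : (z : M) = -1 := by rw [h2] at hz; linear_combination -hz
    exact ⟨Q.β, by rw [h3, Q.σβ]; ring⟩
  · refine ⟨Units.mk0 _ h1, ?_⟩
    rw [Units.val_mk0, map_add, map_one, Q.σσ]; linear_combination hz

lemma finrank_eq (Q : Quad K M B) : Module.finrank K M = 2 := by
  let f : (K × K) →ₗ[K] M :=
    { toFun := fun p => algebraMap K M p.1 + algebraMap K M p.2 * Q.β
      map_add' := by intro x y; simp only [Prod.fst_add, Prod.snd_add, map_add]; ring
      map_smul' := by
        intro m x
        change algebraMap K M (m * x.1) + algebraMap K M (m * x.2) * Q.β =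
          m • (algebraMap K M x.1 + algebraMap K M x.2 * Q.β)
        rw [Algebra.smul_def, map_mul, map_mul]; ring }
  have hf : Function.Bijective f := by
    constructor
    · rw [injective_iff_map_eq_zero]
      rintro ⟨a, b⟩ h
      obtain ⟨h1, h2⟩ := Q.indep h
      exact Prod.ext h1 h2
    · intro z
      obtain ⟨a, b, h⟩ := Q.rep z
      exact ⟨(a, b), h.symm⟩
  rw [← (LinearEquiv.ofBijective f hf).finrank_eq]
  simp

lemma card_infinitePlace (Q : Quad K M B) (hB : B ∈ TP K) :
    Fintype.card (InfinitePlace M) = Fintype.card (InfinitePlace K) * 2 := by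
  haveI : Algebra.IsQuadraticExtension K M := ⟨Q.finrank_eq⟩
  haveI : IsUnramifiedAtInfinitePlaces K M := by
    constructor
    intro w
    by_contra hw
    rw [InfinitePlace.not_isUnramified_iff] at hw
    obtain ⟨h1, h2⟩ := hw
    apply InfinitePlace.not_isReal_iff_isComplex.2 h1
    rw [← InfinitePlace.mk_embedding w, InfinitePlace.comap_mk, InfinitePlace.isReal_mk_iff] at h2
    rw [← InfinitePlace.mk_embedding w, InfinitePlace.isReal_mk_iff]
    set ψ := w.embedding with hψ
    have hre : ∀ a : K, ψ (algebraMap K M a) = (h2.embedding a : ℂ) := fun a =>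
      (ComplexEmbedding.IsReal.coe_embedding_apply h2 a).symm
    have hpos := hB h2.embedding
    have hβ : (starRingEnd ℂ) (ψ Q.β) = ψ Q.β := by
      have hsq : (ψ Q.β) ^ 2 = ((Real.sqrt (h2.embedding B) : ℝ) : ℂ) ^ 2 := by
        rw [← map_pow, Q.sq, hre, ← Complex.ofReal_pow, Real.sq_sqrt hpos.le]
      rcases sq_eq_sq_iff_eq_or_eq_neg.1 hsq with h | h <;> rw [h] <;> simp
    rw [ComplexEmbedding.isReal_iff]
    ext z
    obtain ⟨a, b, rfl⟩ := Q.rep z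
    rw [ComplexEmbedding.conjugate_coe_eq, map_add, map_mul, map_add, map_mul, hβ, hre, hre]
    rw [Complex.conj_ofReal, Complex.conj_ofReal]
  rw [IsUnramifiedAtInfinitePlaces.card_infinitePlace (k := K) (K := M), Q.finrank_eq]

/-- split primes -/
lemma split (Q : Quad K M B) {v : HeightOneSpectrum (𝓞 K)} (hB : B ∈ LS v) :
    ∃ w w' : HeightOneSpectrum (𝓞 M), w ≠ w' ∧ dn K w = v ∧ dn K w' = v := by
  by_contra hcon
  push Not at hcon
  obtain ⟨w, hw⟩ := exists_over K M v
  obtain ⟨w', hw', hww⟩ := hos_equiv K w Q.σ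
  have heq : w = w' := by
    by_contra h
    exact hcon w w' h hw (hw'.trans hw)
  subst heq
  obtain ⟨z, hz⟩ := hB
  set y : M := Q.β * algebraMap K M z with hy
  have hσy : Q.σ (y - 1) = - (y + 1) := by
    rw [hy, map_sub, map_mul, Q.σ.commutes, Q.σβ, map_one]; ring
  have h1 : vl w (y - 1) = vl w (y + 1) := by
    rw [hww, hσy, Valuation.map_neg]
  have h2 : vl w ((y - 1) * (y + 1)) < vl w 4 := by
    have : (y - 1) * (y + 1) = algebraMap K M ((B : K) * z ^ 2 - 1) := by
      rw [hy, map_sub, map_mul, map_pow, map_one, ← Q.sq]; ring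
    rw [this]
    subst hw
    rw [← vl_up_lt_iff K w, map_ofNat (algebraMap K M) 4] at hz
    exact hz
  have h3 : vl w 2 ≤ vl w (y - 1) := by
    have : (2 : M) = (y + 1) - (y - 1) := by ring
    rw [this]
    refine (Valuation.map_sub _ _ _).trans ?_
    rw [h1, max_self]
  rw [map_mul, ← h1, ← _root_.sq, vl4_eq] at h2
  exact absurd (pow_le_pow_left₀ zero_le' h3 2) (not_le.2 h2)

end Quad
end UD

end

section
set_option linter.all false
open IsDedekindDomain NumberField WithZero
namespace UD

section grp
variable {G : Type*} [CommGroup G]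
lemma two_le_relIndex {H L : Subgroup G} {x : G} (hx : x ∈ L) (hx' : x ∉ H) (h0 : H.relIndex L ≠ 0) :
    2 ≤ H.relIndex L := by
  have : H.relIndex L ≠ 1 := fun h => hx' (Subgroup.relIndex_eq_one.1 h hx)
  omega

/-- index multiplicativity for `H ≤ K` -/
lemma relIndex_split {H K : Subgroup G} (L : Subgroup G) (h : H ⊓ L ≤ K) :
    H.relIndex (K ⊓ L) * K.relIndex L = H.relIndex L := by
  rw [Subgroup.relIndex_inf_mul_relIndex, ← Subgroup.inf_relIndex_right (H ⊓ K), ← Subgroup.inf_relIndex_right H]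
  congr 1
  apply le_antisymm
  · exact le_inf (inf_le_left.trans inf_le_left) inf_le_right
  · exact le_inf (le_inf inf_le_left h) inf_le_right

lemma F1_group {G' : Type*} [CommGroup G'] {S U : Subgroup G} {S' V : Subgroup G'} (up : G →* G') (N : G' →* G)
    (B : G) (hB : B ∈ U) (hBS : B ∉ S) (hBS' : up B ∈ S') (hS : ∀ x ∈ S, up x ∈ S')
    (hNV : ∀ z ∈ V, N z ∈ U) (hSU : ∀ x ∈ S, x ∈ U → ∃ z ∈ V, N z = x)
    (hker : ∀ z ∈ V, N z ∈ S → ∃ u ∈ U, ∃ s ∈ S', z = up u * s)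
    (h0 : S.relIndex U ≠ 0) (h0' : S'.relIndex V ≠ 0) :
    2 * S'.relIndex V * (V.map N).relIndex U ≤ S.relIndex U * S.relIndex U ∧ (V.map N).relIndex U ≠ 0 := by
  set D := V.map N with hD
  have hDU : D ≤ U := by
    rintro _ ⟨z, hz, rfl⟩; exact hNV z hz
  have h1 : S.relIndex D * D.relIndex U = S.relIndex U := by
    have := relIndex_split (H := S) (K := D) U (by
      rintro x ⟨hx, hxU⟩
      obtain ⟨z, hz, rfl⟩ := hSU x hx hxU
      exact ⟨z, hz, rfl⟩)
    rwa [inf_eq_left.2 hDU] at this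
  set E := S'.comap up with hE
  have h2 : S.relIndex (E ⊓ U) * E.relIndex U = S.relIndex U :=
    relIndex_split U (fun x hx => hS x hx.1)
  have h3 : 2 ≤ S.relIndex (E ⊓ U) := two_le_relIndex (x := B) ⟨hBS', hB⟩ hBS (by
    intro h; rw [h, zero_mul] at h2; exact h0 h2.symm)
  set J := U.map up ⊔ S' with hJ
  have h4 : S'.relIndex (J ⊓ V) * J.relIndex V = S'.relIndex V :=
    relIndex_split V (fun x hx => (le_sup_right : S' ≤ J) hx.1)
  have h5 : S'.relIndex J = E.relIndex U := by
    rw [hJ, Subgroup.relIndex_sup_right, hE, Subgroup.relIndex_comap]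
  have hE0 : E.relIndex U ≠ 0 := by
    intro h; rw [h, mul_zero] at h2; exact h0 h2.symm
  have h6 : S'.relIndex (J ⊓ V) ≤ E.relIndex U := by
    rw [← h5]
    exact Subgroup.relIndex_le_of_le_right inf_le_left (by rw [h5]; exact hE0)
  have h7 : (S.comap N).relIndex V = S.relIndex D := Subgroup.relIndex_comap _ _ _
  have hS0 : S.relIndex D ≠ 0 := by
    intro h; rw [h, zero_mul] at h1; exact h0 h1.symm
  have h8 : J.relIndex V ≤ S.relIndex D := by
    rw [← h7, ← Subgroup.inf_relIndex_right (S.comap N)]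
    apply Subgroup.relIndex_le_of_le_left
    · rintro z ⟨hz, hzV⟩
      obtain ⟨u, hu, s, hs, rfl⟩ := hker z hzV hz
      exact mul_mem (le_sup_left (a := U.map up) ⟨u, hu, rfl⟩) (le_sup_right (a := U.map up) hs)
    · rw [Subgroup.inf_relIndex_right, h7]; exact hS0
  refine ⟨?_, fun h => h0 (by rw [← h1, h, mul_zero])⟩
  calc 2 * S'.relIndex V * D.relIndex U = 2 * (S'.relIndex (J ⊓ V) * J.relIndex V) * D.relIndex U := by rw [h4]
    _ ≤ S.relIndex (E ⊓ U) * (E.relIndex U * S.relIndex D) * D.relIndex U := by gcongr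
    _ = (S.relIndex (E ⊓ U) * E.relIndex U) * (S.relIndex D * D.relIndex U) := by ring
    _ = _ := by rw [h2, h1]
end grp

namespace Quad
variable {K M : Type*} [Field K] [NumberField K] [Field M] [NumberField M] [Algebra K M] {B : Kˣ}

/-- primes above T -/
noncomputable def ovr (K M : Type*) [Field K] [NumberField K] [Field M] [NumberField M] [Algebra K M]
    (T : Finset (HeightOneSpectrum (𝓞 K))) : Finset (HeightOneSpectrum (𝓞 M)) :=
  (T.finite_toSet.biUnion fun v _ => finite_over K M v).toFinset

lemma mem_ovr {T : Finset (HeightOneSpectrum (𝓞 K))} {w : HeightOneSpectrum (𝓞 M)} :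
    w ∈ ovr K M T ↔ dn K w ∈ T := by
  simp [ovr]

open Classical in
lemma card_ovr (Q : Quad K M B) (T : Finset (HeightOneSpectrum (𝓞 K))) :
    2 * T.card ≤ (ovr K M T).card + (T.filter (fun v => B ∉ LS v)).card := by
  have h : (ovr K M T).card = ∑ v ∈ T, ((ovr K M T).filter (fun w => dn K w = v)).card :=
    Finset.card_eq_sum_card_fiberwise (fun w hw => mem_ovr.1 hw)
  rw [h, Finset.card_filter, ← Finset.sum_add_distrib, mul_comm, ← smul_eq_mul, ← Finset.sum_const]
  apply Finset.sum_le_sum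
  intro v hv
  split_ifs with hB
  · obtain ⟨w, w', hne, hw, hw'⟩ := Q.split hB
    have : 1 < ((ovr K M T).filter (fun w => dn K w = v)).card :=
      Finset.one_lt_card.2 ⟨w, Finset.mem_filter.2 ⟨mem_ovr.2 (hw ▸ hv), hw⟩,
        w', Finset.mem_filter.2 ⟨mem_ovr.2 (hw' ▸ hv), hw'⟩, hne⟩
    omega
  · obtain ⟨w, hw⟩ := exists_over K M v
    have : 0 < ((ovr K M T).filter (fun w => dn K w = v)).card :=
      Finset.card_pos.2 ⟨w, Finset.mem_filter.2 ⟨mem_ovr.2 (hw ▸ hv), hw⟩⟩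
    omega

lemma up_mem_KT {T : Finset (HeightOneSpectrum (𝓞 K))} {x : Kˣ} (hx : x ∈ KT T) :
    up K M x ∈ KT (ovr K M T) := by
  intro w hw
  rw [up_val, vl_up_eq_one_iff K w]
  exact hx _ (fun h => hw (mem_ovr.2 h))

lemma nm_mem_KT (Q : Quad K M B) {T : Finset (HeightOneSpectrum (𝓞 K))} {z : Mˣ} (hz : z ∈ KT (ovr K M T)) :
    Q.nm z ∈ KT T := by
  intro v hv
  obtain ⟨w, rfl⟩ := exists_over K M v
  obtain ⟨w', hw', hww⟩ := hos_equiv K w Q.σ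
  rw [← vl_up_eq_one_iff K w, Q.nm_spec, map_mul, ← hww, hz w (fun h => hv (mem_ovr.1 h)),
    hz w' (fun h => hv (hw' ▸ mem_ovr.1 h)), mul_one]

lemma nm_EV (Q : Quad K M B) {w : HeightOneSpectrum (𝓞 M)} (hw : Odd' w) (hB : vl w Q.β = 1) {x : Mˣ}
    (hx : vl w (Q.σ x) = vl w x) : Q.nm x ∈ EV (dn K w) := by
  obtain ⟨a, b, hab, hn⟩ := Q.nm_rep x
  have h2 : vl w 2 = 1 := hw
  have hσ : Q.σ x = algebraMap K M a - algebraMap K M b * Q.β := by rw [hab, Q.σ_rep]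
  have ha : vl w (algebraMap K M a) ≤ vl w x := by
    have : 2 * algebraMap K M a = x + Q.σ x := by rw [hσ, hab]; ring
    have h := congrArg (vl w) this
    rw [map_mul, h2, one_mul] at h
    rw [h]
    exact (Valuation.map_add _ _ _).trans (by rw [hx, max_self])
  have hb : vl w (algebraMap K M b) ≤ vl w x := by
    have : 2 * algebraMap K M b * Q.β = x - Q.σ x := by rw [hσ, hab]; ring
    have h := congrArg (vl w) this
    rw [map_mul, map_mul, h2, one_mul, hB, mul_one] at h
    rw [h]
    exact (Valuation.map_sub _ _ _).trans (by rw [hx, max_self])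
  have hN : vl w (algebraMap K M (Q.nm x)) = vl w x ^ 2 := by
    rw [Q.nm_spec, map_mul, hx, _root_.sq]
  have hx0 : vl w (x : M) ≠ 0 := (Valuation.ne_zero_iff _).2 x.ne_zero
  have hmax : vl w (x : M) = vl w (algebraMap K M a) ∨ vl w (x : M) = vl w (algebraMap K M b) := by
    have h1 : vl w x ≤ max (vl w (algebraMap K M a)) (vl w (algebraMap K M b)) := by
      conv_lhs => rw [hab]
      refine (Valuation.map_add _ _ _).trans ?_
      rw [map_mul, hB, mul_one]
    rcases le_max_iff.1 h1 with h | h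
    · exact Or.inl (le_antisymm h ha)
    · exact Or.inr (le_antisymm h hb)
  have key : ∀ c : K, vl w (x : M) = vl w (algebraMap K M c) → Q.nm x ∈ EV (dn K w) := by
    intro c hc
    have hc0 : c ≠ 0 := by
      rintro rfl; rw [map_zero, map_zero] at hc; exact hx0 hc
    refine ⟨(Units.mk0 c hc0)⁻¹, ?_⟩
    rw [← vl_up_eq_one_iff K w, map_mul, map_mul, hN, map_pow, map_pow, Units.val_inv_eq_inv_val, map_inv₀, map_inv₀, Units.val_mk0, ← hc]
    rw [← mul_pow, mul_inv_cancel₀ hx0, one_pow]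
  rcases hmax with h | h
  · exact key a h
  · exact key b h

lemma Sq_mem {x : Kˣ} (h : x ∈ Sq K) : up K M x ∈ Sq M := by
  obtain ⟨u, rfl⟩ := h
  exact ⟨up K M u, (map_pow (up K M) u 2).symm⟩

lemma vlβ (Q : Quad K M B) {w : HeightOneSpectrum (𝓞 M)} (h : vl (dn K w) (B : K) = 1) : vl w Q.β = 1 := by
  have h1 : vl w (Q.β : M) ^ 2 = 1 := by
    rw [← map_pow, Q.sq, vl_up_eq_one_iff K w, h]
  exact (pow_eq_one_iff.1 h1).resolve_right two_ne_zero

lemma ker_nm (Q : Quad K M B) {T : Finset (HeightOneSpectrum (𝓞 K))} (hT : Large T) (hBT : B ∈ KT T)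
    {z : Mˣ} (hz : z ∈ KT (ovr K M T)) (hn : Q.nm z ∈ Sq K) :
    ∃ u ∈ KT T, ∃ s ∈ Sq M, z = up K M u * s := by
  obtain ⟨k, hk⟩ := hn
  change k ^ 2 = _ at hk
  have hkU : k ∈ KT T := KT_of_sq (by rw [hk]; exact Q.nm_mem_KT hz)
  have hz'V : z * (up K M k)⁻¹ ∈ KT (ovr K M T) := mul_mem hz (inv_mem (up_mem_KT hkU))
  obtain ⟨x, hx⟩ := Q.hilbert90 (z := z * (up K M k)⁻¹) (by
    rw [map_mul, map_inv, Q.nm_up, hk, mul_inv_cancel])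
  have hEV : ∀ v ∉ T, Q.nm x ∈ EV v := by
    intro v hv
    obtain ⟨w, rfl⟩ := exists_over K M v
    apply Q.nm_EV
    · rw [Odd'.up K]; by_contra h; exact hv (hT.1 _ h)
    · exact Q.vlβ (hBT _ hv)
    · rw [← hx, map_mul, hz'V w (fun h => hv (mem_ovr.1 h)), one_mul]
  obtain ⟨κ, hκ, c, hc⟩ := hT.exists_KT hEV
  have hxσ : Units.map Q.σ.toAlgHom.toRingHom.toMonoidHom x = z * (up K M k)⁻¹ * x := Units.ext hx.symm
  set u := x * (up K M c)⁻¹ with hu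
  have hnu : Q.nm u = κ := by
    rw [hu, map_mul, map_inv, Q.nm_up, hc, mul_inv_cancel_right]
  have hσu : Q.σ u = (z * (up K M k)⁻¹ : Mˣ) * u := by
    have h1 : Q.σ ((up K M c : Mˣ) : M) = (up K M c : Mˣ) := by rw [up_val, Q.σ.commutes]
    rw [hu, Units.val_mul x, Units.val_inv_eq_inv_val, map_mul, map_inv₀, h1, ← hx]; ring
  refine ⟨k * κ, mul_mem hkU hκ, (u⁻¹) ^ 2, ⟨u⁻¹, rfl⟩, ?_⟩
  have h3 : up K M κ = u * (z * (up K M k)⁻¹ * u) := by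
    apply Units.ext
    rw [up_val, ← hnu, Q.nm_spec, hσu]; simp
  rw [map_mul, h3]
  apply Units.ext
  have hk0 : ((up K M k : Mˣ) : M) ≠ 0 := Units.ne_zero _
  have hu0 : (u : M) ≠ 0 := Units.ne_zero _
  simp only [Units.val_mul, Units.val_pow_eq_pow_val, Units.val_inv_eq_inv_val]
  field_simp

open Classical in
/-- second inequality -/
theorem F1 (Q : Quad K M B) {T : Finset (HeightOneSpectrum (𝓞 K))} (hT : Large T) (hBT : B ∈ KT T)
    (hB : B ∈ TP K) :
    2 * ((KT (ovr K M T)).map Q.nm).relIndex (KT T) ≤ 2 ^ (T.filter (fun v => B ∉ LS v)).card ∧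
    ((KT (ovr K M T)).map Q.nm).relIndex (KT T) ≠ 0 := by
  have h := F1_group (S := Sq K) (U := KT T) (S' := Sq M) (V := KT (ovr K M T)) (up K M) Q.nm B hBT Q.nsq
    (Q.sq_descend.2 (Or.inr ⟨B, _root_.sq B⟩)) (fun x hx => Sq_mem hx) (fun z hz => Q.nm_mem_KT hz)
    (by
      rintro x ⟨y, rfl⟩ hx
      exact ⟨up K M y, up_mem_KT (KT_of_sq hx), Q.nm_up y⟩)
    (fun z hz hn => Q.ker_nm hT hBT hz hn) (by rw [relIndex_Sq]; positivity) (by rw [relIndex_Sq]; positivity)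
  refine ⟨?_, h.2⟩
  have h1 := h.1
  rw [relIndex_Sq, relIndex_Sq, Q.card_infinitePlace hB] at h1
  have h2 := Q.card_ovr T
  set d := ((KT (ovr K M T)).map Q.nm).relIndex (KT T)
  set r := Fintype.card (InfinitePlace K)
  set t1 := (T.filter (fun v => B ∉ LS v)).card
  have h3 : 2 ^ (r * 2 + (2 * T.card)) ≤ 2 ^ (r * 2 + (ovr K M T).card) * 2 ^ t1 := by
    rw [← pow_add]; exact Nat.pow_le_pow_right (by norm_num) (by omega)
  have h4 : 2 ^ (r * 2 + (ovr K M T).card) * (2 * d) ≤ 2 ^ (r * 2 + (ovr K M T).card) * 2 ^ t1 := by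
    calc _ = 2 * 2 ^ (r * 2 + (ovr K M T).card) * d := by ring
      _ ≤ _ := h1
      _ = 2 ^ (r * 2 + (2 * T.card)) := by ring
      _ ≤ _ := h3
  exact Nat.le_of_mul_le_mul_left h4 (by positivity)

end Quad
end UD

end

section
set_option linter.all false
open IsDedekindDomain NumberField WithZero
namespace UD
variable {K : Type*} [Field K] [NumberField K]

/-! weak approximation -/
lemma crt (S : Finset (HeightOneSpectrum (𝓞 K))) (a : HeightOneSpectrum (𝓞 K) → 𝓞 K) (n : ℕ) :
    ∃ x : 𝓞 K, ∀ v ∈ S, vl v (algebraMap (𝓞 K) K x - algebraMap (𝓞 K) K (a v)) ≤ exp (-(n : ℤ)) := by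
  obtain ⟨x, hx⟩ := IsDedekindDomain.exists_forall_sub_mem_ideal (s := S) (fun v => v.asIdeal) (fun _ => n)
    (fun v _ => v.prime) (fun v _ w _ h h' => h (HeightOneSpectrum.ext h')) (fun v => a v)
  refine ⟨x, fun v hv => ?_⟩
  rw [← map_sub, vl_algebraMap_le_iff]
  exact hx v hv

lemma exists_denom (S : Finset (HeightOneSpectrum (𝓞 K))) (a : HeightOneSpectrum (𝓞 K) → K) :
    ∃ d : 𝓞 K, d ≠ 0 ∧ ∃ b : HeightOneSpectrum (𝓞 K) → 𝓞 K, ∀ v ∈ S,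
      algebraMap (𝓞 K) K d * a v = algebraMap (𝓞 K) K (b v) := by
  classical
  obtain ⟨d, hd⟩ := IsLocalization.exist_integer_multiples (nonZeroDivisors (𝓞 K)) S a
  have h : ∀ v, ∃ b : 𝓞 K, v ∈ S → algebraMap (𝓞 K) K d * a v = algebraMap (𝓞 K) K b := by
    intro v
    by_cases hv : v ∈ S
    · obtain ⟨b, hb⟩ := hd v hv
      exact ⟨b, fun _ => by rw [hb, Algebra.smul_def]⟩
    · exact ⟨0, fun h => absurd h hv⟩
  choose b hb using h
  exact ⟨d, nonZeroDivisors.coe_ne_zero d, b, hb⟩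

lemma weak_approx (S : Finset (HeightOneSpectrum (𝓞 K))) (a : HeightOneSpectrum (𝓞 K) → K) (n : ℕ) :
    ∃ x : K, ∀ v ∈ S, vl v (x - a v) ≤ exp (-(n : ℤ)) := by
  obtain ⟨d, hd, b, hb⟩ := exists_denom S a
  have hd' : algebraMap (𝓞 K) K d ≠ 0 := by simpa using hd
  have hm : ∀ v : HeightOneSpectrum (𝓞 K), ∃ m : ℕ, exp (-(m : ℤ)) ≤ vl v (algebraMap (𝓞 K) K d) := by
    intro v
    obtain ⟨k, hk⟩ := vl_unit_eq v (Units.mk0 _ hd')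
    rw [Units.val_mk0] at hk
    exact ⟨(-k).toNat, by rw [hk, exp_le_exp]; omega⟩
  choose m hm using hm
  obtain ⟨x, hx⟩ := crt S b (n + S.sup m)
  refine ⟨algebraMap (𝓞 K) K x / algebraMap (𝓞 K) K d, fun v hv => ?_⟩
  have h1 : algebraMap (𝓞 K) K x / algebraMap (𝓞 K) K d - a v =
    (algebraMap (𝓞 K) K x - algebraMap (𝓞 K) K (b v)) / algebraMap (𝓞 K) K d := by
    rw [← hb v hv]; field_simp
  rw [h1, map_div₀, div_le_iff₀ (by rw [zero_lt_iff]; exact (Valuation.ne_zero_iff _).2 hd')]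
  refine (hx v hv).trans (le_trans ?_ (mul_le_mul_right (hm v) _))
  rw [← exp_add, exp_le_exp]
  have := Finset.le_sup (f := m) hv
  push_cast; omega

/-! residues -/
abbrev Fv (v : HeightOneSpectrum (𝓞 K)) := 𝓞 K ⧸ v.asIdeal

noncomputable instance (v : HeightOneSpectrum (𝓞 K)) : Field (Fv v) :=
  haveI := v.isMaximal; Ideal.Quotient.field _

instance (v : HeightOneSpectrum (𝓞 K)) : Finite (Fv v) :=
  Ideal.finiteQuotientOfFreeOfNeBot _ v.ne_bot

lemma exists_int {v : HeightOneSpectrum (𝓞 K)} {x : K} (h : vl v x ≤ 1) :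
    ∃ a : 𝓞 K, vl v (x - algebraMap (𝓞 K) K a) < 1 := by
  obtain ⟨a, ha⟩ := v.exists_valuation_sub_lt_of_integer (K := K) h (γ := 1)
  exact ⟨a, by simpa [Valuation.map_sub_swap] using ha⟩

open Classical in
noncomputable def rs (v : HeightOneSpectrum (𝓞 K)) (x : K) : Fv v :=
  if h : vl v x ≤ 1 then Ideal.Quotient.mk _ (exists_int h).choose else 0

lemma lt_one_iff_mem (v : HeightOneSpectrum (𝓞 K)) (a : 𝓞 K) : vl v (algebraMap (𝓞 K) K a) < 1 ↔ a ∈ v.asIdeal := by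
  have h1 := vl_eq_one_iff v a
  have h2 : vl v (algebraMap (𝓞 K) K a) ≤ 1 := v.valuation_le_one a
  rw [lt_iff_le_and_ne, Ne, h1, not_not]
  exact ⟨fun h => h.2, fun h => ⟨h2, h⟩⟩

lemma vl_le_of_sub {v : HeightOneSpectrum (𝓞 K)} {x y : K} (h : vl v (x - y) ≤ 1) (hy : vl v y ≤ 1) : vl v x ≤ 1 := by
  have : x = (x - y) + y := by ring
  rw [this]
  exact (Valuation.map_add _ _ _).trans (max_le h hy)

lemma rs_of {v : HeightOneSpectrum (𝓞 K)} {x : K} {a : 𝓞 K} (h : vl v (x - algebraMap (𝓞 K) K a) < 1) :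
    rs v x = Ideal.Quotient.mk _ a := by
  have hx : vl v x ≤ 1 := vl_le_of_sub h.le (v.valuation_le_one a)
  rw [rs, dif_pos hx, Ideal.Quotient.eq, ← lt_one_iff_mem, map_sub]
  have h2 := (exists_int hx).choose_spec
  set b := (exists_int hx).choose
  have : algebraMap (𝓞 K) K b - algebraMap (𝓞 K) K a = (x - algebraMap (𝓞 K) K a) - (x - algebraMap (𝓞 K) K b) := by ring
  rw [this]
  exact Valuation.map_sub_lt _ h h2

lemma rs_alg (v : HeightOneSpectrum (𝓞 K)) (a : 𝓞 K) : rs v (algebraMap (𝓞 K) K a) = Ideal.Quotient.mk _ a :=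
  rs_of (by rw [sub_self, map_zero]; exact zero_lt_one)

lemma rs_add {v : HeightOneSpectrum (𝓞 K)} {x y : K} (hx : vl v x ≤ 1) (hy : vl v y ≤ 1) :
    rs v (x + y) = rs v x + rs v y := by
  obtain ⟨a, ha⟩ := exists_int hx
  obtain ⟨b, hb⟩ := exists_int hy
  rw [rs_of ha, rs_of hb, ← map_add]
  apply rs_of
  have : x + y - algebraMap (𝓞 K) K (a + b) = (x - algebraMap (𝓞 K) K a) + (y - algebraMap (𝓞 K) K b) := by
    rw [map_add]; ring
  rw [this]
  exact Valuation.map_add_lt _ ha hb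

lemma rs_mul {v : HeightOneSpectrum (𝓞 K)} {x y : K} (hx : vl v x ≤ 1) (hy : vl v y ≤ 1) :
    rs v (x * y) = rs v x * rs v y := by
  obtain ⟨a, ha⟩ := exists_int hx
  obtain ⟨b, hb⟩ := exists_int hy
  rw [rs_of ha, rs_of hb, ← map_mul]
  apply rs_of
  have : x * y - algebraMap (𝓞 K) K (a * b) = (x - algebraMap (𝓞 K) K a) * y + algebraMap (𝓞 K) K a * (y - algebraMap (𝓞 K) K b) := by
    rw [map_mul]; ring
  rw [this]
  refine Valuation.map_add_lt _ ?_ ?_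
  · rw [map_mul]; exact lt_of_le_of_lt (mul_le_of_le_one_right' hy) ha
  · rw [map_mul]; exact lt_of_le_of_lt (mul_le_of_le_one_left' (v.valuation_le_one a)) hb

lemma rs_zero_iff {v : HeightOneSpectrum (𝓞 K)} {x : K} (hx : vl v x ≤ 1) : rs v x = 0 ↔ vl v x < 1 := by
  constructor
  · intro h
    obtain ⟨a, ha⟩ := exists_int hx
    rw [rs_of ha, Ideal.Quotient.eq_zero_iff_mem, ← lt_one_iff_mem] at h
    have : x = (x - algebraMap (𝓞 K) K a) + algebraMap (𝓞 K) K a := by ring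
    rw [this]
    exact Valuation.map_add_lt _ ha h
  · intro h
    rw [rs_of (a := 0) (by simpa using h), map_zero]

lemma rs_one (v : HeightOneSpectrum (𝓞 K)) : rs v 1 = 1 := by
  have := rs_alg v 1; simpa using this

lemma rs_two (v : HeightOneSpectrum (𝓞 K)) : rs v 2 = 2 := by
  have := rs_alg v 2
  rwa [map_ofNat (algebraMap (𝓞 K) K) 2, map_ofNat (Ideal.Quotient.mk v.asIdeal) 2] at this

lemma rs_neg {v : HeightOneSpectrum (𝓞 K)} {x : K} (hx : vl v x ≤ 1) : rs v (-x) = - rs v x := by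
  have h := rs_add hx (y := -x) (by rwa [Valuation.map_neg])
  rw [add_neg_cancel, (rs_zero_iff (by simp)).2 (by simp)] at h
  exact eq_neg_of_add_eq_zero_right h.symm

lemma rs_sub {v : HeightOneSpectrum (𝓞 K)} {x y : K} (hx : vl v x ≤ 1) (hy : vl v y ≤ 1) :
    rs v (x - y) = rs v x - rs v y := by
  rw [sub_eq_add_neg, rs_add hx (by rwa [Valuation.map_neg]), rs_neg hy, sub_eq_add_neg]

lemma rs_eq_iff {v : HeightOneSpectrum (𝓞 K)} {x y : K} (hx : vl v x ≤ 1) (hy : vl v y ≤ 1) :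
    rs v x = rs v y ↔ vl v (x - y) < 1 := by
  rw [← rs_zero_iff ((Valuation.map_sub _ _ _).trans (max_le hx hy)), rs_sub hx hy, sub_eq_zero]

lemma rs_surj (v : HeightOneSpectrum (𝓞 K)) (c : Fv v) : ∃ a : 𝓞 K, rs v (algebraMap (𝓞 K) K a) = c := by
  obtain ⟨a, rfl⟩ := Ideal.Quotient.mk_surjective c
  exact ⟨a, rs_alg v a⟩

lemma LS_odd_iff {v : HeightOneSpectrum (𝓞 K)} (hv : Odd' v) {x : Kˣ} (hx : vl v (x : K) = 1) :
    x ∈ LS v ↔ IsSquare (rs v x) := by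
  have hrx : rs v (x : K) ≠ 0 := fun h => ((rs_zero_iff hx.le).1 h).ne hx
  constructor
  · rintro ⟨z, hz⟩
    rw [hv.four] at hz
    have h1 := vl_eq_one_of_sub_lt hz
    have hz1 : vl v (z : K) = 1 := by
      rw [map_mul, hx, one_mul, map_pow] at h1
      exact (pow_eq_one_iff.1 h1).resolve_right two_ne_zero
    have h2 := (rs_eq_iff h1.le (by simp)).2 hz
    rw [sq, rs_mul hx.le (by rw [map_mul, hz1, mul_one]), rs_mul hz1.le hz1.le, rs_one] at h2
    refine ⟨(rs v (z : K))⁻¹, ?_⟩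
    have hz0 : rs v (z : K) ≠ 0 := fun h => ((rs_zero_iff hz1.le).1 h).ne hz1
    field_simp
    rw [sq, h2]
  · rintro ⟨c, hc⟩
    have hc0 : c ≠ 0 := by rintro rfl; rw [mul_zero] at hc; exact hrx hc
    obtain ⟨a, ha⟩ := rs_surj v c⁻¹
    apply mem_LS_of (z := algebraMap (𝓞 K) K a)
    have ha1 : vl v (algebraMap (𝓞 K) K a) ≤ 1 := v.valuation_le_one a
    have ha2 : vl v ((algebraMap (𝓞 K) K a) ^ 2) ≤ 1 := by rw [map_pow]; exact pow_le_one' ha1 2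
    have hxa : vl v (x * (algebraMap (𝓞 K) K a) ^ 2) ≤ 1 := by
      rw [map_mul, hx, one_mul]; exact ha2
    rw [hv.four, ← rs_eq_iff hxa (by simp), rs_mul hx.le ha2, sq, rs_mul ha1 ha1, ha, hc, rs_one]
    field_simp

section ff
variable {F : Type*} [Field F] [Finite F]
lemma ff_card_odd (h2 : (2 : F) ≠ 0) [Fintype F] : Fintype.card F % 2 = 1 := by
  refine FiniteField.odd_card_of_char_ne_two ?_
  intro h
  exact h2 (by have := ringChar.Nat.cast_ringChar (R := F); rw [h] at this; simpa using this)

lemma ff_sum (h2 : (2 : F) ≠ 0) (a b c : F) (ha : a ≠ 0) (hb : b ≠ 0) : ∃ x y : F, a * x ^ 2 + b * y ^ 2 = c := by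
  classical
  cases nonempty_fintype F
  obtain ⟨x, y, h⟩ := FiniteField.exists_root_sum_quadratic (R := F) (f := Polynomial.C a * Polynomial.X ^ 2)
    (g := Polynomial.C b * Polynomial.X ^ 2 + Polynomial.C 0 * Polynomial.X + Polynomial.C (-c)) (Polynomial.degree_C_mul_X_pow 2 ha)
    (Polynomial.degree_quadratic hb) (ff_card_odd h2)
  refine ⟨x, y, ?_⟩
  simp at h
  linear_combination h

lemma ff_nonsq (h2 : (2 : F) ≠ 0) : ∃ a : F, ¬ IsSquare a :=
  FiniteField.exists_nonsquare (fun h => h2 (by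
    have := ringChar.Nat.cast_ringChar (R := F); rw [h] at this; simpa using this))

lemma ff_one_add (h2 : (2 : F) ≠ 0) : ∃ g : F, ¬ IsSquare (1 + g ^ 2) := by
  obtain ⟨a, ha⟩ := ff_nonsq h2
  obtain ⟨x, y, h⟩ := ff_sum h2 1 1 a one_ne_zero one_ne_zero
  have hx : x ≠ 0 := by
    rintro rfl; exact ha ⟨y, by rw [← h]; ring⟩
  refine ⟨y / x, ?_⟩
  rintro ⟨s, hs⟩
  apply ha
  refine ⟨s * x, ?_⟩
  rw [← h]
  field_simp at hs
  linear_combination hs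

/-- for a nonsquare `c`, some `1 - c e²` is a nonsquare. -/
lemma ff_one_sub (h2 : (2 : F) ≠ 0) {c : F} (hc : ¬ IsSquare c) : ∃ e : F, e ≠ 0 ∧ ¬ IsSquare (1 - c * e ^ 2) := by
  have hc0 : c ≠ 0 := by rintro rfl; exact hc ⟨0, by simp⟩
  -- if all `1 - c e²` are squares,
  by_contra hcon
  push Not at hcon
  obtain ⟨a, ha⟩ := ff_nonsq h2
  obtain ⟨x, y, h⟩ := ff_sum h2 1 (-c) a one_ne_zero (neg_ne_zero.2 hc0)
  have main : ∀ x y : F, x ≠ 0 → ¬ IsSquare (x ^ 2 - c * y ^ 2) → False := by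
    intro x y hx hns
    by_cases hy : y = 0
    · subst hy; exact hns ⟨x, by ring⟩
    obtain ⟨s, hs⟩ := hcon (y / x) (div_ne_zero hy hx)
    apply hns
    refine ⟨s * x, ?_⟩
    field_simp at hs
    linear_combination hs
  by_cases hx : x = 0
  · subst hx
    have hy : y ≠ 0 := by rintro rfl; exact ha ⟨0, by rw [← h]; ring⟩
    have h1c : 1 - c ≠ 0 := fun h0 => hc ⟨1, by linear_combination -h0⟩
    refine main (2 * c * y / (1 - c)) (y * (1 + c) / (1 - c)) (div_ne_zero (mul_ne_zero (mul_ne_zero h2 hc0) hy) h1c) ?_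
    rw [show (2 * c * y / (1 - c)) ^ 2 - c * (y * (1 + c) / (1 - c)) ^ 2 = a by
      rw [← h]; field_simp; ring]
    exact ha
  · exact main x y hx (by rw [show x ^ 2 - c * y ^ 2 = a by linear_combination h]; exact ha)
end ff
end UD

end

section
set_option linter.all false
open IsDedekindDomain NumberField WithZero
namespace UD
variable {K : Type*} [Field K] [NumberField K]

theorem sq_of_LS {B : Kˣ} (hB : B ∈ TP K) (h : ∀ v, B ∈ LS v) : B ∈ Sq K := by
  classical
  by_contra hn
  obtain ⟨M, _, _, _, ⟨Q⟩⟩ := exists_quad B hn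
  obtain ⟨T, hT0, hT⟩ := exists_Large (finite_vl_ne_one B).toFinset
  have hBT : B ∈ KT T := by
    intro v hv
    by_contra h
    exact hv (hT0 (by simpa using h))
  have := Q.F1 hT hBT hB
  rw [Finset.filter_false_of_mem (fun v _ => not_not.2 (h v))] at this
  simp at this
  omega

lemma exists_notMem (T : Finset (HeightOneSpectrum (𝓞 K))) : ∃ v, v ∉ T := by
  classical
  set m : ℕ := ∏ v ∈ T, Ideal.absNorm v.asIdeal with hm
  have hm0 : 0 < m := Finset.prod_pos fun v _ => Nat.pos_of_ne_zero (by
    rw [Ne, Ideal.absNorm_eq_zero_iff]; exact v.ne_bot)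
  set a : ℕ := 2 * m + 1 with ha
  have hu : ¬ IsUnit ((a : ℤ) : 𝓞 K) := by
    intro h
    have h1 := h.map (Algebra.norm ℤ)
    rw [← eq_intCast (algebraMap ℤ (𝓞 K)), Algebra.norm_algebraMap, isUnit_pow_iff (Module.finrank_pos).ne',
      Int.isUnit_iff] at h1
    omega
  obtain ⟨P, hP, hPa⟩ := exists_max_ideal_of_mem_nonunits (mem_nonunits_iff.2 hu)
  have hP0 : P ≠ ⊥ := by
    rintro rfl
    rw [Ideal.mem_bot] at hPa
    have : (a : ℤ) = 0 := by exact_mod_cast hPa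
    omega
  obtain ⟨v, rfl⟩ : ∃ v : HeightOneSpectrum (𝓞 K), v.asIdeal = P := ⟨⟨P, hP.isPrime, hP0⟩, rfl⟩
  refine ⟨v, fun hT => hP.ne_top ?_⟩
  rw [Ideal.eq_top_iff_one]
  have h1 : ((m : ℤ) : 𝓞 K) ∈ v.asIdeal := by
    have h2 : (Ideal.absNorm v.asIdeal : 𝓞 K) ∈ v.asIdeal := Ideal.absNorm_mem v.asIdeal
    have h3 : Ideal.absNorm v.asIdeal ∣ m := Finset.dvd_prod_of_mem (fun v : HeightOneSpectrum (𝓞 K) => Ideal.absNorm v.asIdeal) hT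
    obtain ⟨c, hc⟩ := h3
    rw [hc]; push_cast
    exact Ideal.mul_mem_right _ _ h2
  have : (1 : 𝓞 K) = ((a : ℤ) : 𝓞 K) - 2 * ((m : ℤ) : 𝓞 K) := by rw [ha]; push_cast; ring
  rw [this]
  exact sub_mem hPa (Ideal.mul_mem_left _ _ h1)

/-- `1 + g²` as a unit -/
lemma one_add_TP {g : K} {B : Kˣ} (hB : (B : K) = 1 + g ^ 2) : B ∈ TP K := by
  intro φ
  rw [hB, map_add, map_one, map_pow]; positivity

lemma one_add_LS {v : HeightOneSpectrum (𝓞 K)} {g : K} (hg : vl v g < vl v 4) {B : Kˣ} (hB : (B : K) = 1 + g ^ 2) :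
    B ∈ LS v := by
  apply mem_LS_of (z := 1)
  rw [hB, one_pow, mul_one, add_sub_cancel_left, sq, map_mul]
  exact lt_of_le_of_lt (mul_le_of_le_one_right' (hg.le.trans (vl4_le v))) hg

lemma exists_g {v : HeightOneSpectrum (𝓞 K)} (hv : Odd' v) : ∃ g0 : 𝓞 K,
    ∀ g : K, vl v (g - algebraMap (𝓞 K) K g0) < 1 → vl v (1 + g ^ 2) = 1 ∧ ∀ B : Kˣ, (B : K) = 1 + g ^ 2 → B ∉ LS v := by
  have h2 : (2 : Fv v) ≠ 0 := by
    rw [← rs_two, Ne, rs_zero_iff (vl2_le v)]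
    intro h; exact h.ne hv
  obtain ⟨c, hc⟩ := ff_one_add h2
  obtain ⟨g0, hg0⟩ := rs_surj v c
  refine ⟨g0, fun g hg => ?_⟩
  have hg0' : vl v (algebraMap (𝓞 K) K g0) ≤ 1 := v.valuation_le_one g0
  have hg1 := vl_le_of_sub hg.le hg0'
  have hrg : rs v g = c := by rw [← hg0]; exact (rs_eq_iff hg1 hg0').2 hg
  have hg2 : vl v (g ^ 2) ≤ 1 := by rw [map_pow]; exact pow_le_one' hg1 2
  have h1g : vl v (1 + g ^ 2) ≤ 1 := (Valuation.map_add _ _ _).trans (max_le (by simp) hg2)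
  have hr : rs v (1 + g ^ 2) = 1 + c ^ 2 := by
    rw [rs_add (by simp) hg2, rs_one, sq, rs_mul hg1 hg1, hrg, sq]
  have h1 : vl v (1 + g ^ 2) = 1 := by
    refine le_antisymm h1g (not_lt.1 fun h => hc ?_)
    rw [← hr, (rs_zero_iff h1g).2 h]; exact ⟨0, by simp⟩
  refine ⟨h1, fun B hB => ?_⟩
  rw [LS_odd_iff hv (by rw [hB, h1]), hB, hr]
  exact hc

/-- precision sufficient at all of `S` -/
lemma exists_prec (S : Finset (HeightOneSpectrum (𝓞 K))) : ∃ n : ℕ, 1 ≤ n ∧ ∀ v ∈ S, ∀ x : K,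
    vl v x ≤ exp (-(n : ℤ)) → vl v x < vl v 4 := by
  classical
  refine ⟨S.sup (fun v => 2 * e2 v + 1) + 1, by omega, fun v hv x hx => ?_⟩
  rw [lt_vl4_iff]
  refine hx.trans ?_
  rw [exp_le_exp]
  have := Finset.le_sup (f := fun v => 2 * e2 v + 1) hv
  push_cast at *; omega

lemma exp_neg_lt_one {n : ℕ} (hn : 1 ≤ n) : (exp (-(n : ℤ)) : ℤᵐ⁰) < 1 := by
  rw [← exp_zero, exp_lt_exp]; omega

/-- CRT choice of `B = 1 + g²`: locally square on `S`, nonsquare unit on `P` -/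
lemma exists_B (S P : Finset (HeightOneSpectrum (𝓞 K))) (hP : ∀ p ∈ P, Odd' p) (hSP : Disjoint S P) (hne : ∃ v, v ∈ S ∨ v ∈ P) :
    ∃ (g : K) (B : Kˣ), (B : K) = 1 + g ^ 2 ∧ (∀ v ∈ S, vl v g < vl v 4) ∧
      (∀ p ∈ P, vl p (B : K) = 1 ∧ B ∉ LS p) := by
  classical
  have h0 : ∀ p : HeightOneSpectrum (𝓞 K), ∃ g0 : 𝓞 K, p ∈ P → ∀ g : K, vl p (g - algebraMap (𝓞 K) K g0) < 1 →
    vl p (1 + g ^ 2) = 1 ∧ ∀ B : Kˣ, (B : K) = 1 + g ^ 2 → B ∉ LS p := by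
    intro p
    by_cases hp : p ∈ P
    · obtain ⟨g, hg⟩ := exists_g (hP p hp); exact ⟨g, fun _ => hg⟩
    · exact ⟨0, fun h => absurd h hp⟩
  choose g0 hg0 using h0
  obtain ⟨n, hn, hprec⟩ := exists_prec S
  obtain ⟨g, hg⟩ := weak_approx (S ∪ P) (fun v => if v ∈ P then algebraMap (𝓞 K) K (g0 v) else 0) n
  have hS : ∀ v ∈ S, vl v g < vl v 4 := by
    intro v hv
    have h1 := hg v (Finset.mem_union_left _ hv)
    rw [if_neg (Finset.disjoint_left.1 hSP hv), sub_zero] at h1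
    exact hprec v hv _ h1
  have hPg : ∀ p ∈ P, vl p (g - algebraMap (𝓞 K) K (g0 p)) < 1 := by
    intro v hv
    have h1 := hg v (Finset.mem_union_right _ hv)
    rw [if_pos hv] at h1
    exact lt_of_le_of_lt h1 (exp_neg_lt_one hn)
  have hB : 1 + g ^ 2 ≠ 0 := by
    obtain ⟨v, hv⟩ := hne
    intro h0
    rcases hv with hv | hv
    · have h1 := (hS v hv).trans_le (vl4_le v)
      have h2 : g ^ 2 = -1 := by linear_combination h0
      have h3 : vl v (g ^ 2) < 1 := by
        rw [map_pow]; exact pow_lt_one₀ zero_le' h1 two_ne_zero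
      rw [h2] at h3; simp at h3
    · have := (hg0 v hv g (hPg v hv)).1
      rw [h0, map_zero] at this; exact zero_ne_one this
  refine ⟨g, Units.mk0 _ hB, rfl, hS, fun p hp => ?_⟩
  have h := hg0 p hp g (hPg p hp)
  exact ⟨h.1, h.2 _ rfl⟩

theorem Qthm {κ : Kˣ} (hκ : κ ∉ Sq K) (T : Finset (HeightOneSpectrum (𝓞 K))) : ∃ q ∉ T, Odd' q ∧ κ ∉ LS q := by
  classical
  by_contra hcon
  push Not at hcon
  set T' := T ∪ finite_not_odd.toFinset with hT'
  have hodd : ∀ q ∉ T', Odd' q := by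
    intro q hq
    by_contra h
    exact hq (Finset.mem_union_right _ (by simpa using h))
  have hcon : ∀ q ∉ T', κ ∈ LS q := fun q hq =>
    hcon q (fun h => hq (Finset.mem_union_left _ h)) (hodd q hq)
  obtain ⟨q0, hq0⟩ := exists_notMem T'
  obtain ⟨g, B, hB, hBT, hBq⟩ := exists_B T' {q0} (by simpa using hodd q0 hq0) (by simpa using hq0) ⟨q0, by simp⟩
  have hBq0 := (hBq q0 (by simp)).2
  set e := κ * B with he
  have heq : e ∉ LS q0 := fun h => hBq0 ((Subgroup.mul_mem_cancel_left _ (hcon q0 hq0)).1 h)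
  obtain ⟨M, _, _, _, ⟨Q⟩⟩ := exists_quad e (fun h => heq (Sq_le_LS q0 h))
  have hupe : up K M e ∈ Sq M := Q.sq_descend.2 (Or.inr ⟨e, sq e⟩)
  have h1 : up K M κ ∉ Sq M := by
    rw [Q.sq_descend, not_or]
    refine ⟨hκ, fun h => ?_⟩
    have h2 := Sq_le_LS q0 h
    rw [he, ← mul_assoc] at h2
    exact hBq0 ((Subgroup.mul_mem_cancel_left _ (mul_self_mem_LS q0 κ)).1 h2)
  have hκe : up K M κ = up K M e * (up K M B)⁻¹ := by
    rw [he, map_mul, mul_inv_cancel_right]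
  apply h1
  apply sq_of_LS
  · rw [hκe]
    exact mul_mem (Sq_le_TP hupe) (inv_mem (TP.up (one_add_TP hB)))
  · intro w
    by_cases hw : dn K w ∈ T'
    · rw [hκe]
      exact mul_mem (Sq_le_LS w hupe) (inv_mem (LS.up K (one_add_LS (hBT _ hw) hB)))
    · exact LS.up K (hcon _ hw)

theorem Qthm' {κ B : Kˣ} (hκ : κ ∉ Sq K) (hκB : κ * B ∉ Sq K) (T : Finset (HeightOneSpectrum (𝓞 K))) :
    ∃ q ∉ T, Odd' q ∧ B ∈ LS q ∧ κ ∉ LS q := by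
  classical
  by_cases hB : B ∈ Sq K
  · obtain ⟨q, h1, h2, h3⟩ := Qthm hκ T
    exact ⟨q, h1, h2, Sq_le_LS q hB, h3⟩
  obtain ⟨M, _, _, _, ⟨Q⟩⟩ := exists_quad B hB
  set T' := T ∪ (finite_vl_ne_one κ).toFinset ∪ (finite_vl_ne_one B).toFinset with hT'
  obtain ⟨w, hw, hodd, hwκ⟩ := Qthm (K := M) (κ := up K M κ) (by rw [Q.sq_descend, not_or]; exact ⟨hκ, hκB⟩)
    (Quad.ovr K M T')
  rw [Quad.mem_ovr] at hw
  have hodd' := (Odd'.up K).1 hodd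
  simp only [hT', Finset.mem_union, not_or, Set.Finite.mem_toFinset, Set.mem_setOf_eq, not_not] at hw
  have hκ' : κ ∉ LS (dn K w) := fun h => hwκ (LS.up K h)
  refine ⟨dn K w, hw.1.1, hodd', ?_, hκ'⟩
  by_contra hBw
  have h1 : κ * B ∈ LS (dn K w) := mul_mem_LS_of_EV hodd' ⟨1, by simpa using hw.1.2⟩ ⟨1, by simpa using hw.2⟩ hκ' hBw
  have h2 := LS.up K h1
  rw [map_mul] at h2
  have hBs : up K M B ∈ Sq M := Q.sq_descend.2 (Or.inr ⟨B, sq B⟩)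
  exact hwκ ((Subgroup.mul_mem_cancel_right _ (Sq_le_LS w hBs)).1 h2)

end UD

end

section
set_option linter.all false
open IsDedekindDomain NumberField WithZero
namespace UD

section grp
variable {G : Type*} [CommGroup G]

lemma relIndex_le_two {H L : Subgroup G} (h : ∀ a ∈ L, ∀ b ∈ L, a ∉ H → b ∉ H → a⁻¹ * b ∈ H) :
    H.relIndex L ≠ 0 ∧ H.relIndex L ≤ 2 := by
  classical
  have := relIndex_le_of_fun H L (X := Bool) (fun a => decide ((a : G) ∈ H)) (by
    intro a b hab
    rw [decide_eq_decide] at hab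
    by_cases ha : (a : G) ∈ H
    · exact mul_mem (inv_mem ha) (hab.1 ha)
    · exact h a a.2 b b.2 ha (fun hb => ha (hab.2 hb)))
  simpa using this

/-- finite intersections -/
def FI {ι : Type*} (N : ι → Subgroup G) (I : Finset ι) : Subgroup G := ⨅ i ∈ I, N i

lemma mem_FI {ι : Type*} {N : ι → Subgroup G} {I : Finset ι} {x : G} : x ∈ FI N I ↔ ∀ i ∈ I, x ∈ N i := by
  simp [FI, Subgroup.mem_iInf]

lemma FI_insert {ι : Type*} [DecidableEq ι] {N : ι → Subgroup G} {I : Finset ι} {a : ι} :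
    FI N (insert a I) = N a ⊓ FI N I := by
  ext x; simp [mem_FI, Subgroup.mem_inf]

lemma FI_empty {ι : Type*} {N : ι → Subgroup G} : FI N ∅ = ⊤ := by
  ext x; simp [mem_FI]

lemma dual_index {ι : Type*} (N : ι → Subgroup G) (I : Finset ι) (L : Subgroup G) (x : ι → G)
    (h1 : ∀ i ∈ I, x i ∈ L) (h2 : ∀ i ∈ I, x i ∉ N i) (h3 : ∀ i ∈ I, ∀ j ∈ I, j ≠ i → x i ∈ N j)
    (h0 : (FI N I).relIndex L ≠ 0) : 2 ^ I.card ≤ (FI N I).relIndex L := by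
  classical
  induction I using Finset.induction_on with
  | empty => simp; omega
  | insert a I ha ih =>
    have hs := relIndex_split (H := FI N (insert a I)) (K := FI N I) L (by
      rintro y ⟨hy, -⟩
      rw [FI_insert] at hy; exact hy.2)
    have h0' : (FI N I).relIndex L ≠ 0 := by
      intro h; rw [h, mul_zero] at hs; exact h0 hs.symm
    have ih' := ih (fun i hi => h1 i (Finset.mem_insert_of_mem hi)) (fun i hi => h2 i (Finset.mem_insert_of_mem hi))
      (fun i hi j hj => h3 i (Finset.mem_insert_of_mem hi) j (Finset.mem_insert_of_mem hj)) h0'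
    have hge : 2 ≤ (FI N (insert a I)).relIndex (FI N I ⊓ L) := by
      refine two_le_relIndex (x := x a) ⟨mem_FI.2 fun j hj => ?_, h1 a (Finset.mem_insert_self _ _)⟩ ?_ ?_
      · exact h3 a (Finset.mem_insert_self _ _) j (Finset.mem_insert_of_mem hj) (fun h => ha (h ▸ hj))
      · intro h; exact h2 a (Finset.mem_insert_self _ _) (mem_FI.1 h a (Finset.mem_insert_self _ _))
      · intro h; rw [h, zero_mul] at hs; exact h0 hs.symm
    rw [Finset.card_insert_of_notMem ha, ← hs, pow_succ, mul_comm]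
    exact Nat.mul_le_mul hge ih'

lemma FI_relIndex_le {ι : Type*} (N : ι → Subgroup G) (I : Finset ι) (L : Subgroup G) (c : ι → ℕ)
    (h : ∀ i ∈ I, (N i).relIndex L ≠ 0 ∧ (N i).relIndex L ≤ c i) :
    (FI N I).relIndex L ≠ 0 ∧ (FI N I).relIndex L ≤ ∏ i ∈ I, c i := by
  classical
  induction I using Finset.induction_on with
  | empty => rw [FI_empty]; simp
  | insert a I ha ih =>
    have ih' := ih fun i hi => h i (Finset.mem_insert_of_mem hi)
    have ha' := h a (Finset.mem_insert_self _ _)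
    rw [FI_insert, Finset.prod_insert ha]
    exact ⟨Subgroup.relIndex_inf_ne_zero ha'.1 ih'.1,
      (Subgroup.relIndex_inf_le).trans (Nat.mul_le_mul ha'.2 ih'.2)⟩
end grp

variable {K : Type*} [Field K] [NumberField K]

lemma prod_norm_le (T : Finset (HeightOneSpectrum (𝓞 K))) :
    ∏ v ∈ T, (Ideal.absNorm v.asIdeal) ^ (e2 v) ≤ 2 ^ Module.finrank ℚ K := by
  have h1 : ∏ v ∈ T, v.asIdeal ^ (e2 v) ∣ Ideal.span {(2 : 𝓞 K)} := by
    apply Finset.prod_dvd_of_coprime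
    · intro v hv w hw hvw
      apply IsCoprime.pow
      rw [Ideal.isCoprime_iff_sup_eq]
      exact v.isMaximal.coprime_of_ne w.isMaximal (fun h => hvw (HeightOneSpectrum.ext h))
    · intro v hv
      rw [Ideal.dvd_span_singleton, ← vl_algebraMap_le_iff, map_ofNat (algebraMap (𝓞 K) K) 2, vl_two]
  have h2 := Nat.le_of_dvd ?_ (map_dvd Ideal.absNorm h1)
  · rw [map_prod] at h2
    simp only [map_pow] at h2
    refine h2.trans (le_of_eq ?_)
    rw [Ideal.absNorm_span_singleton]
    have : (2 : 𝓞 K) = algebraMap ℤ (𝓞 K) 2 := by simp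
    rw [this, Algebra.norm_algebraMap, Int.natAbs_pow, NumberField.RingOfIntegers.rank]
    rfl
  · apply Nat.pos_of_ne_zero
    rw [Ne, Ideal.absNorm_eq_zero_iff, Ideal.span_singleton_eq_bot]
    norm_num

lemma relIndex_EV (v : HeightOneSpectrum (𝓞 K)) : (EV v).relIndex ⊤ ≠ 0 ∧ (EV v).relIndex ⊤ ≤ 2 :=
  relIndex_le_two fun a _ b _ ha hb => mul_mem_EV (fun h => ha (inv_mem_iff.1 h)) hb

lemma relIndex_LS_top (v : HeightOneSpectrum (𝓞 K)) : (LS v).relIndex ⊤ ≠ 0 ∧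
    (LS v).relIndex ⊤ ≤ 4 * (Ideal.absNorm v.asIdeal) ^ (e2 v) := by
  have h1 := relIndex_LS_EV v
  have h2 := relIndex_EV v
  have h3 := relIndex_split (H := LS v) (K := EV v) ⊤ (fun x hx => LS_le_EV v hx.1)
  rw [inf_top_eq] at h3
  rw [← h3]
  refine ⟨mul_ne_zero h1.1 h2.1, (Nat.mul_le_mul h1.2 h2.2).trans (le_of_eq (by ring))⟩

open Classical in
lemma relIndex_LS_LN (v : HeightOneSpectrum (𝓞 K)) (B : Kˣ) : (LS v).relIndex (LN v B) ≠ 0 ∧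
    (if B ∉ LS v then 2 else 1) * (LS v).relIndex (LN v B) ≤ 4 * (Ideal.absNorm v.asIdeal) ^ (e2 v) := by
  by_cases h : B ∈ LS v
  · rw [LN_of_LS h, if_neg (not_not.2 h), one_mul]
    exact relIndex_LS_top v
  rw [if_pos h]
  by_cases h' : B ∈ UR v
  · rw [LN_of_UR h h']
    have h1 := relIndex_LS_EV v
    exact ⟨h1.1, by linarith [h1.2]⟩
  · have h1 : (LS v).relIndex (LN v B) ≠ 0 ∧ (LS v).relIndex (LN v B) ≤ 2 := by
      apply relIndex_le_two
      intro a ha b hb ha' hb'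
      have h2 := ((mem_LN_RAM h').1 ha).resolve_left ha'
      have h3 := ((mem_LN_RAM h').1 hb).resolve_left hb'
      have h4 := mul_mem (mul_mem (inv_mem h2) h3) (mul_mem (inv_mem (one_mem (LS v))) (one_mem (LS v)))
      convert h4 using 1
      apply Units.ext; push_cast; field_simp
    refine ⟨h1.1, ?_⟩
    have : 1 ≤ (Ideal.absNorm v.asIdeal) ^ (e2 v) := Nat.one_le_pow _ _ (Nat.pos_of_ne_zero (by
      rw [Ne, Ideal.absNorm_eq_zero_iff]; exact v.ne_bot))
    omega

open Classical in
/-- the upper bound -/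
lemma upper (T : Finset (HeightOneSpectrum (𝓞 K))) (B : Kˣ) (L : Subgroup Kˣ) (hL : L ≤ FI (fun v => LN v B) T) :
    (FI LS T ⊓ TP K).relIndex L ≠ 0 ∧
    2 ^ (T.filter (fun v => B ∉ LS v)).card * (FI LS T ⊓ TP K).relIndex L ≤
      2 ^ (2 * (Fintype.card (InfinitePlace K) + T.card)) := by
  have h1 := FI_relIndex_le LS T L (fun v => (LS v).relIndex (LN v B)) (fun v hv => by
    have h1 := (relIndex_LS_LN v B).1
    have hle : L ≤ LN v B := fun x hx => mem_FI.1 (hL hx) v hv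
    exact ⟨fun h => h1 (Subgroup.relIndex_eq_zero_of_le_right hle h), Subgroup.relIndex_le_of_le_right hle h1⟩)
  have h2 := TP_index (K := K)
  have h3 : (TP K).relIndex L ≠ 0 ∧ (TP K).relIndex L ≤ 2 ^ InfinitePlace.nrRealPlaces K :=
    ⟨fun h => h2.1 (Subgroup.relIndex_eq_zero_of_le_right le_top h), (Subgroup.relIndex_le_of_le_right le_top h2.1).trans h2.2⟩
  refine ⟨Subgroup.relIndex_inf_ne_zero h1.1 h3.1, ?_⟩
  have h4 : 2 ^ (T.filter (fun v => B ∉ LS v)).card * ∏ v ∈ T, (LS v).relIndex (LN v B) ≤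
      4 ^ T.card * 2 ^ Module.finrank ℚ K := by
    have : 2 ^ (T.filter (fun v => B ∉ LS v)).card = ∏ v ∈ T, (if B ∉ LS v then 2 else 1) := by
      rw [Finset.prod_ite]; simp
    rw [this, ← Finset.prod_mul_distrib]
    refine (Finset.prod_le_prod' fun v _ => (relIndex_LS_LN v B).2).trans ?_
    rw [Finset.prod_mul_distrib, Finset.prod_const]
    exact Nat.mul_le_mul le_rfl (prod_norm_le T)
  have h5 : Module.finrank ℚ K + InfinitePlace.nrRealPlaces K = 2 * Fintype.card (InfinitePlace K) := by
    have a1 := InfinitePlace.card_add_two_mul_card_eq_rank K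
    have a2 := InfinitePlace.card_eq_nrRealPlaces_add_nrComplexPlaces K
    omega
  calc _ ≤ 2 ^ (T.filter (fun v => B ∉ LS v)).card * ((∏ v ∈ T, (LS v).relIndex (LN v B)) * 2 ^ InfinitePlace.nrRealPlaces K) := by
        exact Nat.mul_le_mul le_rfl ((Subgroup.relIndex_inf_le).trans (Nat.mul_le_mul h1.2 h3.2))
    _ = (2 ^ (T.filter (fun v => B ∉ LS v)).card * (∏ v ∈ T, (LS v).relIndex (LN v B))) * 2 ^ InfinitePlace.nrRealPlaces K := by ring
    _ ≤ (4 ^ T.card * 2 ^ Module.finrank ℚ K) * 2 ^ InfinitePlace.nrRealPlaces K := by gcongr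
    _ = 2 ^ (2 * T.card + (Module.finrank ℚ K + InfinitePlace.nrRealPlaces K)) := by
        rw [show (4 : ℕ) = 2 ^ 2 by norm_num, ← pow_mul, pow_add, pow_add]; ring
    _ = _ := by rw [h5]; congr 1; ring

/-- choice of auxiliary primes -/
lemma exists_aux {T : Finset (HeightOneSpectrum (𝓞 K))} (hT : Large T) {B : Kˣ} (hBT : B ∈ KT T) (k : ℕ)
    (hk : k + 1 ≤ Fintype.card (InfinitePlace K) + T.card) :
    ∃ P : Finset (HeightOneSpectrum (𝓞 K)), P.card = k ∧ (∀ q ∈ P, q ∉ T ∧ Odd' q ∧ B ∈ LS q) ∧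
      (∀ q ∈ P, ∃ u ∈ KT T, u ∉ LS q ∧ ∀ q' ∈ P, q' ≠ q → u ∈ LS q') ∧
      (Sq K).relIndex (FI LS P ⊓ KT T) * 2 ^ k = 2 ^ (Fintype.card (InfinitePlace K) + T.card) := by
  classical
  induction k with
  | zero => exact ⟨∅, rfl, by simp, by simp, by rw [FI_empty, top_inf_eq, relIndex_Sq]; simp⟩
  | succ k ih =>
    obtain ⟨P, hPk, hP1, hP2, hP3⟩ := ih (by omega)
    set H := FI LS P ⊓ KT T with hH
    have hgt : 2 < (Sq K).relIndex H := by
      by_contra hle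
      push Not at hle
      have : 2 ^ (k + 2) ≤ (2 : ℕ) ^ (Fintype.card (InfinitePlace K) + T.card) :=
        Nat.pow_le_pow_right (by norm_num) (by omega)
      rw [← hP3] at this
      have h2 : (Sq K).relIndex H * 2 ^ k ≤ 2 * 2 ^ k := Nat.mul_le_mul hle le_rfl
      have h3 : 0 < 2 ^ k := by positivity
      rw [pow_add] at this
      nlinarith
    obtain ⟨κ, hκH, hκ1, hκ2⟩ : ∃ κ ∈ H, κ ∉ Sq K ∧ κ * B ∉ Sq K := by
      by_contra hcon
      push Not at hcon
      refine absurd (relIndex_le_two (H := Sq K) (L := H) fun a ha b hb ha' hb' => ?_).2 (not_le.2 hgt)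
      have := mul_mem (inv_mem (hcon a ha ha')) (hcon b hb hb')
      convert this using 1
      apply Units.ext; push_cast; field_simp
    obtain ⟨q, hq, hodd, hqB, hqκ⟩ := Qthm' hκ1 hκ2 (T ∪ P)
    rw [Finset.mem_union, not_or] at hq
    have hEV : ∀ x ∈ KT T, x ∈ EV q := fun x hx => ⟨1, by simpa using hx q hq.1⟩
    have hidx : (LS q).relIndex H = 2 := by
      have h1 := relIndex_le_two (H := LS q) (L := H) fun a ha b hb ha' hb' =>
        mul_mem_LS_of_EV hodd (hEV _ (inv_mem ha.2)) (hEV _ hb.2) (fun h => ha' (inv_mem_iff.1 h)) hb'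
      have h2 := two_le_relIndex hκH hqκ h1.1
      omega
    refine ⟨insert q P, by rw [Finset.card_insert_of_notMem hq.2, hPk], ?_, ?_, ?_⟩
    · intro q' hq'
      rcases Finset.mem_insert.1 hq' with rfl | h
      · exact ⟨hq.1, hodd, hqB⟩
      · exact hP1 q' h
    · intro q' hq'
      rcases Finset.mem_insert.1 hq' with rfl | h
      · refine ⟨κ, hκH.2, hqκ, fun q'' h1 h2 => ?_⟩
        exact mem_FI.1 hκH.1 q'' ((Finset.mem_insert.1 h1).resolve_left h2)
      · obtain ⟨u, hu, hu1, hu2⟩ := hP2 q' h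
        by_cases huq : u ∈ LS q
        · refine ⟨u, hu, hu1, fun q'' h1 h2 => ?_⟩
          rcases Finset.mem_insert.1 h1 with rfl | h3
          · exact huq
          · exact hu2 q'' h3 h2
        · refine ⟨u * κ, mul_mem hu hκH.2, ?_, fun q'' h1 h2 => ?_⟩
          · intro h'; exact hu1 ((Subgroup.mul_mem_cancel_right _ (mem_FI.1 hκH.1 q' h)).1 h')
          rcases Finset.mem_insert.1 h1 with rfl | h3
          · exact mul_mem_LS_of_EV hodd (hEV _ hu) (hEV _ hκH.2) huq hqκ
          · exact mul_mem (hu2 q'' h3 h2) (mem_FI.1 hκH.1 q'' h3)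
    · have h1 := relIndex_split (H := Sq K) (K := LS q) H (fun x hx => Sq_le_LS q hx.1)
      rw [FI_insert, inf_assoc, ← hH, ← hP3, ← h1, hidx, pow_succ]; ring

end UD

end

section
set_option linter.all false
open IsDedekindDomain NumberField WithZero
namespace UD
variable {K : Type*} [Field K] [NumberField K]

open Classical in
lemma F1' {B : Kˣ} {T : Finset (HeightOneSpectrum (𝓞 K))} (hT : Large T) (hBT : B ∈ KT T)
    (hB : B ∈ TP K) (hsq : B ∉ Sq K) : ∃ N : Subgroup Kˣ,
    2 * N.relIndex (KT T) ≤ 2 ^ (T.filter (fun v => B ∉ LS v)).card ∧ N.relIndex (KT T) ≠ 0 ∧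
    ∀ n ∈ N, ∃ x y : K, (n : K) = x ^ 2 - B * y ^ 2 := by
  obtain ⟨M, _, _, _, ⟨Q⟩⟩ := exists_quad B hsq
  have := Q.F1 hT hBT hB
  refine ⟨_, this.1, this.2, ?_⟩
  rintro _ ⟨z, -, rfl⟩
  obtain ⟨a, b, -, h⟩ := Q.nm_rep z
  exact ⟨a, b, h⟩

open Classical in
lemma kap_sq {T P : Finset (HeightOneSpectrum (𝓞 K))} (hT : Large T)
    (hP1 : ∀ q ∈ P, q ∉ T ∧ Odd' q)
    (hP2 : ∀ q ∈ P, ∃ u ∈ KT T, u ∉ LS q ∧ ∀ q' ∈ P, q' ≠ q → u ∈ LS q') {κ : Kˣ}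
    (h1 : κ ∈ KT (T ∪ P)) (h2 : κ ∈ FI LS T) (h3 : κ ∈ TP K) : κ ∈ Sq K := by
  by_contra hsq
  obtain ⟨N, hN1, hN0, hN⟩ := F1' (hT.mono Finset.subset_union_left) h1 h3 hsq
  set T1 := (T ∪ P).filter (fun v => κ ∉ LS v) with hT1
  have hT1P : ∀ q ∈ T1, q ∈ P ∧ κ ∉ LS q := by
    intro q hq
    rw [hT1, Finset.mem_filter, Finset.mem_union] at hq
    refine ⟨hq.1.resolve_left fun h => hq.2 (mem_FI.1 h2 q h), hq.2⟩
  set L := KT (T ∪ P)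
  have hle : N ≤ FI (fun v => LN v κ) T1 := by
    intro n hn
    rw [mem_FI]
    intro q hq
    obtain ⟨x, y, hxy⟩ := hN n hn
    exact norm_mem_LN (Or.inl (hP1 q (hT1P q hq).1).2) hxy
  have e1 := Subgroup.relIndex_le_of_le_left (L := L) hle hN0
  have e0 : (FI (fun v => LN v κ) T1).relIndex L ≠ 0 :=
    fun h => hN0 (Subgroup.relIndex_eq_zero_of_le_left hle h)
  set I1 := T1.filter (fun v => κ ∈ UR v) with hI1
  set I2 := T1.filter (fun v => ¬ κ ∈ UR v) with hI2
  have hc : I1.card + I2.card = T1.card := Finset.card_filter_add_card_filter_not _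
  have hs := relIndex_split (H := FI (fun v => LN v κ) T1) (K := FI (fun v => LN v κ) I1) L (by
    rintro x ⟨hx, -⟩
    exact mem_FI.2 fun q hq => mem_FI.1 hx q (Finset.mem_filter.1 hq).1)
  rw [← hs] at e0
  have g1 : 2 ^ I1.card ≤ (FI (fun v => LN v κ) I1).relIndex L := by
    have hw : ∀ q, ∃ w : Kˣ, q ∈ I1 → (vl q (w : K) = exp (-1 : ℤ) ∧ ∀ v ∉ T, v ≠ q → vl v (w : K) = 1) := by
      intro q
      by_cases hq : q ∈ I1
      · obtain ⟨w, hw⟩ := hT.2 q (hP1 q (hT1P q (Finset.mem_filter.1 hq).1).1).1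
        exact ⟨w, fun _ => hw⟩
      · exact ⟨1, fun h => absurd h hq⟩
    choose w hw using hw
    refine dual_index _ _ _ w ?_ ?_ ?_ (right_ne_zero_of_mul e0)
    · intro q hq v hv
      rw [Finset.mem_union, not_or] at hv
      exact (hw q hq).2 v hv.1 (fun h => hv.2 (h ▸ (hT1P q (Finset.mem_filter.1 hq).1).1))
    · intro q hq
      change w q ∉ LN q κ
      rw [LN_of_UR (hT1P q (Finset.mem_filter.1 hq).1).2 (Finset.mem_filter.1 hq).2, mem_EV_iff (hw q hq).1]
      decide
    · intro q hq j hj hjq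
      change w q ∈ LN j κ
      rw [LN_of_UR (hT1P j (Finset.mem_filter.1 hj).1).2 (Finset.mem_filter.1 hj).2]
      exact ⟨1, by simpa using (hw q hq).2 j (hP1 j (hT1P j (Finset.mem_filter.1 hj).1).1).1 hjq⟩
  have g2 : 2 ^ I2.card ≤ (FI (fun v => LN v κ) T1).relIndex (FI (fun v => LN v κ) I1 ⊓ L) := by
    have hle2 : FI (fun v => LN v κ) T1 ≤ FI (fun v => LN v κ) I2 :=
      fun x hx => mem_FI.2 fun q hq => mem_FI.1 hx q (Finset.mem_filter.1 hq).1
    refine le_trans ?_ (Subgroup.relIndex_le_of_le_left hle2 (left_ne_zero_of_mul e0))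
    have hu : ∀ q, ∃ u : Kˣ, q ∈ I2 → (u ∈ KT T ∧ u ∉ LS q ∧ ∀ q' ∈ P, q' ≠ q → u ∈ LS q') := by
      intro q
      by_cases hq : q ∈ I2
      · obtain ⟨w, hw⟩ := hP2 q (hT1P q (Finset.mem_filter.1 hq).1).1
        exact ⟨w, fun _ => hw⟩
      · exact ⟨1, fun h => absurd h hq⟩
    choose u hu using hu
    refine dual_index _ _ _ u ?_ ?_ ?_ (fun h => left_ne_zero_of_mul e0 (Subgroup.relIndex_eq_zero_of_le_left hle2 h))
    · intro q hq
      refine ⟨mem_FI.2 fun j hj => LS_le_LN j κ ((hu q hq).2.2 j (hT1P j (Finset.mem_filter.1 hj).1).1 ?_),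
        KT_mono Finset.subset_union_left (hu q hq).1⟩
      rintro rfl
      exact (Finset.mem_filter.1 hq).2 (Finset.mem_filter.1 hj).2
    · intro q hq
      change u q ∉ LN q κ
      have hqP := hP1 q (hT1P q (Finset.mem_filter.1 hq).1).1
      rw [mem_LN_RAM (Finset.mem_filter.1 hq).2]
      rintro (h | h)
      · exact (hu q hq).2.1 h
      · have := LS_le_EV _ h
        rw [neg_mem_EV] at this
        have hue : u q ∈ EV q := ⟨1, by simpa using (hu q hq).1 q hqP.1⟩
        rw [Subgroup.mul_mem_cancel_left _ hue, ← hqP.2.UR_eq] at this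
        exact (Finset.mem_filter.1 hq).2 this
    · intro q hq j hj hjq
      exact LS_le_LN j κ ((hu q hq).2.2 j (hT1P j (Finset.mem_filter.1 hj).1).1 hjq)
  have g3 := Nat.mul_le_mul g2 g1
  rw [hs, ← pow_add, add_comm, hc] at g3
  have : 0 < 2 ^ T1.card := by positivity
  omega

/-- semi-nice -/
structure SN (B : Kˣ) : Prop where
  tp : B ∈ TP K
  adm : ∀ v, Adm v B

open Classical in
lemma F2 {B : Kˣ} (hB : SN B) (hsq : B ∉ Sq K) {T : Finset (HeightOneSpectrum (𝓞 K))} (hT : Large T)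
    (hBT : B ∈ KT T) : ∃ T', T ⊆ T' ∧ (∀ v ∈ T', v ∉ T → B ∈ LS v) ∧
      (∀ A ∈ KT T', (∀ v ∈ T, A ∈ LN v B) → ∃ x y : K, (A : K) = x ^ 2 - B * y ^ 2) ∧
      2 ^ (T.filter (fun v => B ∉ LS v)).card ≤ 2 * (FI (fun v => LN v B) T).relIndex (KT T') := by
  set s := Fintype.card (InfinitePlace K) + T.card with hs
  have hs1 : 1 ≤ s := by
    have : 0 < Fintype.card (InfinitePlace K) := Fintype.card_pos
    omega
  obtain ⟨P, hPc, hP1, hP2, -⟩ := exists_aux hT hBT (s - 1) (by omega)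
  have hdis : Disjoint T P := Finset.disjoint_left.2 fun v hv hv' => (hP1 v hv').1 hv
  have hTT : T ⊆ T ∪ P := Finset.subset_union_left
  have hcard : (T ∪ P).card = T.card + (s - 1) := by rw [Finset.card_union_of_disjoint hdis, hPc]
  have hfil : (T ∪ P).filter (fun v => B ∉ LS v) = T.filter (fun v => B ∉ LS v) := by
    ext v
    simp only [Finset.mem_filter, Finset.mem_union]
    constructor
    · rintro ⟨h | h, h'⟩
      · exact ⟨h, h'⟩
      · exact absurd (hP1 v h).2.2 h'
    · rintro ⟨h, h'⟩; exact ⟨Or.inl h, h'⟩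
  obtain ⟨N, hN1, hN0, hN⟩ := F1' (hT.mono hTT) (KT_mono hTT hBT) hB.tp hsq
  rw [hfil] at hN1
  set L := KT (T ∪ P)
  set Pn := FI (fun v => LN v B) T
  have hup := upper T B (Pn ⊓ L) inf_le_left
  rw [← hs] at hup
  have hker : FI LS T ⊓ TP K ⊓ L ≤ Sq K := by
    rintro κ ⟨⟨h1, h2⟩, h3⟩
    exact kap_sq hT (fun q hq => ⟨(hP1 q hq).1, (hP1 q hq).2.1⟩) hP2 h3 h1 h2
  have hsp := relIndex_split (H := FI LS T ⊓ TP K) (K := Pn) L (by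
    rintro κ ⟨⟨h1, h2⟩, h3⟩
    exact mem_FI.2 fun v hv => LS_le_LN v B (mem_FI.1 h1 v hv))
  have hNPn : N ≤ Pn := fun n hn => mem_FI.2 fun v hv => by
    obtain ⟨x, y, h⟩ := hN n hn
    exact norm_mem_LN (hB.adm v) h
  have hPn0 : Pn.relIndex L ≠ 0 := fun h => hN0 (Subgroup.relIndex_eq_zero_of_le_left hNPn h)
  have hq1 : 2 ^ (s + (s - 1)) ≤ (FI LS T ⊓ TP K).relIndex L := by
    have h1 := relIndex_Sq (T ∪ P)
    rw [hcard, ← add_assoc, ← hs] at h1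
    rw [← h1, ← Subgroup.inf_relIndex_right (FI LS T ⊓ TP K)]
    apply Subgroup.relIndex_le_of_le_left hker
    rw [Subgroup.inf_relIndex_right, ← hsp]
    exact mul_ne_zero hup.1 hPn0
  rw [← hsp] at hq1
  have key : 2 ^ (T.filter (fun v => B ∉ LS v)).card ≤ 2 * Pn.relIndex L := by
    have h2 : (2 : ℕ) ^ (2 * s) = 2 * 2 ^ (s + (s - 1)) := by
      rw [← pow_succ']; congr 1; omega
    have h3 : 0 < 2 ^ (s + (s - 1)) := by positivity
    rw [h2] at hup
    have h4 := Nat.mul_le_mul (le_refl (2 ^ (T.filter (fun v => B ∉ LS v)).card)) hq1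
    have h5 := Nat.mul_le_mul hup.2 (le_refl (Pn.relIndex L))
    have h6 := h4.trans (le_trans (le_of_eq (by ring)) h5)
    have h7 : 2 ^ (T.filter (fun v => B ∉ LS v)).card * 2 ^ (s + (s - 1)) ≤ (2 * Pn.relIndex L) * 2 ^ (s + (s - 1)) :=
      h6.trans (le_of_eq (by ring))
    exact Nat.le_of_mul_le_mul_right h7 h3
  refine ⟨T ∪ P, hTT, ?_, ?_, key⟩
  · intro v hv hv'
    exact (hP1 v ((Finset.mem_union.1 hv).resolve_left hv')).2.2
  · intro A hA hA'
    have h1 := relIndex_split (H := N) (K := Pn) L (fun x hx => hNPn hx.1)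
    have h2 : N.relIndex (Pn ⊓ L) * Pn.relIndex L ≤ 1 * Pn.relIndex L := by
      rw [h1]; omega
    have h3 := Nat.le_of_mul_le_mul_right h2 (Nat.pos_of_ne_zero hPn0)
    have h4 : N.relIndex (Pn ⊓ L) ≠ 0 := fun h => by rw [h, zero_mul] at h1; exact hN0 h1.symm
    have h5 : N.relIndex (Pn ⊓ L) = 1 := by omega
    exact hN A (Subgroup.relIndex_eq_one.1 h5 ⟨mem_FI.2 hA', hA⟩)

lemma mem_LN_unit {v : HeightOneSpectrum (𝓞 K)} (hv : Odd' v) {A B : Kˣ} (hA : A ∈ EV v) (hB : B ∈ EV v) :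
    A ∈ LN v B := hv.mem_LN.2 (Or.inr (Or.inr (Or.inr ⟨hA, hB⟩)))

lemma EV_of_one {v : HeightOneSpectrum (𝓞 K)} {A : Kˣ} (h : vl v (A : K) = 1) : A ∈ EV v := ⟨1, by simpa using h⟩

lemma exists_T (S : Finset (HeightOneSpectrum (𝓞 K))) (A B : Kˣ) :
    ∃ T, S ⊆ T ∧ Large T ∧ A ∈ KT T ∧ B ∈ KT T := by
  classical
  obtain ⟨T, h1, h2⟩ := exists_Large (S ∪ (finite_vl_ne_one A).toFinset ∪ (finite_vl_ne_one B).toFinset)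
  refine ⟨T, ?_, h2, ?_, ?_⟩
  · exact fun v hv => h1 (by simp [hv])
  · intro v hv; by_contra h; exact hv (h1 (by simp [h]))
  · intro v hv; by_contra h; exact hv (h1 (by simp [h]))

/-- Hasse norm principle for semi-nice `B`. -/
theorem Hasse {B : Kˣ} (hB : SN B) {A : Kˣ} (hA : ∀ v, A ∈ LN v B) : ∃ x y : K, (A : K) = x ^ 2 - B * y ^ 2 := by
  by_cases hsq : B ∈ Sq K
  · obtain ⟨b, rfl⟩ := hsq
    refine ⟨(A + 1) / 2, (A - 1) / (2 * b), ?_⟩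
    have : (b : K) ≠ 0 := b.ne_zero
    push_cast
    field_simp
    simp
    ring
  · obtain ⟨T, -, hT, hAT, hBT⟩ := exists_T ∅ A B
    obtain ⟨T', hTT, -, h, -⟩ := F2 hB hsq hT hBT
    exact h A (KT_mono hTT hAT) fun v _ => hA v

open Classical in
/-- local symbol -/
noncomputable def ch (v : HeightOneSpectrum (𝓞 K)) (B A : Kˣ) : ℤˣ := if A ∈ LN v B then 1 else -1

lemma ch_eq_one {v : HeightOneSpectrum (𝓞 K)} {A B : Kˣ} : ch v B A = 1 ↔ A ∈ LN v B := by
  rw [ch]; split_ifs with h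
  · simp [h]
  · simp only [h, iff_false]; decide

lemma ch_mul {v : HeightOneSpectrum (𝓞 K)} {B : Kˣ} (hB : Adm v B) (A A' : Kˣ) :
    ch v B (A * A') = ch v B A * ch v B A' := by
  have := mul_mem_LN_iff hB (x := A) (y := A')
  by_cases h1 : A ∈ LN v B <;> by_cases h2 : A' ∈ LN v B <;> simp [ch, this, h1, h2]

/-- realization up to index two -/
theorem R2 {B : Kˣ} (hB : SN B) (f f' : HeightOneSpectrum (𝓞 K) → ℤˣ) (S : Finset (HeightOneSpectrum (𝓞 K)))
    (hf : ∀ v ∉ S, f v = 1) (hf' : ∀ v ∉ S, f' v = 1) (hf1 : ∀ v, B ∈ LS v → f v = 1) (hf1' : ∀ v, B ∈ LS v → f' v = 1) :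
    ∃ A : Kˣ, (∀ v, ch v B A = f v) ∨ (∀ v, ch v B A = f' v) ∨ (∀ v, ch v B A = f v * f' v) := by
  classical
  by_cases hsq : B ∈ Sq K
  · refine ⟨1, Or.inl fun v => ?_⟩
    rw [hf1 v (Sq_le_LS v hsq), ch_eq_one]; exact one_mem _
  obtain ⟨T, hST, hT, -, hBT⟩ := exists_T S B B
  obtain ⟨T', hTT, hT'1, -, hidx⟩ := F2 hB hsq hT hBT
  set T1 := T.filter (fun v => B ∉ LS v) with hT1
  let φ : Kˣ →* (T1 → ℤˣ) :=
    { toFun := fun A v => ch v B A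
      map_one' := by funext v; rw [Pi.one_apply, ch_eq_one]; exact one_mem _
      map_mul' := fun A A' => by funext v; exact ch_mul (hB.adm v) A A' }
  set ψ := φ.comp (KT T').subtype with hψ
  have hker : ψ.ker = (FI (fun v => LN v B) T).subgroupOf (KT T') := by
    ext A
    rw [MonoidHom.mem_ker, Subgroup.mem_subgroupOf, mem_FI]
    constructor
    · intro h v hv
      by_cases h' : B ∈ LS v
      · change _ ∈ LN v B
        rw [LN_of_LS h']; trivial
      · have := congrFun h ⟨v, Finset.mem_filter.2 ⟨hv, h'⟩⟩
        exact ch_eq_one.1 this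
    · intro h
      funext v
      exact ch_eq_one.2 (h v (Finset.mem_filter.1 v.2).1)
  have hcard : Nat.card ψ.range = (FI (fun v => LN v B) T).relIndex (KT T') := by
    rw [← Subgroup.index_ker, hker, Subgroup.relIndex]
  have hc2 := Subgroup.card_mul_index ψ.range
  have hc3 : Nat.card (T1 → ℤˣ) = 2 ^ T1.card := by simp
  rw [hc3, hcard] at hc2
  have hi : ψ.range.index ≤ 2 := by
    have hpos : 0 < (FI (fun v => LN v B) T).relIndex (KT T') := by
      apply Nat.pos_of_ne_zero; intro h; rw [h, zero_mul] at hc2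
      exact absurd hc2.symm (by positivity)
    by_contra h
    push Not at h
    nlinarith
  have fin : ∀ g : HeightOneSpectrum (𝓞 K) → ℤˣ, (∀ v ∉ S, g v = 1) → (∀ v, B ∈ LS v → g v = 1) →
      (fun v : T1 => g v) ∈ ψ.range → ∃ A : Kˣ, ∀ v, ch v B A = g v := by
    rintro g hg hg1 ⟨⟨A, hA⟩, hA'⟩
    refine ⟨A, fun v => ?_⟩
    by_cases h1 : B ∈ LS v
    · rw [hg1 v h1, ch_eq_one, LN_of_LS h1]; trivial
    by_cases h2 : v ∈ T
    · exact congrFun hA' ⟨v, Finset.mem_filter.2 ⟨h2, h1⟩⟩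
    · rw [hg v (fun h => h2 (hST h)), ch_eq_one]
      have hv : Odd' v := by by_contra h; exact h2 (hT.1 v h)
      by_cases h3 : v ∈ T'
      · exact absurd (hT'1 v h3 h2) h1
      · exact mem_LN_unit hv (EV_of_one (hA v h3)) (EV_of_one (hBT v h2))
  by_cases m1 : (fun v : T1 => f v) ∈ ψ.range
  · obtain ⟨A, hA⟩ := fin f hf hf1 m1; exact ⟨A, Or.inl hA⟩
  by_cases m2 : (fun v : T1 => f' v) ∈ ψ.range
  · obtain ⟨A, hA⟩ := fin f' hf' hf1' m2; exact ⟨A, Or.inr (Or.inl hA)⟩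
  have hi2 : ψ.range.index = 2 := by
    have h0 : ψ.range.index ≠ 0 := by
      intro h; rw [h, mul_zero] at hc2; exact absurd hc2.symm (by positivity)
    have h1 : ψ.range.index ≠ 1 := by
      intro h; rw [Subgroup.index_eq_one] at h; rw [h] at m1; exact m1 trivial
    omega
  have m3 := (Subgroup.mul_mem_iff_of_index_two hi2 (a := fun v : T1 => f v) (b := fun v : T1 => f' v)).2 (by simp [m1, m2])
  obtain ⟨A, hA⟩ := fin (fun v => f v * f' v) (fun v hv => by rw [hf v hv, hf' v hv, one_mul])
    (fun v hv => by rw [hf1 v hv, hf1' v hv, one_mul]) m3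
  exact ⟨A, Or.inr (Or.inr hA)⟩

end UD

end

section
set_option linter.all false
open IsDedekindDomain NumberField WithZero
namespace UD
variable {K : Type*} [Field K] [NumberField K]

lemma Quad.HL {M : Type*} [Field M] [NumberField M] [Algebra K M] {D : Kˣ} (Q : Quad K M D) {A B : Kˣ} {x y : M}
    (h : algebraMap K M A = x ^ 2 - algebraMap K M B * y ^ 2)
    (hA : ¬ ∃ x y : K, (A : K) = x ^ 2 - B * y ^ 2) :
    ∃ α β γ : K, (D : K) = A * α ^ 2 + B * β ^ 2 - A * B * γ ^ 2 := by
  obtain ⟨x1, x2, rfl⟩ := Q.rep x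
  obtain ⟨y1, y2, rfl⟩ := Q.rep y
  have hs := Q.sq
  have h0 : algebraMap K M (x1 ^ 2 + D * x2 ^ 2 - B * (y1 ^ 2 + D * y2 ^ 2) - A) +
      algebraMap K M (2 * (x1 * x2 - B * y1 * y2)) * Q.β = 0 := by
    simp only [map_sub, map_add, map_mul, map_pow, map_ofNat (algebraMap K M) 2]
    rw [← hs]
    linear_combination -h
  obtain ⟨e1, e2⟩ := Q.indep h0
  have e2' : x1 * x2 - B * y1 * y2 = 0 := by
    rcases mul_eq_zero.1 e2 with h | h
    · exact absurd h two_ne_zero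
    · exact h
  have hN : x2 ^ 2 - B * y2 ^ 2 ≠ 0 := by
    intro hN
    by_cases hy2 : y2 = 0
    · subst hy2
      have hx2 : x2 = 0 := by simpa using hN
      subst hx2
      exact hA ⟨x1, y1, by linear_combination -e1⟩
    · apply hA
      have hb : (B : K) = (x2 / y2) ^ 2 := by field_simp; linear_combination -hN
      have hx2 : x2 ≠ 0 := by
        rintro rfl
        have : (B : K) = 0 := by rw [hb]; simp
        exact B.ne_zero this
      refine ⟨(A + 1) / 2, (A - 1) / (2 * (x2 / y2)), ?_⟩
      rw [hb]; field_simp; ring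
  refine ⟨x2 / (x2 ^ 2 - B * y2 ^ 2), (y1 * x2 - x1 * y2) / (x2 ^ 2 - B * y2 ^ 2), y2 / (x2 ^ 2 - B * y2 ^ 2), ?_⟩
  field_simp
  linear_combination (x2 ^ 2 - B * y2 ^ 2) * e1 - (x1 * x2 - B * y1 * y2) * e2'

section bc
variable {M : Type*} [Field M] [NumberField M] [Algebra K M]

lemma Adm.up' {w : HeightOneSpectrum (𝓞 M)} {B : Kˣ} (h : Adm (dn K w) B) : Adm w (up K M B) := by
  rcases h with h | h
  · exact Or.inl ((Odd'.up K).2 h)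
  · exact Or.inr (UR.up K h)

lemma SN.up {B : Kˣ} (h : SN B) : SN (up K M B) := ⟨TP.up h.tp, fun w => (h.adm _).up'⟩

lemma up_neg (x : Kˣ) : up K M (-x) = - up K M x := by
  apply Units.ext; simp

lemma BC1 {w : HeightOneSpectrum (𝓞 M)} {A B : Kˣ} (h : A ∈ LN (dn K w) B) : up K M A ∈ LN w (up K M B) := by
  by_cases hl : up K M B ∈ LS w
  · rw [LN_of_LS hl]; trivial
  by_cases hB : B ∈ UR (dn K w)
  · have : B ∉ LS (dn K w) := fun h => hl (LS.up K h)
    rw [LN_of_UR this hB] at h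
    rw [LN_of_UR hl (UR.up K hB)]
    exact EV.up K h
  · rw [mem_LN_RAM hB] at h
    rcases h with h | h
    · exact LS_le_LN _ _ (LS.up K h)
    · have h' := LS.up K h
      rw [up_neg, map_mul] at h'
      by_cases hu : up K M B ∈ UR w
      · rw [LN_of_UR hl hu]
        have := LS_le_EV _ h'
        rwa [neg_mem_EV, Subgroup.mul_mem_cancel_right _ (UR_le_EV _ hu)] at this
      · rw [mem_LN_RAM hu]; exact Or.inr h'

lemma Quad.BC2 {D : Kˣ} (Q : Quad K M D) {w : HeightOneSpectrum (𝓞 M)} {A B : Kˣ} (hB : Adm (dn K w) B)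
    (h : A ∉ LN (dn K w) B) (hD : D ∉ EV (dn K w) ∨ (Odd' (dn K w) ∧ D ∉ LS (dn K w))) :
    up K M A ∈ LN w (up K M B) := by
  have hDsq : up K M D ∈ LS w := by
    have : up K M D = Q.β ^ 2 := by apply Units.ext; simp [Q.sq]
    rw [this]; exact sq_mem_LS w _
  by_cases hDE : D ∈ EV (dn K w)
  · obtain ⟨hodd, hDL⟩ := hD.resolve_left (not_not.2 hDE)
    have hodd' : Odd' w := (Odd'.up K).2 hodd
    have key : ∀ x : Kˣ, x ∈ EV (dn K w) → up K M x ∈ LS w := by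
      intro x hx
      by_cases hxl : x ∈ LS (dn K w)
      · exact LS.up K hxl
      have := LS.up K (mul_mem_LS_of_EV hodd hx hDE hxl hDL)
      rwa [map_mul, Subgroup.mul_mem_cancel_right _ hDsq] at this
    rw [hodd'.mem_LN]
    by_cases hA : A ∈ EV (dn K w)
    · exact Or.inl (key A hA)
    by_cases hB : B ∈ EV (dn K w)
    · exact Or.inr (Or.inl (key B hB))
    have := key (-(A * B)) (neg_mem_EV.2 (mul_mem_EV hA hB))
    rw [up_neg, map_mul] at this
    exact Or.inr (Or.inr (Or.inl this))
  · have hev : ∀ x : Kˣ, up K M x ∈ EV w := by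
      intro x
      obtain ⟨e, he, hv⟩ := vl_up K w
      obtain ⟨n, hn⟩ := vl_unit_eq (dn K w) D
      obtain ⟨m, hm⟩ := vl_unit_eq (dn K w) x
      obtain ⟨k, hk⟩ := vl_unit_eq w Q.β
      rw [mem_EV_iff hn] at hDE
      have h1 : vl w ((Q.β : M) ^ 2) = vl w (algebraMap K M D) := by rw [Q.sq]
      rw [map_pow, hk, hv, hn, ← exp_nsmul, ← exp_nsmul, exp_inj] at h1
      have h2 : vl w ((up K M x : Mˣ) : M) = exp (e • m) := by rw [up_val, hv, hm, ← exp_nsmul]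
      rw [mem_EV_iff h2]
      simp only [nsmul_eq_mul] at h1 ⊢
      have h3 : Even ((e : ℤ) * n) := by rw [← h1]; simp
      rw [Int.even_mul] at h3 ⊢
      exact Or.inl (h3.resolve_right hDE)
    rcases hB with hodd | hu
    · exact mem_LN_unit ((Odd'.up K).2 hodd) (hev A) (hev B)
    · by_cases hl : up K M B ∈ LS w
      · rw [LN_of_LS hl]; trivial
      · rw [LN_of_UR hl (UR.up K hu)]; exact hev A

end bc

/-- representation by the pure quaternion form -/
theorem repr {A B D : Kˣ} (hB : SN B) (hne : ∃ v, A ∉ LN v B)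
    (hD : ∀ v, A ∉ LN v B → D ∉ EV v ∨ (Odd' v ∧ D ∉ LS v)) :
    ∃ α β γ : K, (D : K) = A * α ^ 2 + B * β ^ 2 - A * B * γ ^ 2 := by
  obtain ⟨v0, hv0⟩ := hne
  have hsq : D ∉ Sq K := by
    intro h
    rcases hD v0 hv0 with h' | ⟨-, h'⟩
    · exact h' (LS_le_EV _ (Sq_le_LS _ h))
    · exact h' (Sq_le_LS _ h)
  have hA : ¬ ∃ x y : K, (A : K) = x ^ 2 - B * y ^ 2 := by
    rintro ⟨x, y, h⟩
    exact hv0 (norm_mem_LN (hB.adm v0) h)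
  obtain ⟨M, _, _, _, ⟨Q⟩⟩ := exists_quad D hsq
  obtain ⟨x, y, hxy⟩ := Hasse (hB.up (M := M)) (A := up K M A) (by
    intro w
    by_cases h : A ∈ LN (dn K w) B
    · exact BC1 h
    · exact Q.BC2 (hB.adm _) h (hD _ h))
  exact Q.HL hxy hA

end UD

end

section
set_option linter.all false
open IsDedekindDomain NumberField WithZero
namespace UD
variable {K : Type*} [Field K] [NumberField K]

/-- dyadic primes -/
noncomputable def Dy (K : Type*) [Field K] [NumberField K] : Finset (HeightOneSpectrum (𝓞 K)) := finite_not_odd.toFinset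

lemma mem_Dy {v : HeightOneSpectrum (𝓞 K)} : v ∈ Dy K ↔ ¬ Odd' v := by simp [Dy]

/-- nice elements -/
noncomputable def NI (K : Type*) [Field K] [NumberField K] : Subgroup Kˣ := FI LS (Dy K) ⊓ TP K

lemma NI.ls {C : Kˣ} (h : C ∈ NI K) {v : HeightOneSpectrum (𝓞 K)} (hv : ¬ Odd' v) : C ∈ LS v :=
  mem_FI.1 h.1 v (mem_Dy.2 hv)

lemma NI.sn {C : Kˣ} (h : C ∈ NI K) : SN C :=
  ⟨h.2, fun v => by
    by_cases hv : Odd' v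
    · exact Or.inl hv
    · exact Or.inr (LS_le_UR _ (NI.ls h hv))⟩

lemma NI.odd {C A : Kˣ} (h : C ∈ NI K) {v : HeightOneSpectrum (𝓞 K)} (hv : A ∉ LN v C) : Odd' v := by
  by_contra h'
  rw [LN_of_LS (NI.ls h h')] at hv
  exact hv trivial

lemma not_LS_of {C A : Kˣ} {v : HeightOneSpectrum (𝓞 K)} (hv : A ∉ LN v C) : C ∉ LS v := by
  intro h'
  rw [LN_of_LS h'] at hv
  exact hv trivial

section sym
variable {v : HeightOneSpectrum (𝓞 K)} (hv : Odd' v)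

lemma ch_symm (hv : Odd' v) (a b : Kˣ) : ch v a b = ch v b a := by
  by_cases h : b ∈ LN v a
  · rw [ch_eq_one.2 h, ch_eq_one.2 (hv.LN_symm.1 h)]
  · rw [ch, ch, if_neg h, if_neg (fun h' => h (hv.LN_symm.1 h'))]

lemma ch_mul_left (hv : Odd' v) (a a' b : Kˣ) : ch v (a * a') b = ch v a b * ch v a' b := by
  rw [ch_symm hv, ch_mul (Or.inl hv), ch_symm hv b, ch_symm hv b]

lemma ch_sq (a b : Kˣ) : ch v a (b ^ 2) = 1 := ch_eq_one.2 (LS_le_LN _ _ (sq_mem_LS v b))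

lemma ch_norm (hv : Odd' v) {a b : Kˣ} {x y : K} (h : (b : K) = x ^ 2 - a * y ^ 2) : ch v a b = 1 :=
  ch_eq_one.2 (norm_mem_LN (Or.inl hv) h)

lemma ch_self (hv : Odd' v) (c : Kˣ) : ch v c c = ch v c (-1) := by
  have h : ch v c (-c) = 1 := ch_norm hv (x := 0) (y := 1) (by simp)
  have h2 : ch v c (-c) = ch v c (-1) * ch v c c := by rw [← ch_mul (Or.inl hv)]; simp
  rw [h] at h2
  have h3 := Int.units_mul_self (ch v c (-1))
  calc ch v c c = (ch v c (-1) * ch v c (-1)) * ch v c c := by rw [h3, one_mul]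
    _ = ch v c (-1) := by rw [mul_assoc, ← h2, mul_one]

lemma steinberg (hv : Odd' v) {a b c : Kˣ} (h : (c : K) = a + b) : ch v b a = ch v c (-(a * b)) := by
  have h1 : ch v (b * c) (a * c) = 1 := by
    refine ch_norm hv (x := c) (y := 1) ?_
    push_cast; rw [h]; ring
  rw [ch_mul (Or.inl hv), ch_mul_left hv, ch_mul_left hv, ch_self hv c, ch_symm hv b c] at h1
  have e : -(a * b) = (-1) * (a * b) := by simp
  rw [e, ch_mul (Or.inl hv), ch_mul (Or.inl hv)]
  generalize ch v b a = x at *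
  generalize ch v c a = y at *
  generalize ch v c b = z at *
  generalize ch v c (-1) = t at *
  rcases Int.units_eq_one_or x with rfl | rfl <;> rcases Int.units_eq_one_or y with rfl | rfl <;>
  rcases Int.units_eq_one_or z with rfl | rfl <;> rcases Int.units_eq_one_or t with rfl | rfl <;> simp_all
end sym

def Bad (v : HeightOneSpectrum (𝓞 K)) : Prop := ∃ B ∈ NI K, ∃ A : Kˣ, ∀ u, A ∉ LN u B ↔ u = v

lemma Bad.odd {v : HeightOneSpectrum (𝓞 K)} (h : Bad v) : Odd' v := by
  obtain ⟨B, hB, A, h⟩ := h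
  exact NI.odd hB ((h v).2 rfl)

lemma Bad.trans {v : HeightOneSpectrum (𝓞 K)} (h : Bad v) {C : Kˣ} (hC : C ∈ NI K) (hCv : C ∉ LS v) :
    ∃ A : Kˣ, ∀ u, A ∉ LN u C ↔ u = v := by
  have hodd := h.odd
  obtain ⟨B, hB, A, h⟩ := h
  suffices hs : ∃ A1 : Kˣ, ∀ u, Odd' u → ch u C A1 = ch u B A by
    obtain ⟨A1, h1⟩ := hs
    refine ⟨A1, fun u => ?_⟩
    by_cases hu : Odd' u
    · rw [← h u, ← ch_eq_one, ← ch_eq_one, h1 u hu]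
    · rw [LN_of_LS (NI.ls hC hu)]
      simp only [Subgroup.mem_top, not_true_eq_false, false_iff]
      rintro rfl; exact hu hodd
  obtain ⟨α, β, γ, hrep⟩ := repr (D := C) (NI.sn hB) ⟨v, (h v).2 rfl⟩ (fun u hu => by
    rw [h u] at hu; subst hu; exact Or.inr ⟨hodd, hCv⟩)
  have hBsq : B ∉ Sq K := fun h' => not_LS_of ((h v).2 rfl) (Sq_le_LS v h')
  by_cases hn : α ^ 2 - B * γ ^ 2 = 0
  · have hγ : γ = 0 := by
      by_contra hγ
      apply not_sq_of hBsq (α / γ)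
      field_simp; linear_combination hn
    have hα : α = 0 := by rw [hγ] at hn; simpa using hn
    have hβ : β ≠ 0 := by
      rintro rfl
      apply C.ne_zero; rw [hrep, hγ, hα]; ring
    refine ⟨A, fun u hu => ?_⟩
    have : C = B * (Units.mk0 β hβ) ^ 2 := by
      apply Units.ext; rw [hrep, hγ, hα]; simp
    rw [this, ch_mul_left hu, ch_symm hu (_ ^ 2), ch_sq, mul_one]
  · set n := Units.mk0 _ hn with hn'
    have hnv : (n : K) = α ^ 2 - B * γ ^ 2 := rfl
    have hm : ∀ u, Odd' u → ch u B (A * n) = ch u B A := by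
      intro u hu
      rw [ch_mul (Or.inl hu), ch_norm hu hnv, mul_one]
    by_cases hβ : β = 0
    · refine ⟨B, fun u hu => ?_⟩
      have : C = A * n := by apply Units.ext; push_cast; rw [hrep, hnv, hβ]; ring
      rw [← hm u hu, this, ch_symm hu]
    · refine ⟨-(A * n * (B * Units.mk0 β hβ ^ 2)), fun u hu => ?_⟩
      rw [← steinberg hu (c := C), ch_mul_left hu, ch_symm hu (_ ^ 2), ch_sq, mul_one, hm u hu]
      rw [hrep]; push_cast; rw [hnv]; simp; ring

open Classical in
lemma even_real {C : Kˣ} (hC : C ∈ NI K) (n : ℕ) : ∀ X : Finset (HeightOneSpectrum (𝓞 K)), X.card = n → (∀ v ∈ X, C ∉ LS v) →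
    Even (X.filter (fun v => ¬ Bad v)).card → ∃ A : Kˣ, ∀ u, A ∉ LN u C ↔ u ∈ X := by
  have hadm := (NI.sn hC).adm
  have mulk : ∀ (X Y : Finset (HeightOneSpectrum (𝓞 K))) (A A' : Kˣ), (∀ u, A ∉ LN u C ↔ u ∈ X) → (∀ u, A' ∉ LN u C ↔ u ∈ Y) →
      Disjoint X Y → ∃ A : Kˣ, ∀ u, A ∉ LN u C ↔ u ∈ X ∪ Y := by
    intro X Y A A' h1 h2 hd
    refine ⟨A * A', fun u => ?_⟩
    have h3 : u ∈ X → u ∉ Y := fun h => Finset.disjoint_left.1 hd h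
    rw [mul_mem_LN_iff (hadm u), Finset.mem_union, ← h1, ← h2]
    rw [← h1, ← h2] at h3
    tauto
  induction n using Nat.strong_induction_on with
  | _ n ih =>
  intro X hX hXL hev
  by_cases hb : ∃ v ∈ X, Bad v
  · obtain ⟨v, hv, hbv⟩ := hb
    obtain ⟨A, hA⟩ := ih (X.erase v).card (by rw [← hX]; exact Finset.card_erase_lt_of_mem hv) (X.erase v) rfl
      (fun u hu => hXL u (Finset.mem_of_mem_erase hu)) (by
        convert hev using 2
        ext u; simp only [Finset.mem_filter, Finset.mem_erase]
        constructor
        · rintro ⟨⟨_, h⟩, h'⟩; exact ⟨h, h'⟩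
        · rintro ⟨h, h'⟩; exact ⟨⟨fun e => h' (e ▸ hbv), h⟩, h'⟩)
    obtain ⟨A', hA'⟩ := hbv.trans hC (hXL v hv)
    obtain ⟨A'', h''⟩ := mulk (X.erase v) {v} A A' hA (fun u => by rw [hA', Finset.mem_singleton]) (by simp)
    refine ⟨A'', fun u => ?_⟩
    rw [h'', Finset.union_comm, ← Finset.insert_eq, Finset.insert_erase hv]
  · push Not at hb
    rw [Finset.filter_true_of_mem hb] at hev
    rcases X.eq_empty_or_nonempty with rfl | ⟨v, hv⟩
    · exact ⟨1, fun u => by simpa using one_mem _⟩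
    obtain ⟨v', hv', hne⟩ : ∃ v' ∈ X, v' ≠ v := by
      by_contra hcon
      push Not at hcon
      have : X = {v} := by ext u; simp; exact ⟨hcon u, fun h => h ▸ hv⟩
      rw [this] at hev; simp at hev
    have hsub : X = (X \ {v, v'}) ∪ {v, v'} := by
      rw [Finset.sdiff_union_of_subset]; intro u hu; simp at hu; rcases hu with rfl | rfl <;> assumption
    have hc2 : ({v, v'} : Finset (HeightOneSpectrum (𝓞 K))).card = 2 := Finset.card_pair hne.symm
    have hcc : (X \ {v, v'}).card + 2 = X.card := by
      conv_rhs => rw [hsub, Finset.card_union_of_disjoint Finset.sdiff_disjoint, hc2]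
    obtain ⟨A, hA⟩ := ih (X \ {v, v'}).card (by omega) (X \ {v, v'}) rfl
      (fun u hu => hXL u (Finset.mem_sdiff.1 hu).1) (by
        rw [Finset.filter_true_of_mem (fun u hu => hb u (Finset.mem_sdiff.1 hu).1)]
        rw [← hcc] at hev
        rwa [Nat.even_add, iff_true_right even_two] at hev)
    obtain ⟨A', hA'⟩ := R2 (NI.sn hC) (fun u => if u = v then -1 else 1) (fun u => if u = v' then -1 else 1) {v, v'}
      (fun u hu => by simp at hu; simp [hu.1]) (fun u hu => by simp at hu; simp [hu.2])
      (fun u hu => if_neg (by rintro rfl; exact hXL _ hv hu)) (fun u hu => if_neg (by rintro rfl; exact hXL _ hv' hu))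
    have hneg : (-1 : ℤˣ) ≠ 1 := by decide
    have hA'' : ∀ u, A' ∉ LN u C ↔ u ∈ ({v, v'} : Finset (HeightOneSpectrum (𝓞 K))) := by
      rcases hA' with h | h | h
      · exfalso
        apply hb v hv
        refine ⟨C, hC, A', fun u => ?_⟩
        rw [← ch_eq_one, h u]; split_ifs with e <;> simp [e]
      · exfalso
        apply hb v' hv'
        refine ⟨C, hC, A', fun u => ?_⟩
        rw [← ch_eq_one, h u]; split_ifs with e <;> simp [e]
      · intro u
        rw [← ch_eq_one, h u, Finset.mem_insert, Finset.mem_singleton]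
        by_cases e : u = v
        · subst e; simp [hne.symm]
        · by_cases e' : u = v'
          · simp [e, e', hne]
          · simp [e, e']
    obtain ⟨A'', h''⟩ := mulk _ _ A A' hA hA'' Finset.sdiff_disjoint
    exact ⟨A'', fun u => by rw [h'', ← hsub]⟩

open Classical in
lemma parity {C : Kˣ} (hC : C ∈ NI K) {A : Kˣ} {X : Finset (HeightOneSpectrum (𝓞 K))} (hA : ∀ u, A ∉ LN u C ↔ u ∈ X) :
    Even (X.filter (fun v => ¬ Bad v)).card := by
  by_contra hodd
  obtain ⟨v, hv⟩ : (X.filter (fun v => ¬ Bad v)).Nonempty := by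
    rw [Finset.nonempty_iff_ne_empty]; intro h; rw [h] at hodd; simp at hodd
  have hvX := (Finset.mem_filter.1 hv).1
  have hvb := (Finset.mem_filter.1 hv).2
  have he : (X.erase v).filter (fun v => ¬ Bad v) = (X.filter (fun v => ¬ Bad v)).erase v := by
    rw [Finset.filter_erase]
  obtain ⟨A', hA'⟩ := even_real hC _ (X.erase v) rfl (fun u hu => not_LS_of ((hA u).2 (Finset.mem_of_mem_erase hu))) (by
    rw [he, Finset.card_erase_of_mem hv]
    have : 0 < (X.filter (fun v => ¬ Bad v)).card := Finset.card_pos.2 ⟨v, hv⟩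
    rw [Nat.not_even_iff_odd] at hodd
    obtain ⟨k, hk⟩ := hodd
    exact ⟨k, by omega⟩)
  apply hvb
  refine ⟨C, hC, A * A', fun u => ?_⟩
  rw [mul_mem_LN_iff ((NI.sn hC).adm u)]
  have h1 := hA u
  have h2 := hA' u
  rw [Finset.mem_erase] at h2
  by_cases e : u = v
  · subst e; tauto
  · tauto

end UD

end

section
set_option linter.all false
open IsDedekindDomain NumberField WithZero
namespace UD

section pairing

lemma card_hom_le (Γ : Type*) [CommGroup Γ] [Finite Γ] : Nat.card (Γ →* ℤˣ) ≤ Nat.card Γ ∧ Nat.card (Γ →* ℤˣ) ≠ 0 := by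
  classical
  cases nonempty_fintype Γ
  haveI : Finite (Γ →* ℤˣ) := Finite.of_injective (fun f => (f : Γ → ℤˣ)) DFunLike.coe_injective
  cases nonempty_fintype (Γ →* ℤˣ)
  let j : (Γ →* ℤˣ) → (Γ →* ℚ) := fun f => ((Int.castRingHom ℚ).toMonoidHom.comp (Units.coeHom ℤ)).comp f
  have hj : Function.Injective j := by
    intro f g h
    ext x
    have := DFunLike.congr_fun h x
    simpa [j] using this
  have h1 := (linearIndependent_monoidHom Γ ℚ).comp j hj
  have h2 := h1.fintype_card_le_finrank
  rw [Module.finrank_fintype_fun_eq_card] at h2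
  rw [Nat.card_eq_fintype_card, Nat.card_eq_fintype_card]
  exact ⟨h2, Fintype.card_ne_zero⟩

lemma pair_index {A G : Type*} [CommGroup A] [CommGroup G] (p : A →* (G →* ℤˣ)) (X H : Subgroup G) (S : Subgroup A)
    (hX0 : X.index ≠ 0) (hX : ∀ a, ∀ x ∈ X, p a x = 1) (hH : ∀ a, ∀ x ∈ H, p a x = 1)
    (hS : ∀ a, (∀ g, p a g = 1) → a ∈ S) : S.index * X.relIndex H ≤ X.index := by
  set Y := H ⊔ X
  have hY : ∀ a, Y ≤ (p a).ker := fun a => sup_le (fun x hx => hH a x hx) (fun x hx => hX a x hx)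
  have h1 : X.relIndex Y * Y.index = X.index := Subgroup.relIndex_mul_index le_sup_right
  rw [Subgroup.relIndex_sup_right] at h1
  have hY0 : Y.index ≠ 0 := fun h => by rw [h, mul_zero] at h1; exact hX0 h1.symm
  haveI : Finite (G ⧸ Y) := Nat.finite_of_card_ne_zero hY0
  let q : A →* ((G ⧸ Y) →* ℤˣ) :=
    { toFun := fun a => QuotientGroup.lift Y (p a) (hY a)
      map_one' := by ext x; simp
      map_mul' := by intro a b; ext x; simp }
  have hker : q.ker ≤ S := by
    intro a ha
    apply hS
    intro g
    have := DFunLike.congr_fun (MonoidHom.mem_ker.1 ha) (QuotientGroup.mk g)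
    simpa [q] using this
  have hc := card_hom_le (G ⧸ Y)
  haveI : Finite ((G ⧸ Y) →* ℤˣ) := Nat.finite_of_card_ne_zero hc.2
  have h2 : q.ker.index ≤ Y.index := by
    rw [Subgroup.index_ker]
    exact (Nat.card_le_card_of_injective _ Subtype.val_injective).trans hc.1
  have h3 : q.ker.index ≠ 0 := by
    rw [Subgroup.index_ker]; exact Nat.card_pos.ne'
  have h4 : S.index ≤ q.ker.index := Nat.le_of_dvd (Nat.pos_of_ne_zero h3) (Subgroup.index_dvd_of_le hker)
  rw [← h1, mul_comm]
  exact Nat.mul_le_mul le_rfl (h4.trans h2)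

end pairing

variable {K : Type*} [Field K] [NumberField K]

lemma approx_LS (S : Finset (HeightOneSpectrum (𝓞 K))) (a : HeightOneSpectrum (𝓞 K) → Kˣ) :
    ∃ x : Kˣ, ∀ v ∈ S, x * (a v)⁻¹ ∈ LS v ∧ vl v (x : K) = vl v (a v : K) := by
  classical
  rcases S.eq_empty_or_nonempty with rfl | ⟨v0, hv0⟩
  · exact ⟨1, by simp⟩
  obtain ⟨n, hn, hn'⟩ := exists_prec S
  have hm : ∀ v : HeightOneSpectrum (𝓞 K), ∃ m : ℕ, exp (-(m : ℤ)) ≤ vl v (a v : K) := by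
    intro v
    obtain ⟨k, hk⟩ := vl_unit_eq v (a v)
    exact ⟨k.natAbs, by rw [hk, exp_le_exp]; omega⟩
  choose m hm using hm
  obtain ⟨x, hx⟩ := weak_approx S (fun v => (a v : K)) (n + S.sup m)
  have key : ∀ v ∈ S, vl v (x * (a v : K)⁻¹ - 1) ≤ exp (-(n : ℤ)) := by
    intro v hv
    have ha : (a v : K) ≠ 0 := (a v).ne_zero
    have e : x - a v = (x * (a v : K)⁻¹ - 1) * a v := by field_simp
    have h1 := hx v hv
    rw [e, map_mul] at h1
    have h2 : (exp (-((n + S.sup m : ℕ) : ℤ)) : ℤᵐ⁰) ≤ exp (-(n : ℤ)) * vl v (a v : K) := by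
      refine le_trans ?_ (mul_le_mul_right (hm v) _)
      rw [← exp_add, exp_le_exp]
      have := Finset.le_sup (f := m) hv
      push_cast; omega
    exact le_of_mul_le_mul_right (h1.trans h2) ((Valuation.pos_iff _).2 ha)
  have hlt : ∀ v ∈ S, vl v (x * (a v : K)⁻¹) = 1 := fun v hv =>
    vl_eq_one_of_sub_lt ((key v hv).trans_lt (exp_neg_lt_one hn))
  have hx0 : x ≠ 0 := by
    rintro rfl
    have := hlt v0 hv0
    simp at this
  refine ⟨Units.mk0 x hx0, fun v hv => ⟨?_, ?_⟩⟩
  · apply mem_LS_of (z := 1)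
    simpa using hn' v hv _ (key v hv)
  · have := hlt v hv
    have ha : vl v (a v : K) ≠ 0 := (Valuation.ne_zero_iff _).2 (a v).ne_zero
    rw [map_mul, map_inv₀] at this
    rw [Units.val_mk0]
    exact eq_of_div_eq_one (by rw [div_eq_mul_inv, this])

lemma exists_not_LN {v : HeightOneSpectrum (𝓞 K)} (hv : Odd' v) {a : Kˣ} (ha : a ∉ LS v) : ∃ g, g ∉ LN v a := by
  by_cases he : a ∈ EV v
  · obtain ⟨p, hp⟩ := exists_unif v
    refine ⟨p, ?_⟩
    rw [LN_of_UR ha (hv.UR_eq ▸ he), mem_EV_iff hp]; decide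
  · obtain ⟨g0, hg⟩ := exists_g hv
    obtain ⟨h1, h2⟩ := hg (algebraMap (𝓞 K) K g0) (by rw [sub_self, map_zero]; exact zero_lt_one)
    have hne : 1 + (algebraMap (𝓞 K) K g0) ^ 2 ≠ 0 := by
      intro h; rw [h, map_zero] at h1; exact zero_ne_one h1
    refine ⟨Units.mk0 _ hne, ?_⟩
    have hE : Units.mk0 _ hne ∈ EV v := EV_of_one h1
    rw [mem_LN_RAM (fun h => he (hv.UR_eq ▸ h))]
    rintro (h | h)
    · exact h2 _ rfl h
    · have := LS_le_EV _ h
      rw [neg_mem_EV, Subgroup.mul_mem_cancel_left _ hE] at this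
      exact he this

open Classical in
lemma good_exists {C : Kˣ} (hC : C ∈ NI K) (hsq : C ∉ Sq K) : ∃ v, ¬ Bad v ∧ C ∉ LS v := by
  by_contra hcon
  push Not at hcon
  have hbad : ∀ v, C ∉ LS v → Bad v := fun v hv => by by_contra h; exact hv (hcon v h)
  obtain ⟨T, -, hT, -, hCT⟩ := exists_T ∅ C C
  set T1 := T.filter (fun v => C ∉ LS v) with hT1
  have hA : ∀ v, ∃ A : Kˣ, v ∈ T1 → ∀ u, A ∉ LN u C ↔ u = v := by
    intro v
    by_cases h : v ∈ T1
    · obtain ⟨A, hA⟩ := (hbad v (Finset.mem_filter.1 h).2).trans hC (Finset.mem_filter.1 h).2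
      exact ⟨A, fun _ => hA⟩
    · exact ⟨1, fun h' => absurd h' h⟩
  choose A hA using hA
  set T2 := T ∪ T1.biUnion (fun v => (finite_vl_ne_one (A v)).toFinset.filter (fun u => A v ∉ EV u)) with hT2
  have hTT : T ⊆ T2 := Finset.subset_union_left
  have hfil : T2.filter (fun v => C ∉ LS v) = T1 := by
    ext u
    simp only [hT1, Finset.mem_filter]
    constructor
    · rintro ⟨h, h'⟩
      refine ⟨?_, h'⟩
      by_contra hu
      rw [hT2, Finset.mem_union, Finset.mem_biUnion] at h
      obtain ⟨v, hv, hv'⟩ := h.resolve_left hu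
      have hvE := (Finset.mem_filter.1 hv').2
      have hodd : Odd' u := by by_contra h; exact hu (hT.1 u h)
      have hne : u ≠ v := by rintro rfl; exact hu (Finset.mem_filter.1 hv).1
      have hin : A v ∈ LN u C := by
        by_contra h; exact hne ((hA v hv u).1 h)
      rw [LN_of_UR h' (hodd.UR_eq ▸ EV_of_one (hCT u hu))] at hin
      exact hvE hin
    · rintro ⟨h, h'⟩; exact ⟨hTT h, h'⟩
  have hL2 := hT.mono hTT
  have hκ : ∀ v, ∃ κ : Kˣ, v ∈ T1 → κ ∈ KT T2 ∧ ∀ u, κ ∉ LN u C ↔ u = v := by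
    intro v
    by_cases h : v ∈ T1
    · obtain ⟨κ, hκ, c, hc⟩ := hL2.exists_KT (x := A v) (fun u hu => by
        by_contra hE
        apply hu
        rw [hT2, Finset.mem_union, Finset.mem_biUnion]
        refine Or.inr ⟨v, h, Finset.mem_filter.2 ⟨?_, hE⟩⟩
        simp only [Set.Finite.mem_toFinset, Set.mem_setOf_eq]
        intro h1; exact hE (EV_of_one h1))
      refine ⟨κ, fun _ => ⟨hκ, fun u => ?_⟩⟩
      rw [← hA v h u, hc, Subgroup.mul_mem_cancel_right _ (LS_le_LN _ _ (sq_mem_LS u c))]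
    · exact ⟨1, fun h' => absurd h' h⟩
  choose κ hκ using hκ
  obtain ⟨N, hN1, hN0, hN⟩ := F1' hL2 (KT_mono hTT hCT) hC.2 hsq
  rw [hfil] at hN1
  have hle : N ≤ FI (fun v => LN v C) T1 := fun n hn => mem_FI.2 fun v _ => by
    obtain ⟨x, y, h⟩ := hN n hn
    exact norm_mem_LN ((NI.sn hC).adm v) h
  have e1 := Subgroup.relIndex_le_of_le_left (L := KT T2) hle hN0
  have e2 := dual_index (fun v => LN v C) T1 (KT T2) κ (fun v hv => (hκ v hv).1) (fun v hv => ((hκ v hv).2 v).2 rfl)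
    (fun v hv u hu huv => by by_contra h; exact huv (((hκ v hv).2 u).1 h))
    (fun h => hN0 (Subgroup.relIndex_eq_zero_of_le_left hle h))
  have : 0 < 2 ^ T1.card := by positivity
  omega

lemma ch_prod {C A : Kˣ} {Tg : Finset (HeightOneSpectrum (𝓞 K))} (h : ∀ s : Finset (HeightOneSpectrum (𝓞 K)),
    (∀ u, u ∈ s ↔ u ∈ Tg ∧ A ∉ LN u C) → Even s.card) : ∏ v ∈ Tg, ch v C A = 1 := by
  classical
  have := h (Tg.filter (fun u => A ∉ LN u C)) (fun u => Finset.mem_filter)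
  have e : ∏ v ∈ Tg, ch v C A = ∏ v ∈ Tg, (if A ∉ LN v C then (-1 : ℤˣ) else 1) := by
    apply Finset.prod_congr rfl
    intro v _
    by_cases hv : A ∈ LN v C <;> simp [ch, hv]
  rw [e, Finset.prod_ite, Finset.prod_const, Finset.prod_const_one, mul_one, this.neg_one_pow]

section count
open Classical

/-- good primes of `T` -/
noncomputable def Tg (T : Finset (HeightOneSpectrum (𝓞 K))) : Finset (HeightOneSpectrum (𝓞 K)) :=
  T.filter (fun v => Odd' v ∧ ¬ Bad v)

lemma mem_Tg {T : Finset (HeightOneSpectrum (𝓞 K))} {v : HeightOneSpectrum (𝓞 K)} : v ∈ Tg T ↔ v ∈ T ∧ Odd' v ∧ ¬ Bad v := by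
  simp [Tg]

lemma ram_fin (C A : Kˣ) : {u : HeightOneSpectrum (𝓞 K) | A ∉ LN u C}.Finite := by
  refine ((finite_vl_ne_one C).union ((finite_vl_ne_one A).union finite_not_odd)).subset ?_
  intro u hu
  by_contra h
  simp only [Set.mem_union, Set.mem_setOf_eq, not_or, not_not] at h
  exact hu (mem_LN_unit h.2.2 (EV_of_one h.2.1) (EV_of_one h.1))

lemma ortho {T : Finset (HeightOneSpectrum (𝓞 K))} (hT : Large T) {C A : Kˣ} (hC : C ∈ NI K) (hCT : C ∈ KT T) (hA : A ∈ KT T) :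
    ∏ v ∈ Tg T, ch v C A = 1 := by
  apply ch_prod
  intro s hs
  have := parity hC (A := A) (X := (ram_fin C A).toFinset) (by simp)
  convert this using 2
  ext u
  rw [hs, Finset.mem_filter, mem_Tg]
  simp only [Set.Finite.mem_toFinset, Set.mem_setOf_eq]
  constructor
  · rintro ⟨⟨_, _, h1⟩, h2⟩; exact ⟨h2, h1⟩
  · rintro ⟨h1, h2⟩
    refine ⟨⟨?_, NI.odd hC h1, h2⟩, h1⟩
    by_contra hu
    exact h1 (mem_LN_unit (NI.odd hC h1) (EV_of_one (hA u hu)) (EV_of_one (hCT u hu)))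

lemma inj_g {T : Finset (HeightOneSpectrum (𝓞 K))} (hT : Large T) {C : Kˣ} (hC : C ∈ NI K) (hCT : C ∈ KT T)
    (h : C ∈ FI LS (Tg T)) : C ∈ Sq K := by
  by_contra hsq
  obtain ⟨v, hv, hvL⟩ := good_exists hC hsq
  have hodd : Odd' v := by by_contra h'; exact hvL (NI.ls hC h')
  have hvT : v ∉ T := fun h' => hvL (mem_FI.1 h v (mem_Tg.2 ⟨h', hodd, hv⟩))
  obtain ⟨w, hw, hw'⟩ := hT.2 v hvT
  have := parity hC (A := w) (X := (ram_fin C w).toFinset) (by simp)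
  have he : (ram_fin C w).toFinset.filter (fun v => ¬ Bad v) = {v} := by
    ext u
    simp only [Finset.mem_filter, Set.Finite.mem_toFinset, Set.mem_setOf_eq, Finset.mem_singleton]
    constructor
    · rintro ⟨h1, h2⟩
      by_contra hne
      have ho := NI.odd hC h1
      by_cases huT : u ∈ T
      · exact not_LS_of h1 (mem_FI.1 h u (mem_Tg.2 ⟨huT, ho, h2⟩))
      · exact h1 (mem_LN_unit ho (EV_of_one (hw' u huT hne)) (EV_of_one (hCT u huT)))
    · rintro rfl
      refine ⟨?_, hv⟩
      rw [LN_of_UR hvL (hodd.UR_eq ▸ EV_of_one (hCT u hvT)), mem_EV_iff hw]; decide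
  rw [he] at this
  simp at this

/-- the nice group has bounded index -/
lemma NI_index (L : Subgroup Kˣ) : (NI K).relIndex L ≠ 0 ∧
    (NI K).relIndex L ≤ 2 ^ (2 * (Fintype.card (InfinitePlace K) + (Dy K).card)) := by
  have h := upper (Dy K) (1 : Kˣ) L (by
    intro x _
    exact mem_FI.2 fun v _ => by rw [LN_of_LS (one_mem _)]; trivial)
  exact ⟨h.1, le_trans (Nat.le_mul_of_pos_left _ (by positivity)) h.2⟩

lemma Zle {T : Finset (HeightOneSpectrum (𝓞 K))} (hT : Large T) :
    (Sq K).relIndex (FI LS (Tg T) ⊓ KT T) ≤ 2 ^ (2 * (Fintype.card (InfinitePlace K) + (Dy K).card)) := by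
  have h := NI_index (FI LS (Tg T) ⊓ KT T)
  refine le_trans ?_ h.2
  rw [← Subgroup.inf_relIndex_right (NI K)] at h ⊢
  apply Subgroup.relIndex_le_of_le_left _ h.1
  rintro x ⟨h1, h2, h3⟩
  exact inj_g hT h1 h3 h2

lemma count {T : Finset (HeightOneSpectrum (𝓞 K))} (hT : Large T) :
    4 ^ (T.filter (fun v => Bad v)).card ≤ (Sq K).relIndex (FI LS (Tg T) ⊓ KT T) := by
  set X := FI LS (Tg T) with hX
  set s2 := Fintype.card (InfinitePlace K) + (Dy K).card with hs2
  set b := (T.filter (fun v => Bad v)).card with hb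
  have hcard : T.card = (Dy K).card + (Tg T).card + b := by
    have hD : Dy K = T.filter (fun v => ¬ Odd' v) := by
      ext v; rw [mem_Dy, Finset.mem_filter]; exact ⟨fun h => ⟨hT.1 v h, h⟩, fun h => h.2⟩
    have h1 : (T.filter (fun v => Odd' v)).card + (T.filter (fun v => ¬ Odd' v)).card = T.card :=
      Finset.card_filter_add_card_filter_not _
    have h2 : ((T.filter (fun v => Odd' v)).filter (fun v => Bad v)).card + ((T.filter (fun v => Odd' v)).filter (fun v => ¬ Bad v)).card =
      (T.filter (fun v => Odd' v)).card := Finset.card_filter_add_card_filter_not _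
    rw [Finset.filter_filter, Finset.filter_filter] at h2
    have h3 : T.filter (fun v => Odd' v ∧ Bad v) = T.filter (fun v => Bad v) := by
      apply Finset.filter_congr; intro v _; exact ⟨fun h => h.2, fun h => ⟨h.odd, h⟩⟩
    rw [h3] at h2
    rw [hD, Tg]; omega
  have hXi : X.index ≠ 0 ∧ X.index ≤ 4 ^ (Tg T).card := by
    have := FI_relIndex_le LS (Tg T) ⊤ (fun _ => 4) (fun v hv => by
      have h := relIndex_LS_top v
      rw [(mem_Tg.1 hv).2.1.e2_eq, pow_zero, mul_one] at h
      exact h)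
    rw [Subgroup.relIndex_top_right] at this
    simpa using this
  set 𝒞 := NI K ⊓ KT T with h𝒞
  have hpr : ∀ C ∈ 𝒞, ∀ v ∈ Tg T, Odd' v := fun _ _ v hv => (mem_Tg.1 hv).2.1
  let p : 𝒞 →* (Kˣ →* ℤˣ) :=
    { toFun := fun C =>
        { toFun := fun A => ∏ v ∈ Tg T, ch v (C : Kˣ) A
          map_one' := Finset.prod_eq_one fun v _ => ch_eq_one.2 (one_mem _)
          map_mul' := fun A A' => by
            rw [← Finset.prod_mul_distrib]
            exact Finset.prod_congr rfl fun v hv => ch_mul (Or.inl (mem_Tg.1 hv).2.1) _ _ }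
      map_one' := by
        ext A
        simp only [MonoidHom.coe_mk, OneHom.coe_mk, MonoidHom.one_apply]
        congr 1
        refine Finset.prod_eq_one fun v _ => ch_eq_one.2 ?_
        rw [LN_of_LS (by exact one_mem _)]; trivial
      map_mul' := fun C C' => by
        ext A
        simp only [MonoidHom.coe_mk, OneHom.coe_mk, MonoidHom.mul_apply]
        rw [← Finset.prod_mul_distrib]
        congr 1
        exact Finset.prod_congr rfl fun v hv => ch_mul_left (mem_Tg.1 hv).2.1 _ _ _ }
  have hp : ∀ C A, p C A = ∏ v ∈ Tg T, ch v (C : Kˣ) A := fun _ _ => rfl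
  have hpair := pair_index p X (KT T) ((Sq K).subgroupOf 𝒞) hXi.1
    (fun C x hx => Finset.prod_eq_one fun v hv => ch_eq_one.2 (LS_le_LN _ _ (mem_FI.1 hx v hv)))
    (fun C x hx => ortho hT C.2.1 C.2.2 hx)
    (fun C hC => by
      rw [Subgroup.mem_subgroupOf]
      apply inj_g hT C.2.1 C.2.2
      rw [mem_FI]
      intro v hv
      by_contra hCv
      obtain ⟨g0, hg0⟩ := exists_not_LN (mem_Tg.1 hv).2.1 hCv
      obtain ⟨g, hg⟩ := approx_LS (Tg T) (fun u => if u = v then g0 else 1)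
      have h1 := hC g
      rw [hp, Finset.prod_eq_single_of_mem v hv, ch_eq_one] at h1
      · have h2 := (hg v hv).1
        rw [if_pos rfl] at h2
        have h3 := LS_le_LN v (C : Kˣ) h2
        rw [Subgroup.mul_mem_cancel_left _ h1, inv_mem_iff] at h3
        exact hg0 h3
      · intro u hu huv
        have h2 := (hg u hu).1
        rw [if_neg huv, inv_one, mul_one] at h2
        exact ch_eq_one.2 (LS_le_LN _ _ h2))
  change (Sq K).relIndex 𝒞 * X.relIndex (KT T) ≤ X.index at hpair
  have i1 := relIndex_split (H := Sq K) (K := NI K) (KT T) (fun x hx =>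
    ⟨mem_FI.2 fun v _ => Sq_le_LS v hx.1, Sq_le_TP hx.1⟩)
  have i2 := relIndex_split (H := Sq K) (K := X) (KT T) (fun x hx => mem_FI.2 fun v _ => Sq_le_LS v hx.1)
  rw [relIndex_Sq] at i1 i2
  have i3 := (NI_index (KT T)).2
  rw [← h𝒞] at i1
  rw [← hs2] at i3
  set c := (Sq K).relIndex 𝒞
  set z := (Sq K).relIndex (X ⊓ KT T)
  set y := X.relIndex (KT T)
  set S := 2 ^ (Fintype.card (InfinitePlace K) + T.card) with hS
  have j1 : S ≤ c * 2 ^ (2 * s2) := by rw [← i1]; exact Nat.mul_le_mul le_rfl i3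
  have j2 : c * S ≤ 4 ^ (Tg T).card * z := by
    rw [← i2]
    calc c * (z * y) = (c * y) * z := by ring
      _ ≤ _ := Nat.mul_le_mul (hpair.trans hXi.2) le_rfl
  have j3 : S * S ≤ (4 ^ (Tg T).card * 2 ^ (2 * s2)) * z :=
    calc S * S ≤ (c * 2 ^ (2 * s2)) * S := Nat.mul_le_mul j1 le_rfl
      _ = (c * S) * 2 ^ (2 * s2) := by ring
      _ ≤ (4 ^ (Tg T).card * z) * 2 ^ (2 * s2) := Nat.mul_le_mul j2 le_rfl
      _ = _ := by ring
  have j4 : S * S = (4 ^ (Tg T).card * 2 ^ (2 * s2)) * 4 ^ b := by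
    rw [hS, hcard, hs2, show (4 : ℕ) = 2 ^ 2 by norm_num, ← pow_mul, ← pow_mul, ← pow_add, ← pow_add, ← pow_add]
    congr 1; ring
  rw [j4] at j3
  exact Nat.le_of_mul_le_mul_left j3 (by positivity)

/-- there are no bad primes -/
theorem not_bad (v0 : HeightOneSpectrum (𝓞 K)) : ¬ Bad v0 := by
  intro hv0
  set s2 := Fintype.card (InfinitePlace K) + (Dy K).card with hs2
  have hbound : ∀ S : Finset (HeightOneSpectrum (𝓞 K)), (∀ v ∈ S, Bad v) → S.card ≤ s2 := by
    intro S hS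
    obtain ⟨T, hST, hT⟩ := exists_Large S
    have h := (count hT).trans (Zle hT)
    rw [← hs2, show (4 : ℕ) = 2 ^ 2 by norm_num, ← pow_mul, Nat.pow_le_pow_iff_right (by norm_num)] at h
    have h2 := Finset.card_le_card (s := S) (t := T.filter (fun v => Bad v)) (fun v hv => Finset.mem_filter.2 ⟨hST hv, hS v hv⟩)
    omega
  have hfin : {v : HeightOneSpectrum (𝓞 K) | Bad v}.Finite := by
    by_contra hinf
    obtain ⟨S, hS, hc⟩ := Set.Infinite.exists_subset_card_eq hinf (s2 + 1)
    have := hbound S (fun v hv => hS hv)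
    omega
  obtain ⟨T0, hbT, hT0⟩ := exists_Large hfin.toFinset
  have hfi : ((Sq K).subgroupOf (KT T0)).index ≠ 0 := by
    have := relIndex_Sq T0
    rw [Subgroup.relIndex] at this
    rw [this]; positivity
  haveI : Finite (KT T0 ⧸ (Sq K).subgroupOf (KT T0)) := Nat.finite_of_card_ne_zero hfi
  cases nonempty_fintype (KT T0 ⧸ (Sq K).subgroupOf (KT T0))
  have hq : ∀ c : KT T0 ⧸ (Sq K).subgroupOf (KT T0), ∃ q, q ∉ T0 ∧ Odd' q ∧ ((c.out : Kˣ) ∉ Sq K → (c.out : Kˣ) ∉ LS q) := by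
    intro c
    by_cases h : (c.out : Kˣ) ∈ Sq K
    · obtain ⟨q, hq⟩ := exists_notMem T0
      exact ⟨q, hq, by by_contra h; exact hq (hT0.1 q h), fun h' => absurd h h'⟩
    · obtain ⟨q, h1, h2, h3⟩ := Qthm h T0
      exact ⟨q, h1, h2, fun _ => h3⟩
  choose q hq1 hq2 hq3 using hq
  set P := Finset.univ.image q
  have hTT : T0 ⊆ T0 ∪ P := Finset.subset_union_left
  have hT := hT0.mono hTT
  have hc := count hT
  have h1 : (Sq K).relIndex (FI LS (Tg (T0 ∪ P)) ⊓ KT (T0 ∪ P)) = 1 := by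
    rw [Subgroup.relIndex_eq_one]
    rintro κ ⟨hκ1, hκ2⟩
    have hLSq : ∀ c, κ ∈ LS (q c) := fun c => mem_FI.1 hκ1 (q c) (mem_Tg.2
      ⟨Finset.mem_union_right _ (Finset.mem_image_of_mem q (Finset.mem_univ c)), hq2 c, fun hb => hq1 c (hbT (by simpa using hb))⟩)
    obtain ⟨κ', hκ', c, hc⟩ := hT0.exists_KT (x := κ) (fun v hv => by
      by_cases hvP : v ∈ P
      · obtain ⟨c, -, rfl⟩ := Finset.mem_image.1 hvP
        exact LS_le_EV _ (hLSq c)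
      · exact EV_of_one (hκ2 v (by simp [hv, hvP])))
    have hsq : c ^ 2 ∈ Sq K := ⟨c, rfl⟩
    rw [hc, Subgroup.mul_mem_cancel_right _ hsq]
    by_contra hn
    set cl : KT T0 ⧸ (Sq K).subgroupOf (KT T0) := QuotientGroup.mk ⟨κ', hκ'⟩ with hcl
    have hout : (cl.out : KT T0)⁻¹ * ⟨κ', hκ'⟩ ∈ (Sq K).subgroupOf (KT T0) := by
      rw [← QuotientGroup.eq, QuotientGroup.out_eq']
    rw [Subgroup.mem_subgroupOf] at hout
    change ((cl.out : KT T0) : Kˣ)⁻¹ * κ' ∈ Sq K at hout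
    have hno : (cl.out : Kˣ) ∉ Sq K := by
      intro h
      exact hn ((Subgroup.mul_mem_cancel_left _ (inv_mem h)).1 hout)
    have h2 := hq3 cl hno
    have h3 := Sq_le_LS (q cl) hout
    have h4 : κ' ∈ LS (q cl) := by
      have := hLSq cl
      rwa [hc, Subgroup.mul_mem_cancel_right _ (sq_mem_LS _ c)] at this
    rw [Subgroup.mul_mem_cancel_right _ h4, inv_mem_iff] at h3
    exact h2 h3
  rw [h1] at hc
  have hpos : 0 < ((T0 ∪ P).filter (fun v => Bad v)).card :=
    Finset.card_pos.2 ⟨v0, Finset.mem_filter.2 ⟨hTT (hbT (by simpa using hv0)), hv0⟩⟩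
  have := Nat.one_lt_pow hpos.ne' (show 1 < 4 by norm_num)
  omega

end count

end UD

end

section
set_option linter.all false
open IsDedekindDomain NumberField WithZero
namespace UD
variable {K : Type*} [Field K] [NumberField K]

lemma pair_real {C : Kˣ} (hC : C ∈ NI K) {p q : HeightOneSpectrum (𝓞 K)} (hpq : p ≠ q) (hp : C ∉ LS p) (hq : C ∉ LS q) :
    ∃ A : Kˣ, ∀ u, A ∉ LN u C ↔ u = p ∨ u = q := by
  classical
  have := even_real hC 2 {p, q} (Finset.card_pair hpq) (by
    intro v hv
    rcases Finset.mem_insert.1 hv with rfl | hv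
    · exact hp
    · rw [Finset.mem_singleton.1 hv]; exact hq) (by
    rw [Finset.filter_true_of_mem (fun v _ => not_bad v)]
    have h2 : ({p, q} : Finset (HeightOneSpectrum (𝓞 K))).card = 2 := Finset.card_pair hpq
    exact ⟨1, h2⟩)
  obtain ⟨A, hA⟩ := this
  exact ⟨A, fun u => by rw [hA]; simp⟩

lemma other_ram {C A : Kˣ} (hC : C ∈ NI K) {s : HeightOneSpectrum (𝓞 K)} (h : A ∉ LN s C) :
    ∃ p, p ≠ s ∧ A ∉ LN p C := by
  by_contra hcon
  push Not at hcon
  exact not_bad s ⟨C, hC, A, fun u => ⟨fun hu => by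
    by_contra hne; exact hu (hcon u hne), fun hu => hu ▸ h⟩⟩

lemma ff_two {F : Type*} [Field F] [Finite F] (h2 : (2 : F) = 0) : ∃ h : F, ∀ x : F, x ^ 2 + x ≠ h ^ 2 := by
  have hni : ¬ Function.Injective (fun x : F => x ^ 2 + x) := by
    intro h
    have : (0 : F) = 1 := h (by simp; linear_combination -h2)
    exact zero_ne_one this
  have hns : ¬ Function.Surjective (fun x : F => x ^ 2 + x) := fun h => hni (Finite.injective_iff_surjective.2 h)
  have hsq : Function.Surjective (fun x : F => x ^ 2) := by
    apply Finite.injective_iff_surjective.1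
    intro a b hab
    have : (a - b) ^ 2 = 0 := by
      simp only at hab
      linear_combination hab + (b ^ 2 - a * b) * h2
    exact sub_eq_zero.1 (pow_eq_zero_iff two_ne_zero |>.1 this)
  by_contra hcon
  push Not at hcon
  apply hns
  intro b
  obtain ⟨h, rfl⟩ := hsq b
  exact hcon h

lemma exists_gd (v : HeightOneSpectrum (𝓞 K)) : ∃ g0 : K, ∀ g : K, vl v (g - g0) < vl v 4 →
    vl v (1 + g ^ 2) = 1 ∧ ∀ B : Kˣ, (B : K) = 1 + g ^ 2 → B ∈ UR v ∧ B ∉ LS v := by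
  by_cases hv : Odd' v
  · obtain ⟨g0, hg0⟩ := exists_g hv
    refine ⟨algebraMap (𝓞 K) K g0, fun g hg => ?_⟩
    rw [hv.four] at hg
    obtain ⟨h1, h2⟩ := hg0 g hg
    refine ⟨h1, fun B hB => ?_⟩
    refine ⟨?_, h2 B hB⟩
    rw [hv.UR_eq]; exact EV_of_one (by rw [hB, h1])
  have h2' : vl v (2 : K) < 1 := lt_of_le_of_ne (vl2_le v) hv
  have h20 : 0 < vl v (2 : K) := by
    rw [zero_lt_iff, Ne, map_eq_zero]; exact two_ne_zero
  have h2 : (2 : Fv v) = 0 := by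
    rw [← rs_two, rs_zero_iff (vl2_le v)]; exact h2'
  have h4 : vl v (4 : K) = vl v 2 ^ 2 := by rw [← map_pow]; norm_num
  have h40 : 0 < vl v (4 : K) := by rw [h4]; exact pow_pos h20 2
  obtain ⟨c, hc⟩ := ff_two h2
  obtain ⟨h, rfl⟩ := rs_surj v c
  set h' : K := algebraMap (𝓞 K) K h
  have hh : vl v h' ≤ 1 := v.valuation_le_one h
  refine ⟨2 * h', fun g hg => ?_⟩
  -- key
  have key : vl v ((1 + g ^ 2) - (1 + 4 * h' ^ 2)) < vl v 4 := by
    have e : (1 + g ^ 2) - (1 + 4 * h' ^ 2) = (g - 2 * h') * ((g - 2 * h') + 4 * h') := by ring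
    rw [e, map_mul]
    refine lt_of_le_of_lt (mul_le_of_le_one_right' ?_) hg
    refine (Valuation.map_add _ _ _).trans (max_le (hg.le.trans (vl4_le v)) ?_)
    rw [map_mul]; exact mul_le_one' (vl4_le v) hh
  have k4 : vl v ((1 + g ^ 2) - 1) ≤ vl v 4 := by
    have e : (1 + g ^ 2) - 1 = ((1 + g ^ 2) - (1 + 4 * h' ^ 2)) + 4 * h' ^ 2 := by ring
    rw [e]
    refine (Valuation.map_add _ _ _).trans (max_le key.le ?_)
    rw [map_mul, map_pow]; exact mul_le_of_le_one_right' (pow_le_one' hh 2)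
  have k41 : vl v (4 : K) < 1 := by
    rw [h4]; exact pow_lt_one₀ zero_le' h2' two_ne_zero
  have hB1 : vl v (1 + g ^ 2) = 1 := vl_eq_one_of_sub_lt (k4.trans_lt k41)
  refine ⟨hB1, fun B hB => ?_⟩
  rw [← hB] at key k4 hB1
  refine ⟨⟨1, by simpa using hB1, by simpa using k4⟩, ?_⟩
  rintro ⟨z, hz⟩
  set w : K := (z : K)⁻¹
  have hz0 : (z : K) ≠ 0 := z.ne_zero
  have hwz : vl v ((B : K) * z ^ 2) = 1 := vl_eq_one_of_sub_lt (hz.trans_le (vl4_le v))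
  rw [map_mul, hB1, one_mul, map_pow] at hwz
  have hz1 : vl v (z : K) = 1 := by
    simpa using hwz
  have hw1 : vl v w = 1 := by simp [w, hz1]
  have e1 : vl v ((B : K) - w ^ 2) < vl v 4 := by
    have e : (B : K) - w ^ 2 = w ^ 2 * ((B : K) * z ^ 2 - 1) := by simp only [w]; field_simp
    rw [e, map_mul, map_pow, hw1, one_pow, one_mul]; exact hz
  have e2 : vl v (w ^ 2 - (1 + 4 * h' ^ 2)) < vl v 4 := by
    have e : w ^ 2 - (1 + 4 * h' ^ 2) = ((B : K) - (1 + 4 * h' ^ 2)) - ((B : K) - w ^ 2) := by ring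
    rw [e]; exact (Valuation.map_sub _ _ _).trans_lt (max_lt key e1)
  have e3 : vl v (w ^ 2 - 1) ≤ vl v 4 := by
    have e : w ^ 2 - 1 = (w ^ 2 - (1 + 4 * h' ^ 2)) + 4 * h' ^ 2 := by ring
    rw [e]
    refine (Valuation.map_add _ _ _).trans (max_le e2.le ?_)
    rw [map_mul, map_pow]; exact mul_le_of_le_one_right' (pow_le_one' hh 2)
  have e4 : vl v (w - 1) ≤ vl v 2 := by
    by_contra hcon
    push Not at hcon
    have e : w ^ 2 - 1 = (w - 1) * ((w - 1) + 2) := by ring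
    rw [e, map_mul, Valuation.map_add_eq_of_lt_left _ hcon, h4, ← sq] at e3
    exact absurd e3 (not_le.2 (pow_lt_pow_left₀ hcon zero_le' two_ne_zero))
  set x : K := (w - 1) / 2
  have hx : vl v x ≤ 1 := by
    simp only [x]; rw [map_div₀]; exact div_le_one_of_le₀ e4 zero_le'
  have hwx : w = 1 + 2 * x := by simp only [x]; field_simp; ring
  have e5 : vl v (x ^ 2 + x - h' ^ 2) < 1 := by
    have e : w ^ 2 - (1 + 4 * h' ^ 2) = 4 * (x ^ 2 + x - h' ^ 2) := by rw [hwx]; ring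
    rw [e, map_mul] at e2
    exact (mul_lt_iff_lt_one_right h40).1 e2
  have hx2 : vl v (x ^ 2) ≤ 1 := by rw [map_pow]; exact pow_le_one' hx 2
  have hh2 : vl v (h' ^ 2) ≤ 1 := by rw [map_pow]; exact pow_le_one' hh 2
  have hxx : vl v (x ^ 2 + x) ≤ 1 := (Valuation.map_add _ _ _).trans (max_le hx2 hx)
  have e6 := (rs_eq_iff hxx hh2).2 e5
  rw [rs_add hx2 hx, sq, sq, rs_mul hx hx, rs_mul hh hh, ← sq, ← sq] at e6
  exact hc _ e6

lemma exists_Bd (p : HeightOneSpectrum (𝓞 K)) : ∃ B : Kˣ, SN B ∧ B ∈ UR p ∧ B ∉ LS p ∧ ∀ u, u ≠ p → ¬ Odd' u → B ∈ LS u := by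
  classical
  obtain ⟨g0, hg0⟩ := exists_gd p
  obtain ⟨n, hn, hprec⟩ := exists_prec (insert p (Dy K))
  obtain ⟨g, hg⟩ := weak_approx (insert p (Dy K)) (fun v => if v = p then g0 else 0) n
  have hp := hprec p (Finset.mem_insert_self _ _) _ (hg p (Finset.mem_insert_self _ _))
  rw [if_pos rfl] at hp
  have hB : 1 + g ^ 2 ≠ 0 := by
    intro h0
    have := (hg0 g hp).1
    rw [h0, map_zero] at this; exact zero_ne_one this
  have hls : ∀ u, u ≠ p → ¬ Odd' u → Units.mk0 _ hB ∈ LS u := by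
    intro u hup hu
    have hm : u ∈ insert p (Dy K) := Finset.mem_insert_of_mem (mem_Dy.2 hu)
    have h1 := hg u hm
    rw [if_neg hup, sub_zero] at h1
    exact one_add_LS (hprec u hm _ h1) rfl
  obtain ⟨h1, h2⟩ := (hg0 g hp).2 (Units.mk0 _ hB) rfl
  refine ⟨Units.mk0 _ hB, ⟨one_add_TP (g := g) rfl, fun v => ?_⟩, h1, h2, hls⟩
  by_cases hvp : v = p
  · subst hvp; exact Or.inr h1
  by_cases hv : Odd' v
  · exact Or.inl hv
  · exact Or.inr (LS_le_UR _ (hls v hvp hv))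
end UD

end

section
set_option linter.all false
open IsDedekindDomain NumberField WithZero
namespace UD
variable {K : Type*} [Field K] [NumberField K]

/-- quaternionic predicate used for fixed primes -/
def EQ (A B ϖ : K) (N : ℕ) (z : K) : Prop :=
  ∃ α β γ : K, ϖ * (1 + 4 * ϖ * z ^ (2 * N)) = A * α ^ 2 + B * β ^ 2 - A * B * γ ^ 2

lemma exp_one_le {v : HeightOneSpectrum (𝓞 K)} {z : K} (h : 1 < vl v z) : exp (1 : ℤ) ≤ vl v z := by
  have hz : z ≠ 0 := by rintro rfl; simp at h
  obtain ⟨n, hn⟩ := vl_unit_eq v (Units.mk0 z hz)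
  rw [Units.val_mk0] at hn
  rw [hn, ← exp_zero, exp_lt_exp] at h
  rw [hn, exp_le_exp]; omega

lemma le_exp_neg_one {v : HeightOneSpectrum (𝓞 K)} {z : K} (h : vl v z < 1) : vl v z ≤ exp (-1 : ℤ) := by
  by_cases hz : z = 0
  · subst hz; simp
  obtain ⟨n, hn⟩ := vl_unit_eq v (Units.mk0 z hz)
  rw [Units.val_mk0] at hn
  rw [hn, ← exp_zero, exp_lt_exp] at h
  rw [hn, exp_le_exp]; omega

lemma FP0 (p : HeightOneSpectrum (𝓞 K)) : ∃ (X : Finset (HeightOneSpectrum (𝓞 K))) (A B ϖ : K) (N : ℕ),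
    p ∈ X ∧ (∀ z, EQ A B ϖ N z → vl p z ≤ 1) ∧ ∀ z, (∀ v ∈ X, vl v z ≤ 1) → EQ A B ϖ N z := by
  classical
  obtain ⟨B, hB, hUR, hLS, hdy⟩ := exists_Bd p
  obtain ⟨A, hA⟩ := exists_unif p
  have hAp : A ∉ LN p B := by
    rw [LN_of_UR hLS hUR, mem_EV_iff hA]; decide
  set X := (ram_fin B A).toFinset with hX
  have hmX : ∀ u, u ∈ X ↔ A ∉ LN u B := by intro u; simp [hX]
  choose π hπ using fun v : HeightOneSpectrum (𝓞 K) => exists_unif v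
  obtain ⟨ϖ, hϖ⟩ := approx_LS X π
  have hϖ' : ∀ v ∈ X, vl v (ϖ : K) = exp (-1 : ℤ) := fun v hv => by rw [(hϖ v hv).2, hπ]
  have h16 : (16 : K) * ϖ ≠ 0 := mul_ne_zero (by norm_num) ϖ.ne_zero
  obtain ⟨m, hm⟩ := vl_unit_eq p (Units.mk0 _ h16)
  rw [Units.val_mk0] at hm
  refine ⟨X, A, B, ϖ, m.natAbs + 1, (hmX p).2 hAp, ?_, ?_⟩
  · rintro z ⟨α, β, γ, h⟩
    by_contra hz
    push Not at hz
    have hz1 := exp_one_le hz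
    have hz0 : z ≠ 0 := by rintro rfl; simp at hz
    set w : K := z ^ (m.natAbs + 1) with hw
    have hw0 : w ≠ 0 := pow_ne_zero _ hz0
    have hww : z ^ (2 * (m.natAbs + 1)) = w ^ 2 := by rw [hw, ← pow_mul, mul_comm]
    rw [hww] at h
    have hbig : 1 < vl p (16 * ϖ * w ^ 2) := by
      rw [map_mul, hm]
      have : exp ((2 * (m.natAbs + 1) : ℕ) : ℤ) ≤ vl p (w ^ 2) := by
        rw [← hww, map_pow]
        refine le_trans ?_ (pow_le_pow_left₀ zero_le' hz1 _)
        rw [← exp_nsmul, exp_le_exp]; simp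
      refine lt_of_lt_of_le ?_ (mul_le_mul_right this _)
      rw [← exp_add, ← exp_zero, exp_lt_exp]; push_cast; have h8 := neg_abs_le m; have h9 := abs_nonneg m; linarith
    have h2 : (2 : K) ≠ 0 := two_ne_zero
    have hϖ0 : (ϖ : K) ≠ 0 := ϖ.ne_zero
    set q : K := 1 / (2 * ϖ * w) with hq
    have h3 := aniso (hB.adm p) hAp (q * α) (q * β) (q * γ)
    have e : 1 - ((A : K) * (q * α) ^ 2 + B * (q * β) ^ 2 - A * B * (q * γ) ^ 2) = - (4 / (16 * ϖ * w ^ 2)) := by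
      have : (A : K) * (q * α) ^ 2 + B * (q * β) ^ 2 - A * B * (q * γ) ^ 2 = q ^ 2 * (ϖ * (1 + 4 * ϖ * w ^ 2)) := by
        rw [h]; ring
      rw [this, hq]; field_simp; ring
    rw [e, Valuation.map_neg, map_div₀] at h3
    have h4 := vl4_pos p
    exact absurd h3 (not_le.2 (by rw [div_lt_iff₀ (zero_lt_one.trans hbig)]; exact lt_mul_of_one_lt_right h4 hbig))
  · intro z hz
    have hu : ∀ v ∈ X, vl v (1 + 4 * (ϖ : K) * z ^ (2 * (m.natAbs + 1))) = 1 := by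
      intro v hv
      apply vl_eq_one_of_sub_lt
      rw [add_sub_cancel_left, map_mul, map_mul, map_pow, hϖ' v hv]
      have h1 : vl v (4 : K) * exp (-1 : ℤ) < 1 :=
        lt_of_le_of_lt (mul_le_of_le_one_left' (vl4_le v)) (by rw [← exp_zero, exp_lt_exp]; decide)
      exact lt_of_le_of_lt (mul_le_of_le_one_right' (pow_le_one' (hz v hv) _)) h1
    have hD : (ϖ : K) * (1 + 4 * (ϖ : K) * z ^ (2 * (m.natAbs + 1))) ≠ 0 := by
      apply mul_ne_zero ϖ.ne_zero
      intro h0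
      have := hu p ((hmX p).2 hAp)
      rw [h0, map_zero] at this; exact zero_ne_one this
    obtain ⟨α, β, γ, h⟩ := repr (D := Units.mk0 _ hD) hB ⟨p, hAp⟩ (by
      intro v hv
      left
      have hv' := (hmX v).2 hv
      rw [mem_EV_iff (n := -1) (by rw [Units.val_mk0, map_mul, hϖ' v hv', hu v hv', mul_one])]; decide)
    exact ⟨α, β, γ, h⟩

theorem FP (p : HeightOneSpectrum (𝓞 K)) : ∃ (A B ϖ π : K) (N : ℕ), ∀ z : K, vl p z ≤ 1 ↔
    ∃ b, EQ A B ϖ N b ∧ EQ A B ϖ N (z * b) ∧ EQ A B ϖ N ((b - 1) * π) := by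
  classical
  obtain ⟨X, A, B, ϖ, N, hp, h1, h2⟩ := FP0 p
  obtain ⟨π0, hπ0⟩ := exists_unif p
  obtain ⟨π, hπ⟩ := approx_LS X (fun v => if v = p then π0 else 1)
  have hπp : vl p (π : K) = exp (-1 : ℤ) := by rw [(hπ p hp).2]; simp [hπ0]
  have hπv : ∀ v ∈ X, v ≠ p → vl v (π : K) = 1 := by
    intro v hv hvp
    rw [(hπ v hv).2]; simp [hvp]
  refine ⟨A, B, ϖ, (π : K)⁻¹, N, fun z => ⟨fun hz => ?_, ?_⟩⟩
  · by_cases hz0 : z = 0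
    · subst hz0
      refine ⟨1, h2 _ (by simp), h2 _ (by simp), h2 _ (by simp)⟩
    choose n hn using fun v : HeightOneSpectrum (𝓞 K) => vl_unit_eq v (Units.mk0 z hz0)
    simp only [Units.val_mk0] at hn
    set M := X.sup (fun v => (n v).natAbs) + 1 with hM
    have hMv : ∀ v ∈ X, n v ≤ M := by
      intro v hv
      have := Finset.le_sup (f := fun v => (n v).natAbs) hv
      omega
    obtain ⟨b, hb⟩ := weak_approx X (fun v => if v = p then 1 else 0) M
    have hbp : vl p (b - 1) ≤ exp (-1 : ℤ) := by
      have := hb p hp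
      rw [if_pos rfl] at this
      refine this.trans ?_
      rw [exp_le_exp]; omega
    have hbv : ∀ v ∈ X, v ≠ p → vl v b ≤ exp (-(M : ℤ)) := by
      intro v hv hvp
      have := hb v hv
      rwa [if_neg hvp, sub_zero] at this
    have hlt : (exp (-1 : ℤ) : ℤᵐ⁰) < 1 := by rw [← exp_zero, exp_lt_exp]; decide
    have hb1 : vl p b = 1 := vl_eq_one_of_sub_lt (hbp.trans_lt hlt)
    have hbX : ∀ v ∈ X, vl v b ≤ 1 := by
      intro v hv
      by_cases hvp : v = p
      · subst hvp; exact hb1.le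
      · refine (hbv v hv hvp).trans ?_
        rw [← exp_zero, exp_le_exp]; omega
    refine ⟨b, h2 _ hbX, h2 _ fun v hv => ?_, h2 _ fun v hv => ?_⟩
    · by_cases hvp : v = p
      · subst hvp; rw [map_mul, hb1, mul_one]; exact hz
      · rw [map_mul, hn]
        refine (mul_le_mul_right (hbv v hv hvp) _).trans ?_
        rw [← exp_add, ← exp_zero, exp_le_exp]
        have := hMv v hv
        omega
    · by_cases hvp : v = p
      · subst hvp
        rw [map_mul, map_inv₀, hπp]
        refine (mul_le_mul_left hbp _).trans ?_
        rw [mul_inv_cancel₀ exp_ne_zero]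
      · rw [map_mul, map_inv₀, hπv v hv hvp, inv_one, mul_one]
        exact (Valuation.map_sub _ _ _).trans (max_le (hbX v hv) (by simp))
  · rintro ⟨b, hb1, hb2, hb3⟩
    have h3 := h1 _ hb3
    have h4 := h1 _ hb2
    have hlt : (exp (-1 : ℤ) : ℤᵐ⁰) < 1 := by rw [← exp_zero, exp_lt_exp]; decide
    have hb : vl p b = 1 := by
      apply vl_eq_one_of_sub_lt
      have e : b - 1 = ((b - 1) * (π : K)⁻¹) * π := by field_simp
      rw [e, map_mul, hπp]
      exact lt_of_le_of_lt (mul_le_of_le_one_left' h3) hlt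
    rwa [map_mul, hb, mul_one] at h4
end UD

end

section
set_option linter.all false
open IsDedekindDomain NumberField WithZero
namespace UD
variable {K : Type*} [Field K] [NumberField K]

lemma em1_lt : (exp (-1 : ℤ) : ℤᵐ⁰) < 1 := by rw [← exp_zero, exp_lt_exp]; decide
lemma em2_lt : (exp (-2 : ℤ) : ℤᵐ⁰) < exp (-1 : ℤ) := by rw [exp_lt_exp]; decide

lemma le_exp_neg_two {v : HeightOneSpectrum (𝓞 K)} {z : K} (h : vl v z < exp (-1 : ℤ)) : vl v z ≤ exp (-2 : ℤ) := by
  by_cases hz : z = 0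
  · subst hz; simp
  obtain ⟨n, hn⟩ := vl_unit_eq v (Units.mk0 z hz)
  rw [Units.val_mk0] at hn
  rw [hn, exp_lt_exp] at h
  rw [hn, exp_le_exp]; omega

/-- the good local conditions -/
def Gd (v : HeightOneSpectrum (𝓞 K)) (a c : K) : Prop :=
  vl v a < 1 ∧ ((∃ j : ℤ, 0 < j ∧ Odd j ∧ vl v c = exp j) ∨
    (vl v c = 1 ∧ ¬ IsSquare (1 - rs v c)) ∨ (vl v c = 1 ∧ vl v ((1 - a) ^ 2 - c) = exp (-1 : ℤ)))

lemma Gd.use {v : HeightOneSpectrum (𝓞 K)} (hv : Odd' v) {a c u : K} (h : Gd v a c) (hu : vl v (u - 1) ≤ exp (-2 : ℤ)) :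
    1 - a * u ^ 2 ≠ 0 ∧ (1 - a * u ^ 2) ^ 2 - c * u ^ 2 ≠ 0 ∧
      ∀ D : Kˣ, (D : K) * (1 - a * u ^ 2) ^ 2 = (1 - a * u ^ 2) ^ 2 - c * u ^ 2 → D ∉ EV v ∨ D ∉ LS v := by
  obtain ⟨ha, h⟩ := h
  have hu1 : vl v u = 1 := vl_eq_one_of_sub_lt (hu.trans_lt (em2_lt.trans em1_lt))
  have hau : vl v (a * u ^ 2) < 1 := by rw [map_mul, map_pow, hu1, one_pow, mul_one]; exact ha
  have h1 : vl v (1 - a * u ^ 2) = 1 := by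
    apply vl_eq_one_of_sub_lt
    rw [show 1 - a * u ^ 2 - 1 = -(a * u ^ 2) by ring, Valuation.map_neg]; exact hau
  have h1' : vl v ((1 - a * u ^ 2) ^ 2) = 1 := by rw [map_pow, h1, one_pow]
  have h10 : 1 - a * u ^ 2 ≠ 0 := by intro h0; rw [h0, map_zero] at h1; exact zero_ne_one h1
  refine ⟨h10, ?_⟩
  set ψ : K := (1 - a * u ^ 2) ^ 2 - c * u ^ 2 with hψ
  have hDv : ∀ D : Kˣ, (D : K) * (1 - a * u ^ 2) ^ 2 = ψ → vl v (D : K) = vl v ψ := by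
    intro D hD; rw [← hD, map_mul, h1', mul_one]
  have hodd : ∀ j : ℤ, Odd j → vl v ψ = exp j → ψ ≠ 0 ∧ ∀ D : Kˣ, (D : K) * (1 - a * u ^ 2) ^ 2 = ψ → D ∉ EV v ∨ D ∉ LS v := by
    intro j hj hvj
    refine ⟨fun h0 => ?_, fun D hD => Or.inl ?_⟩
    · rw [h0, map_zero] at hvj; exact exp_ne_zero hvj.symm
    · rw [mem_EV_iff ((hDv D hD).trans hvj), Int.not_even_iff_odd]; exact hj
  have hu2 : vl v (u ^ 2 - 1) ≤ exp (-2 : ℤ) := by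
    rw [show u ^ 2 - 1 = (u - 1) * (u + 1) by ring, map_mul]
    exact (mul_le_of_le_one_right' ((Valuation.map_add _ _ _).trans (max_le hu1.le (by simp)))).trans hu
  have hψd : vl v c = 1 → vl v (ψ - ((1 - a) ^ 2 - c)) ≤ exp (-2 : ℤ) := by
    intro hc
    have e : ψ - ((1 - a) ^ 2 - c) = (u ^ 2 - 1) * (a * (a * u ^ 2 + a) - (a + a) - c) := by rw [hψ]; ring
    rw [e, map_mul]
    refine (mul_le_of_le_one_right' ?_).trans hu2
    refine (Valuation.map_sub _ _ _).trans (max_le ((Valuation.map_sub _ _ _).trans (max_le ?_ ?_)) hc.le)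
    · rw [map_mul]; exact mul_le_one' ha.le ((Valuation.map_add _ _ _).trans (max_le hau.le ha.le))
    · exact (Valuation.map_add _ _ _).trans (max_le ha.le ha.le)
  rcases h with ⟨j, hj0, hj, hc⟩ | ⟨hc, hns⟩ | ⟨hc, hc1⟩
  · apply hodd j hj
    rw [hψ, Valuation.map_sub_swap, Valuation.map_sub_eq_of_lt_left, map_mul, map_pow, hu1, one_pow, mul_one, hc]
    rw [h1', map_mul, map_pow, hu1, one_pow, mul_one, hc, ← exp_zero, exp_lt_exp]; exact hj0
  · have hd : vl v (ψ - (1 - c)) < 1 := by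
      have e : ψ - (1 - c) = (ψ - ((1 - a) ^ 2 - c)) + (a * a - (a + a)) := by ring
      rw [e]
      refine (Valuation.map_add _ _ _).trans_lt (max_lt ((hψd hc).trans_lt (em2_lt.trans em1_lt)) ?_)
      refine (Valuation.map_sub _ _ _).trans_lt (max_lt ?_ ((Valuation.map_add _ _ _).trans_lt (max_lt ha ha)))
      rw [map_mul]; exact mul_lt_one' ha ha
    have h1c : vl v (1 - c) ≤ 1 := (Valuation.map_sub _ _ _).trans (max_le (by simp) hc.le)
    have hψ1 : vl v ψ ≤ 1 := by
      rw [show ψ = (ψ - (1 - c)) + (1 - c) by ring]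
      exact (Valuation.map_add _ _ _).trans (max_le hd.le h1c)
    have hrs : rs v ψ = 1 - rs v c := by
      rw [(rs_eq_iff hψ1 h1c).2 hd, rs_sub (by simp) hc.le, rs_one]
    have hψe : vl v ψ = 1 := by
      by_contra hne
      have := (rs_zero_iff hψ1).2 (lt_of_le_of_ne hψ1 hne)
      rw [← hrs, this] at hns
      exact hns ⟨0, by simp⟩
    refine ⟨fun h0 => ?_, fun D hD => Or.inr ?_⟩
    · rw [h0, map_zero] at hψe; exact zero_ne_one hψe
    · have hD1 := (hDv D hD).trans hψe
      rw [LS_odd_iff hv hD1]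
      have : rs v (D : K) = rs v ψ := by
        rw [rs_eq_iff hD1.le hψ1, ← hD, show (D : K) - D * (1 - a * u ^ 2) ^ 2 = D * (a * u ^ 2 * (2 - a * u ^ 2)) by ring, map_mul, hD1, one_mul, map_mul]
        refine lt_of_le_of_lt (mul_le_of_le_one_right' ?_) hau
        exact (Valuation.map_sub _ _ _).trans (max_le (vl2_le v) hau.le)
      rw [this, hrs]; exact hns
  · apply hodd (-1) (by decide)
    rw [← hc1, show ψ = (ψ - ((1 - a) ^ 2 - c)) + ((1 - a) ^ 2 - c) by ring]
    apply Valuation.map_add_eq_of_lt_right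
    rw [hc1]; exact (hψd hc).trans_lt em2_lt

lemma exists_Gd {v : HeightOneSpectrum (𝓞 K)} (hv : Odd' v) {A B : Kˣ} (hA : A ∉ EV v) (hB : vl v (B : K) = 1) {y : K} (hy : 1 < vl v y) :
    ∃ t : Kˣ, Gd v (A * t ^ 2) (4 * A * B * y * t ^ 2) := by
  obtain ⟨π, hπ⟩ := exists_unif v
  have hy0 : y ≠ 0 := by rintro rfl; simp at hy
  obtain ⟨k, hk⟩ := vl_unit_eq v (Units.mk0 y hy0)
  rw [Units.val_mk0] at hk
  rw [hk, ← exp_zero, exp_lt_exp] at hy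
  obtain ⟨l, hl⟩ := vl_unit_eq v A
  rw [mem_EV_iff hl, Int.not_even_iff_odd] at hA
  have hπn : ∀ n : ℤ, vl v (((π ^ n : Kˣ) : K)) = exp (-n) := by
    intro n
    rw [Units.val_zpow_eq_zpow_val, map_zpow₀, hπ, ← exp_zsmul]; simp
  have hval : ∀ n : ℤ, vl v ((A : K) * ((π ^ n : Kˣ) : K) ^ 2) = exp (l - 2 * n) := by
    intro n
    rw [map_mul, map_pow, hl, hπn, ← exp_nsmul, ← exp_add]; congr 1; simp; ring
  have hval2 : ∀ n : ℤ, vl v (4 * (A : K) * B * y * ((π ^ n : Kˣ) : K) ^ 2) = exp (k + (l - 2 * n)) := by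
    intro n
    rw [show 4 * (A : K) * B * y * ((π ^ n : Kˣ) : K) ^ 2 = 4 * B * (y * (A * ((π ^ n : Kˣ) : K) ^ 2)) by ring, map_mul, map_mul, map_mul, hv.four, hB, hval, hk, one_mul, one_mul, ← exp_add]
  rcases Int.even_or_odd k with hke | hko
  · obtain ⟨n, hn⟩ : ∃ n, l - 2 * n = -1 := by
      obtain ⟨r, hr⟩ := hA; exact ⟨r + 1, by omega⟩
    refine ⟨π ^ n, ?_, Or.inl ⟨k + (l - 2 * n), ?_, ?_, hval2 n⟩⟩
    · rw [hval, hn]; exact em1_lt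
    · obtain ⟨r, hr⟩ := hke; omega
    · rw [hn]; exact hke.add_odd (by decide)
  obtain ⟨n, hn⟩ : ∃ n, l - 2 * n = -k := by
    obtain ⟨r, hr⟩ := hA; obtain ⟨r', hr'⟩ := hko; exact ⟨r + r' + 1, by omega⟩
  set t1 : Kˣ := π ^ n with ht1
  have ha1 := hval n
  have hc1 := hval2 n
  rw [hn] at ha1 hc1
  rw [add_neg_cancel, exp_zero] at hc1
  have ha1' : vl v ((A : K) * (t1 : K) ^ 2) < 1 := by
    rw [ha1, ← exp_zero, exp_lt_exp]; omega
  set c1 : K := 4 * (A : K) * B * y * (t1 : K) ^ 2 with hc1d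
  clear_value c1
  have h2 : (2 : Fv v) ≠ 0 := by
    rw [← rs_two, Ne, rs_zero_iff (vl2_le v)]
    intro h; exact h.ne hv
  have lift : ∀ e : Fv v, e ≠ 0 → ∃ u : Kˣ, vl v (u : K) = 1 ∧ rs v (u : K) = e := by
    intro e he
    obtain ⟨a, ha⟩ := rs_surj v e
    have hle : vl v (algebraMap (𝓞 K) K a) ≤ 1 := v.valuation_le_one a
    have h1 : vl v (algebraMap (𝓞 K) K a) = 1 := by
      by_contra hne
      exact he (ha ▸ (rs_zero_iff hle).2 (lt_of_le_of_ne hle hne))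
    have h0 : algebraMap (𝓞 K) K a ≠ 0 := by intro h0; rw [h0, map_zero] at h1; exact zero_ne_one h1
    exact ⟨Units.mk0 _ h0, h1, ha⟩
  have hsc : ∀ u : Kˣ, vl v (u : K) = 1 → vl v ((A : K) * ((t1 * u : Kˣ) : K) ^ 2) < 1 ∧ vl v (4 * (A : K) * B * y * ((t1 * u : Kˣ) : K) ^ 2) = 1 := by
    intro u hu
    rw [Units.val_mul, show (A : K) * ((t1 : K) * u) ^ 2 = A * t1 ^ 2 * u ^ 2 by ring, Valuation.map_mul (vl v) (A * t1 ^ 2 : K), map_pow (vl v) (u : K), hu, one_pow, mul_one,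
      show 4 * (A : K) * B * y * ((t1 : K) * u) ^ 2 = c1 * u ^ 2 by rw [hc1d]; ring, Valuation.map_mul (vl v) c1, hc1, map_pow, hu, one_pow, mul_one]
    exact ⟨ha1', rfl⟩
  have hrsc : ∀ u : Kˣ, vl v (u : K) = 1 → rs v (4 * (A : K) * B * y * ((t1 * u : Kˣ) : K) ^ 2) = rs v c1 * rs v (u : K) ^ 2 := by
    intro u hu
    rw [Units.val_mul, show 4 * (A : K) * B * y * ((t1 : K) * u) ^ 2 = c1 * (u * u) by rw [hc1d]; ring, rs_mul hc1.le (by rw [map_mul, hu, one_mul]), rs_mul hu.le hu.le, _root_.sq]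
  by_cases hsq : IsSquare (rs v c1)
  · obtain ⟨d, hd⟩ := hsq
    have hd0 : d ≠ 0 := by
      rintro rfl
      rw [mul_zero, rs_zero_iff hc1.le] at hd; exact hd.ne hc1
    obtain ⟨u, hu, hru⟩ := lift d⁻¹ (inv_ne_zero hd0)
    obtain ⟨hs1, hs2⟩ := hsc u hu
    set a' := (A : K) * ((t1 * u : Kˣ) : K) ^ 2 with ha'
    set c' := 4 * (A : K) * B * y * ((t1 * u : Kˣ) : K) ^ 2 with hc'
    clear_value a' c'
    have hr : rs v c' = 1 := by rw [hc', hrsc u hu, hd, hru]; field_simp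
    have hc1' : vl v (c' - 1) < 1 := by
      rw [← rs_eq_iff hs2.le (by simp), hr, rs_one]
    have haa : vl v (a' * a' - (a' + a')) < 1 := by
      refine (Valuation.map_sub _ _ _).trans_lt (max_lt ?_ ((Valuation.map_add _ _ _).trans_lt (max_lt hs1 hs1)))
      rw [map_mul]; exact mul_lt_one' hs1 hs1
    have hlt : vl v ((1 - a') ^ 2 - c') < 1 := by
      rw [show (1 - a') ^ 2 - c' = (a' * a' - (a' + a')) - (c' - 1) by ring]
      exact (Valuation.map_sub _ _ _).trans_lt (max_lt haa hc1')
    by_cases hex : vl v ((1 - a') ^ 2 - c') = exp (-1 : ℤ)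
    · refine ⟨t1 * u, ?_⟩
      rw [← ha', ← hc']
      exact ⟨hs1, Or.inr (Or.inr ⟨hs2, hex⟩)⟩
    have hle2 := le_exp_neg_two (lt_of_le_of_ne (le_exp_neg_one hlt) hex)
    have hπ1 : vl v (1 + (π : K)) = 1 := by
      apply vl_eq_one_of_sub_lt; rw [add_sub_cancel_left, hπ]; exact em1_lt
    have hπ0 : 1 + (π : K) ≠ 0 := by intro h0; rw [h0, map_zero] at hπ1; exact zero_ne_one hπ1
    obtain ⟨hs3, hs4⟩ := hsc (u * Units.mk0 _ hπ0) (by rw [Units.val_mul, map_mul, hu, one_mul]; exact hπ1)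
    refine ⟨t1 * (u * Units.mk0 _ hπ0), hs3, Or.inr (Or.inr ⟨hs4, ?_⟩)⟩
    have e1 : (A : K) * ((t1 * (u * Units.mk0 _ hπ0) : Kˣ) : K) ^ 2 = a' * (1 + π) ^ 2 := by
      rw [ha']; push_cast; rw [Units.val_mk0]; ring
    have e2 : 4 * (A : K) * B * y * ((t1 * (u * Units.mk0 _ hπ0) : Kˣ) : K) ^ 2 = c' * (1 + π) ^ 2 := by
      rw [hc']; push_cast; rw [Units.val_mk0]; ring
    rw [e1] at hs3
    rw [e2] at hs4
    rw [e1, e2]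
    have h2π : vl v (2 + (π : K)) = 1 := by
      rw [Valuation.map_add_eq_of_lt_left]
      · exact hv
      · rw [hπ, show vl v (2 : K) = 1 from hv]; exact em1_lt
    have hm : vl v (c' * (π * (2 + π))) = exp (-1 : ℤ) := by
      rw [map_mul, map_mul, hs2, h2π, hπ, one_mul, mul_one]
    have e3 : (1 - a' * (1 + (π : K)) ^ 2) ^ 2 - c' * (1 + π) ^ 2 =
      ((1 - a') ^ 2 - c' + a' * (π * (2 + π) * (a' + a' * (1 + π) ^ 2 - 2))) - c' * (π * (2 + π)) := by ring
    have hsm : vl v ((1 - a') ^ 2 - c' + a' * (π * (2 + π) * (a' + a' * (1 + π) ^ 2 - 2))) < exp (-1 : ℤ) := by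
      refine (Valuation.map_add _ _ _).trans_lt (max_lt (hle2.trans_lt em2_lt) ?_)
      rw [map_mul, map_mul, map_mul, hπ, h2π, mul_one]
      have h5 : vl v (a' + a' * (1 + (π : K)) ^ 2 - 2) ≤ 1 :=
        (Valuation.map_sub _ _ _).trans (max_le ((Valuation.map_add _ _ _).trans (max_le hs1.le hs3.le)) (vl2_le v))
      refine lt_of_le_of_lt (mul_le_mul_right (mul_le_of_le_one_right' h5) _) ?_
      exact mul_lt_of_lt_one_left (by simp) hs1
    rw [e3, Valuation.map_sub_swap, Valuation.map_sub_eq_of_lt_left, hm]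
    rw [hm]; exact hsm
  · obtain ⟨e, he0, he⟩ := ff_one_sub h2 hsq
    obtain ⟨u, hu, hru⟩ := lift e he0
    obtain ⟨hs1, hs2⟩ := hsc u hu
    refine ⟨t1 * u, hs1, Or.inr (Or.inl ⟨hs2, ?_⟩)⟩
    rw [hrsc u hu, hru]; exact he
end UD

end

section
set_option linter.all false
open IsDedekindDomain NumberField WithZero
namespace UD
variable {K : Type*} [Field K] [NumberField K]

def Cert (S : Finset (HeightOneSpectrum (𝓞 K))) (s0 : HeightOneSpectrum (𝓞 K)) (c g0 ϖ y : K) : Prop :=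
  ∃ g A m e e' α β γ : K, (∀ v ∈ S, vl v (g / c) ≤ 1) ∧ vl s0 ((g - g0) / ϖ) ≤ 1 ∧ A * m ^ 2 = ϖ * e ∧ e * e' = 1 ∧
    vl s0 e ≤ 1 ∧ vl s0 e' ≤ 1 ∧
    4 * A * (1 + g ^ 2) * y = (1 - A) ^ 2 * (1 - (A * α ^ 2 + (1 + g ^ 2) * β ^ 2 - A * (1 + g ^ 2) * γ ^ 2))

/-- the constants are fine -/
structure CD (S : Finset (HeightOneSpectrum (𝓞 K))) (s0 : HeightOneSpectrum (𝓞 K)) (c g0 ϖ : K) : Prop where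
  dy : ∀ v, ¬ Odd' v → v ∈ S
  s0S : s0 ∉ S
  c0 : c ≠ 0
  cS : ∀ v ∈ S, vl v c < vl v 4
  g : ∀ g : K, vl s0 (g - g0) < 1 → vl s0 (1 + g ^ 2) = 1 ∧ ∀ B : Kˣ, (B : K) = 1 + g ^ 2 → B ∉ LS s0
  ϖ : vl s0 ϖ = exp (-1 : ℤ)

variable {S : Finset (HeightOneSpectrum (𝓞 K))} {s0 : HeightOneSpectrum (𝓞 K)} {c g0 ϖ : K}

lemma CD.odd (h : CD S s0 c g0 ϖ) {v : HeightOneSpectrum (𝓞 K)} (hv : v ∉ S) : Odd' v := by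
  by_contra hn; exact hv (h.dy v hn)

lemma CD.ϖ0 (h : CD S s0 c g0 ϖ) : ϖ ≠ 0 := by
  rintro rfl
  have := h.ϖ
  rw [map_zero] at this; exact exp_ne_zero this.symm

lemma CD.NI (h : CD S s0 c g0 ϖ) {g : K} {B : Kˣ} (hB : (B : K) = 1 + g ^ 2) (hg : ∀ v ∈ S, vl v (g / c) ≤ 1) :
    B ∈ NI K ∧ ∀ v ∈ S, B ∈ LS v := by
  have hg' : ∀ v ∈ S, B ∈ LS v := by
    intro v hv
    apply one_add_LS _ hB
    refine lt_of_le_of_lt ?_ (h.cS v hv)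
    have := hg v hv
    rw [map_div₀] at this
    have hc : 0 < vl v c := by rw [zero_lt_iff, Ne, map_eq_zero]; exact h.c0
    exact (div_le_one₀ hc).1 this
  refine ⟨⟨mem_FI.2 fun v hv => hg' v (h.dy v (mem_Dy.1 hv)), one_add_TP hB⟩, hg'⟩

lemma LN_unit {v : HeightOneSpectrum (𝓞 K)} (hv : Odd' v) {A B : Kˣ} (hB : vl v (B : K) = 1) (hB' : B ∉ LS v) :
    A ∈ LN v B ↔ A ∈ EV v := by
  rw [LN_of_UR hB' (hv.UR_eq ▸ EV_of_one hB)]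

lemma cert_sound (h : CD S s0 c g0 ϖ) {y : K} (hy : Cert S s0 c g0 ϖ y) : ∃ p ∉ S, p ≠ s0 ∧ 1 < vl p y := by
  obtain ⟨g, A, m, e, e', α, β, γ, hg, hg0, hA, he, he1, he2, hmain⟩ := hy
  have hs0 := h.odd h.s0S
  have hϖ0 := h.ϖ0
  have hg1 : vl s0 (g - g0) < 1 := by
    rw [show g - g0 = (g - g0) / ϖ * ϖ by field_simp, map_mul, h.ϖ]
    exact lt_of_le_of_lt (mul_le_of_le_one_left' hg0) em1_lt
  obtain ⟨hB1, hBn⟩ := h.g g hg1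
  have hB0 : 1 + g ^ 2 ≠ 0 := by intro h0; rw [h0, map_zero] at hB1; exact zero_ne_one hB1
  obtain ⟨B, hB⟩ : ∃ B : Kˣ, (B : K) = 1 + g ^ 2 := ⟨Units.mk0 _ hB0, rfl⟩
  have he0 : e ≠ 0 := by rintro rfl; simp at he
  have hA0 : A ≠ 0 := by
    rintro rfl; rw [zero_mul] at hA
    exact mul_ne_zero hϖ0 he0 hA.symm
  have hm0 : m ≠ 0 := by
    rintro rfl; rw [zero_pow two_ne_zero, mul_zero] at hA
    exact mul_ne_zero hϖ0 he0 hA.symm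
  obtain ⟨A, rfl⟩ : ∃ A' : Kˣ, (A' : K) = A := ⟨Units.mk0 _ hA0, rfl⟩
  obtain ⟨hNI, hLS⟩ := h.NI hB hg
  rw [← hB] at hmain hB1
  have he11 : vl s0 e = 1 := by
    have h1 : vl s0 e * vl s0 e' = 1 := by rw [← map_mul, he, map_one]
    refine le_antisymm he1 ?_
    rw [← h1]; exact mul_le_of_le_one_right' he2
  have hAs : A ∉ LN s0 B := by
    rw [LN_unit hs0 hB1 (hBn B hB)]
    obtain ⟨l, hl⟩ := vl_unit_eq s0 A
    obtain ⟨k, hk⟩ := vl_unit_eq s0 (Units.mk0 m hm0)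
    rw [Units.val_mk0] at hk
    rw [mem_EV_iff hl]
    rintro ⟨r, hr⟩
    have := congrArg (vl s0) hA
    rw [map_mul, map_pow, map_mul, hl, hk, h.ϖ, he11, mul_one, ← exp_nsmul, ← exp_add, exp_inj] at this
    simp at this; omega
  obtain ⟨p, hps, hp⟩ := other_ram hNI hAs
  have hpo := NI.odd hNI hp
  have hBp := not_LS_of hp
  refine ⟨p, fun hpS => hBp (hLS p hpS), hps, ?_⟩
  have han := aniso ((NI.sn hNI).adm p) hp α β γ
  rw [hpo.four] at han
  have hgp : vl p g ≤ 1 := by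
    by_contra hcon
    push Not at hcon
    have hg0' : g ≠ 0 := by rintro rfl; simp at hcon
    apply hBp
    apply mem_LS_of (z := g⁻¹)
    rw [hpo.four, hB, show (1 + g ^ 2) * g⁻¹ ^ 2 - 1 = (g⁻¹) ^ 2 by field_simp; ring, map_pow, map_inv₀]
    exact pow_lt_one₀ zero_le' (inv_lt_one_of_one_lt₀ hcon) two_ne_zero
  have hBle : vl p (B : K) ≤ 1 := by
    rw [hB]
    refine (Valuation.map_add _ _ _).trans (max_le (by simp) ?_)
    rw [map_pow]; exact pow_le_one' hgp 2
  have hBpos : 0 < vl p (B : K) := by rw [zero_lt_iff, Ne, map_eq_zero]; exact B.ne_zero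
  have hApos : 0 < vl p (A : K) := by rw [zero_lt_iff, Ne, map_eq_zero]; exact A.ne_zero
  have hlt : vl p (A : K) * vl p (B : K) < vl p (1 - (A : K)) ^ 2 := by
    rcases lt_trichotomy (vl p (A : K)) 1 with h1 | h1 | h1
    · have : vl p (1 - (A : K)) = 1 := by
        rw [Valuation.map_sub_eq_of_lt_left, map_one]; rw [map_one]; exact h1
      rw [this, one_pow]
      exact lt_of_le_of_lt (mul_le_of_le_one_right' hBle) h1
    · have hBl : vl p (B : K) < 1 := by
        refine lt_of_le_of_ne hBle fun hB1 => hp (mem_LN_unit hpo (EV_of_one h1) (EV_of_one hB1))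
      have : vl p (1 - (A : K)) = 1 := by
        refine le_antisymm ((Valuation.map_sub _ _ _).trans (max_le (by simp) h1.le)) ?_
        by_contra hcon
        push Not at hcon
        apply hp
        apply LS_le_LN
        apply mem_LS_of (z := 1)
        rw [one_pow, mul_one, hpo.four, Valuation.map_sub_swap]; exact hcon
      rw [this, one_pow, h1, one_mul]; exact hBl
    · have : vl p (1 - (A : K)) = vl p (A : K) := by
        rw [Valuation.map_sub_swap, Valuation.map_sub_eq_of_lt_left]; rw [map_one]; exact h1
      rw [this, _root_.sq]
      exact mul_lt_mul_of_pos_left (hBle.trans_lt h1) hApos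
  by_contra hcon
  push Not at hcon
  have h5 := congrArg (vl p) hmain
  rw [map_mul, map_mul, map_mul, map_mul, hpo.four, one_mul, map_pow] at h5
  have h6 : vl p (A : K) * vl p (B : K) * vl p y ≤ vl p (A : K) * vl p (B : K) := mul_le_of_le_one_right' hcon
  rw [h5] at h6
  exact absurd (lt_of_lt_of_le hlt (le_mul_of_one_le_right' han)) (not_lt.2 h6)

lemma cert_compl (h : CD S s0 c g0 ϖ) {y : K} {p : HeightOneSpectrum (𝓞 K)} (hpS : p ∉ S) (hps : p ≠ s0) (hp : 1 < vl p y)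
    (hs : 1 < vl s0 y) : Cert S s0 c g0 ϖ y := by
  classical
  have hpo := h.odd hpS
  have hs0 := h.odd h.s0S
  have hϖ0 := h.ϖ0
  obtain ⟨gp, hgp⟩ := exists_g hpo
  choose n hn using fun v : HeightOneSpectrum (𝓞 K) => vl_unit_eq v (Units.mk0 c h.c0)
  simp only [Units.val_mk0] at hn
  set M := S.sup (fun v => (n v).natAbs) + 1 with hM
  have hMv : ∀ v ∈ S, - n v ≤ M := by
    intro v hv
    have := Finset.le_sup (f := fun v => (n v).natAbs) hv
    omega
  obtain ⟨g, hg⟩ := weak_approx (insert p (insert s0 S)) (fun v => if v = p then algebraMap (𝓞 K) K gp else if v = s0 then g0 else 0) M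
  have hMle : (exp (-(M : ℤ)) : ℤᵐ⁰) ≤ exp (-1 : ℤ) := by rw [exp_le_exp]; omega
  have hgp1 := hg p (by simp)
  rw [if_pos rfl] at hgp1
  have hgs1 := hg s0 (by simp)
  rw [if_neg hps.symm, if_pos rfl] at hgs1
  have hgS : ∀ v ∈ S, vl v (g / c) ≤ 1 := by
    intro v hv
    have h1 := hg v (by simp [hv])
    have hvp : v ≠ p := by rintro rfl; exact hpS hv
    have hvs : v ≠ s0 := by rintro rfl; exact h.s0S hv
    rw [if_neg hvp, if_neg hvs, sub_zero] at h1
    rw [map_div₀]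
    refine div_le_one_of_le₀ (h1.trans ?_) zero_le'
    rw [hn, exp_le_exp]; have := hMv v hv; omega
  obtain ⟨hBp, hBp'⟩ := hgp g (hgp1.trans_lt (hMle.trans_lt em1_lt))
  obtain ⟨hBs, hBs'⟩ := h.g g (hgs1.trans_lt (hMle.trans_lt em1_lt))
  have hB0 : 1 + g ^ 2 ≠ 0 := by intro h0; rw [h0, map_zero] at hBp; exact zero_ne_one hBp
  obtain ⟨B, hB⟩ : ∃ B : Kˣ, (B : K) = 1 + g ^ 2 := ⟨Units.mk0 _ hB0, rfl⟩
  replace hBp' := hBp' B hB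
  replace hBs' := hBs' B hB
  rw [← hB] at hBp hBs
  obtain ⟨hNI, -⟩ := h.NI hB hgS
  obtain ⟨A, hA⟩ := pair_real hNI hps hBp' hBs'
  have hAp : A ∉ EV p := by rw [← LN_unit hpo hBp hBp']; exact (hA p).2 (Or.inl rfl)
  have hAs : A ∉ EV s0 := by rw [← LN_unit hs0 hBs hBs']; exact (hA s0).2 (Or.inr rfl)
  obtain ⟨tp, htp⟩ := exists_Gd hpo hAp hBp hp
  obtain ⟨ts, hts⟩ := exists_Gd hs0 hAs hBs hs
  obtain ⟨np, hnp⟩ := vl_unit_eq p tp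
  obtain ⟨ns, hns⟩ := vl_unit_eq s0 ts
  obtain ⟨t, ht⟩ := weak_approx {p, s0} (fun v => if v = p then (tp : K) else ts) (np.natAbs + ns.natAbs + 2)
  have htp1 := ht p (by simp)
  have hts1 := ht s0 (by simp)
  rw [if_pos rfl] at htp1
  rw [if_neg hps.symm] at hts1
  have hup : vl p (t / tp - 1) ≤ exp (-2 : ℤ) := by
    rw [show t / tp - 1 = (t - tp) / tp by field_simp, map_div₀, hnp, div_le_iff₀ (by simp), ← exp_add]
    refine htp1.trans ?_
    rw [exp_le_exp]; push_cast; have h8 := neg_abs_le np; have h9 := abs_nonneg ns; linarith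
  have hus : vl s0 (t / ts - 1) ≤ exp (-2 : ℤ) := by
    rw [show t / ts - 1 = (t - ts) / ts by field_simp, map_div₀, hns, div_le_iff₀ (by simp), ← exp_add]
    refine hts1.trans ?_
    rw [exp_le_exp]; push_cast; have h8 := neg_abs_le ns; have h9 := abs_nonneg np; linarith
  obtain ⟨d1, d2, d3⟩ := htp.use hpo hup
  obtain ⟨-, -, e3⟩ := hts.use hs0 hus
  have ep : (A : K) * tp ^ 2 * (t / tp) ^ 2 = A * t ^ 2 := by field_simp
  have es : (A : K) * ts ^ 2 * (t / ts) ^ 2 = A * t ^ 2 := by field_simp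
  have ep' : 4 * (A : K) * B * y * tp ^ 2 * (t / tp) ^ 2 = 4 * A * B * y * t ^ 2 := by field_simp
  have es' : 4 * (A : K) * B * y * ts ^ 2 * (t / ts) ^ 2 = 4 * A * B * y * t ^ 2 := by field_simp
  rw [ep] at d1
  rw [ep, ep'] at d2 d3
  rw [es, es'] at e3
  have ht0 : t ≠ 0 := by
    rintro rfl
    rw [zero_div, zero_sub, Valuation.map_neg, map_one] at hup
    exact absurd hup (not_le.2 (em2_lt.trans em1_lt))
  set D : K := ((1 - (A : K) * t ^ 2) ^ 2 - 4 * A * B * y * t ^ 2) / (1 - (A : K) * t ^ 2) ^ 2 with hD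
  have hD0 : D ≠ 0 := div_ne_zero d2 (pow_ne_zero _ d1)
  have hDe : D * (1 - (A : K) * t ^ 2) ^ 2 = (1 - (A : K) * t ^ 2) ^ 2 - 4 * A * B * y * t ^ 2 := by
    rw [hD]; field_simp
  set A' : Kˣ := A * (Units.mk0 t ht0) ^ 2 with hA'
  have hA'v : (A' : K) = A * t ^ 2 := by rw [hA']; push_cast; rfl
  have hA'n : ∀ u, A' ∉ LN u B ↔ A ∉ LN u B := by
    intro u
    rw [hA', mul_mem_LN_iff ((NI.sn hNI).adm u)]
    have := LS_le_LN u B (sq_mem_LS u (Units.mk0 t ht0))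
    tauto
  obtain ⟨α, β, γ, hrep⟩ := repr (A := A') (D := Units.mk0 D hD0) (NI.sn hNI) ⟨p, (hA'n p).2 ((hA p).2 (Or.inl rfl))⟩ (by
    intro v hv
    rw [hA'n, hA] at hv
    rcases hv with rfl | rfl
    · rcases d3 (Units.mk0 D hD0) hDe with h1 | h1
      · exact Or.inl h1
      · exact Or.inr ⟨hpo, h1⟩
    · rcases e3 (Units.mk0 D hD0) hDe with h1 | h1
      · exact Or.inl h1
      · exact Or.inr ⟨hs0, h1⟩)
  rw [Units.val_mk0] at hrep
  have hA's : A' ∉ EV s0 := by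
    rw [← LN_unit hs0 hBs hBs']; exact (hA'n s0).2 ((hA s0).2 (Or.inr rfl))
  obtain ⟨l, hl⟩ := vl_unit_eq s0 A'
  rw [mem_EV_iff hl, Int.not_even_iff_odd] at hA's
  obtain ⟨r, hr⟩ := hA's
  set e : K := A' * (ϖ ^ (r + 1)) ^ 2 / ϖ with he
  have he1 : vl s0 e = 1 := by
    rw [he, map_div₀, map_mul, map_pow, map_zpow₀, hl, h.ϖ, ← exp_zsmul, ← exp_nsmul, ← exp_add, ← exp_sub, ← exp_zero, exp_inj]
    simp; omega
  have he0 : e ≠ 0 := by intro h0; rw [h0, map_zero] at he1; exact zero_ne_one he1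
  refine ⟨g, A', ϖ ^ (r + 1), e, e⁻¹, α, β, γ, hgS, ?_, ?_, mul_inv_cancel₀ he0, he1.le, by rw [map_inv₀, he1, inv_one], ?_⟩
  · rw [map_div₀, h.ϖ]
    exact div_le_one_of_le₀ (hgs1.trans hMle) zero_le'
  · rw [he]; field_simp
  · rw [← hB, ← hrep, hA'v]
    clear_value D
    linear_combination hDe
end UD

end

section
set_option linter.all false
open IsDedekindDomain NumberField WithZero
namespace UD
variable {K : Type*} [Field K] {ι κ : Type}

def PolyF (f : (ι → K) → K) : Prop := ∃ p : MvPolynomial ι K, ∀ x, f x = MvPolynomial.eval x p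

lemma PolyF.const (a : K) : PolyF (fun _ : ι → K => a) := ⟨MvPolynomial.C a, by simp⟩
lemma PolyF.var (i : ι) : PolyF (fun x : ι → K => x i) := ⟨MvPolynomial.X i, by simp⟩
lemma PolyF.add {f g : (ι → K) → K} (hf : PolyF f) (hg : PolyF g) : PolyF (fun x => f x + g x) := by
  obtain ⟨p, hp⟩ := hf; obtain ⟨q, hq⟩ := hg
  exact ⟨p + q, fun x => by simp [hp, hq]⟩
lemma PolyF.sub {f g : (ι → K) → K} (hf : PolyF f) (hg : PolyF g) : PolyF (fun x => f x - g x) := by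
  obtain ⟨p, hp⟩ := hf; obtain ⟨q, hq⟩ := hg
  exact ⟨p - q, fun x => by simp [hp, hq]⟩
lemma PolyF.mul {f g : (ι → K) → K} (hf : PolyF f) (hg : PolyF g) : PolyF (fun x => f x * g x) := by
  obtain ⟨p, hp⟩ := hf; obtain ⟨q, hq⟩ := hg
  exact ⟨p * q, fun x => by simp [hp, hq]⟩
lemma PolyF.pow {f : (ι → K) → K} (hf : PolyF f) (n : ℕ) : PolyF (fun x => f x ^ n) := by
  obtain ⟨p, hp⟩ := hf
  exact ⟨p ^ n, fun x => by simp [hp]⟩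
lemma PolyF.div {f : (ι → K) → K} (hf : PolyF f) (a : K) : PolyF (fun x => f x / a) := by
  simp only [div_eq_mul_inv]
  exact hf.mul (PolyF.const _)

/-- diophantine predicates -/
def Dio (P : (ι → K) → Prop) : Prop :=
  ∃ (m : ℕ) (F : MvPolynomial (ι ⊕ Fin m) K), ∀ x, P x ↔ ∃ y : Fin m → K, MvPolynomial.eval (Sum.elim x y) F = 0

lemma Dio.congr {P Q : (ι → K) → Prop} (h : Dio P) (e : ∀ x, Q x ↔ P x) : Dio Q := by
  obtain ⟨m, F, hF⟩ := h
  exact ⟨m, F, fun x => (e x).trans (hF x)⟩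

lemma Dio.eq {f g : (ι → K) → K} (hf : PolyF f) (hg : PolyF g) : Dio (fun x => f x = g x) := by
  obtain ⟨p, hp⟩ := hf.sub hg
  refine ⟨0, MvPolynomial.rename Sum.inl p, fun x => ?_⟩
  have : ∀ y : Fin 0 → K, MvPolynomial.eval (Sum.elim x y) (MvPolynomial.rename Sum.inl p) = f x - g x := by
    intro y; rw [MvPolynomial.eval_rename]; exact (hp x).symm
  simp only [this, sub_eq_zero]
  simp

lemma elim_append {m n : ℕ} (x : ι → K) (y : Fin (m + n) → K) :
    (Sum.elim x y ∘ Sum.map id (Fin.castAdd n) = Sum.elim x (fun i => y (Fin.castAdd n i))) ∧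
    (Sum.elim x y ∘ Sum.map id (Fin.natAdd m) = Sum.elim x (fun i => y (Fin.natAdd m i))) := by
  constructor <;> (funext z; rcases z with z | z <;> rfl)

lemma Dio.and [NumberField K] {P Q : (ι → K) → Prop} (hP : Dio P) (hQ : Dio Q) : Dio (fun x => P x ∧ Q x) := by
  obtain ⟨v, -⟩ := exists_notMem (K := K) ∅
  obtain ⟨d, hd⟩ := exists_unif v
  have hds : ∀ a b : K, a ^ 2 - d * b ^ 2 = 0 → a = 0 ∧ b = 0 := by
    intro a b h
    have hb : b = 0 := by
      by_contra hb
      have ha : a ≠ 0 := by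
        rintro rfl
        have : (d : K) * b ^ 2 = 0 := by linear_combination -h
        rcases mul_eq_zero.1 this with h1 | h1
        · exact d.ne_zero h1
        · exact hb (pow_eq_zero_iff two_ne_zero |>.1 h1)
      have : d ∈ EV v := ⟨Units.mk0 (b / a) (div_ne_zero hb ha), by
        rw [Units.val_mk0, show (d : K) * (b / a) ^ 2 = 1 by field_simp; linear_combination -h, map_one]⟩
      rw [mem_EV_iff hd] at this
      exact absurd this (by decide)
    subst hb
    refine ⟨?_, rfl⟩
    have : a ^ 2 = 0 := by linear_combination h
    exact pow_eq_zero_iff two_ne_zero |>.1 this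
  obtain ⟨m, F, hF⟩ := hP
  obtain ⟨n, G, hG⟩ := hQ
  refine ⟨m + n, (MvPolynomial.rename (Sum.map id (Fin.castAdd n)) F) ^ 2 - MvPolynomial.C (d : K) * (MvPolynomial.rename (Sum.map id (Fin.natAdd m)) G) ^ 2, fun x => ?_⟩
  simp only [map_sub, map_mul, map_pow, MvPolynomial.eval_rename, (elim_append x _).1, (elim_append x _).2, MvPolynomial.eval_C]
  rw [hF, hG]
  constructor
  · rintro ⟨⟨y, hy⟩, z, hz⟩
    refine ⟨Fin.append y z, ?_⟩
    simp [Fin.append_left, Fin.append_right, hy, hz]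
  · rintro ⟨y, hy⟩
    obtain ⟨h1, h2⟩ := hds _ _ hy
    exact ⟨⟨_, h1⟩, _, h2⟩

lemma Dio.or {P Q : (ι → K) → Prop} (hP : Dio P) (hQ : Dio Q) : Dio (fun x => P x ∨ Q x) := by
  obtain ⟨m, F, hF⟩ := hP
  obtain ⟨n, G, hG⟩ := hQ
  refine ⟨m + n, (MvPolynomial.rename (Sum.map id (Fin.castAdd n)) F) * (MvPolynomial.rename (Sum.map id (Fin.natAdd m)) G), fun x => ?_⟩
  simp only [map_mul, MvPolynomial.eval_rename, (elim_append x _).1, (elim_append x _).2, mul_eq_zero]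
  rw [hF, hG]
  constructor
  · rintro (⟨y, hy⟩ | ⟨z, hz⟩)
    · refine ⟨Fin.append y 0, Or.inl ?_⟩
      simp [Fin.append_left, hy]
    · refine ⟨Fin.append 0 z, Or.inr ?_⟩
      simp [Fin.append_right, hz]
  · rintro ⟨y, hy | hy⟩
    · exact Or.inl ⟨_, hy⟩
    · exact Or.inr ⟨_, hy⟩

lemma Dio.comp {P : (κ → K) → Prop} (hP : Dio P) {f : κ → (ι → K) → K} (hf : ∀ k, PolyF (f k)) :
    Dio (fun x => P (fun k => f k x)) := by
  obtain ⟨m, F, hF⟩ := hP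
  choose p hp using hf
  refine ⟨m, MvPolynomial.bind₁ (Sum.elim (fun k => MvPolynomial.rename Sum.inl (p k)) (fun i => MvPolynomial.X (Sum.inr i))) F, fun x => ?_⟩
  refine (hF _).trans ?_
  have : ∀ y : Fin m → K, MvPolynomial.eval (Sum.elim x y) (MvPolynomial.bind₁ (Sum.elim (fun k => MvPolynomial.rename Sum.inl (p k)) (fun i => MvPolynomial.X (Sum.inr i))) F)
      = MvPolynomial.eval (Sum.elim (fun k => f k x) y) F := by
    intro y
    rw [← MvPolynomial.coe_aeval_eq_eval, RingHom.coe_coe, MvPolynomial.aeval_bind₁, ← MvPolynomial.coe_aeval_eq_eval, RingHom.coe_coe]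
    congr 2
    funext z
    rcases z with z | z
    · simp only [Sum.elim_inl, hp]
      rw [MvPolynomial.aeval_rename, ← MvPolynomial.coe_aeval_eq_eval]; rfl
    · simp
  simp only [this]

lemma Dio.ex {k : ℕ} {P : (ι ⊕ Fin k → K) → Prop} (hP : Dio P) : Dio (fun x => ∃ y : Fin k → K, P (Sum.elim x y)) := by
  obtain ⟨m, F, hF⟩ := hP
  refine ⟨k + m, MvPolynomial.rename (Sum.elim (Sum.map id (Fin.castAdd m)) (fun i => Sum.inr (Fin.natAdd k i))) F, fun x => ?_⟩
  simp only [MvPolynomial.eval_rename, hF]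
  have : ∀ y : Fin (k + m) → K, (Sum.elim x y ∘ Sum.elim (Sum.map id (Fin.castAdd m)) (fun i => Sum.inr (Fin.natAdd k i))) =
      Sum.elim (Sum.elim x (fun i => y (Fin.castAdd m i))) (fun i => y (Fin.natAdd k i)) := by
    intro y; funext z; rcases z with (z | z) | z <;> rfl
  simp only [this]
  constructor
  · rintro ⟨y, z, h⟩
    exact ⟨Fin.append y z, by simpa [Fin.append_left, Fin.append_right] using h⟩
  · rintro ⟨y, h⟩
    exact ⟨_, _, h⟩

/-- unary diophantine predicates -/
def D1 (Q : K → Prop) : Prop := Dio (fun x : Unit → K => Q (x ()))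

lemma D1.app {Q : K → Prop} (hQ : D1 Q) {f : (ι → K) → K} (hf : PolyF f) : Dio (fun x => Q (f x)) :=
  Dio.comp (f := fun _ : Unit => f) hQ (fun _ => hf)

lemma Dio.true : Dio (fun _ : ι → K => True) := (Dio.eq (PolyF.const 0) (PolyF.const 0)).congr (by simp)
lemma Dio.false : Dio (fun _ : ι → K => False) := (Dio.eq (PolyF.const 0) (PolyF.const 1)).congr (by simp)

lemma Dio.all [NumberField K] {α : Type*} (S : Finset α) {P : α → (ι → K) → Prop} (h : ∀ a ∈ S, Dio (P a)) : Dio (fun x => ∀ a ∈ S, P a x) := by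
  classical
  induction S using Finset.induction_on with
  | empty => exact Dio.true.congr (by simp)
  | insert a S ha ih =>
    exact ((h a (Finset.mem_insert_self _ _)).and (ih fun b hb => h b (Finset.mem_insert_of_mem hb))).congr (by simp)

lemma Dio.any {α : Type*} (S : Finset α) {P : α → (ι → K) → Prop} (h : ∀ a ∈ S, Dio (P a)) : Dio (fun x => ∃ a ∈ S, P a x) := by
  classical
  induction S using Finset.induction_on with
  | empty => exact Dio.false.congr (by simp)
  | insert a S ha ih =>
    exact ((h a (Finset.mem_insert_self _ _)).or (ih fun b hb => h b (Finset.mem_insert_of_mem hb))).congr (by simp)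

lemma D1.final {Q : K → Prop} (hQ : D1 Q) : ∃ (n : ℕ) (F : MvPolynomial (Fin (n + 1)) K), ∀ x, Q x ↔ ∃ y : Fin n → K,
    MvPolynomial.eval (Fin.cons x y) F = 0 := by
  obtain ⟨m, F, hF⟩ := hQ
  refine ⟨m, MvPolynomial.rename (Sum.elim (fun _ => 0) Fin.succ) F, fun x => ?_⟩
  refine (hF (fun _ => x)).trans ?_
  have : ∀ y : Fin m → K, ((Fin.cons x y : Fin (m + 1) → K) ∘ Sum.elim (fun _ => 0) Fin.succ) = Sum.elim (fun _ : Unit => x) y := by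
    intro y; funext z; rcases z with z | z <;> rfl
  simp only [MvPolynomial.eval_rename, this]
end UD

end

section
set_option linter.all false
open IsDedekindDomain NumberField WithZero
namespace UD
variable {K : Type*} [Field K] [NumberField K] {ι κ : Type}

lemma Dio_EQ (A B ϖ : K) (N : ℕ) {f : (ι → K) → K} (hf : PolyF f) : Dio (fun x => EQ A B ϖ N (f x)) := by
  have h : D1 (fun z : K => EQ A B ϖ N z) := by
    unfold D1
    have h0 : PolyF (fun x : Unit ⊕ Fin 3 → K => x (Sum.inl ())) := PolyF.var _
    have h1 : PolyF (fun x : Unit ⊕ Fin 3 → K => x (Sum.inr 0)) := PolyF.var _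
    have h2 : PolyF (fun x : Unit ⊕ Fin 3 → K => x (Sum.inr 1)) := PolyF.var _
    have h3 : PolyF (fun x : Unit ⊕ Fin 3 → K => x (Sum.inr 2)) := PolyF.var _
    have hc : ∀ a : K, PolyF (fun x : Unit ⊕ Fin 3 → K => a) := fun a => PolyF.const a
    refine (Dio.ex (k := 3) (Dio.eq ((hc ϖ).mul ((hc 1).add (((hc 4).mul (hc ϖ)).mul (h0.pow (2*N)))))
      ((((hc A).mul (h1.pow 2)).add ((hc B).mul (h2.pow 2))).sub (((hc A).mul (hc B)).mul (h3.pow 2))))).congr ?_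
    intro x
    constructor
    · rintro ⟨α, β, γ, h⟩
      exact ⟨![α, β, γ], h⟩
    · rintro ⟨y, h⟩
      exact ⟨_, _, _, h⟩
  exact h.app hf

lemma D1_le (p : HeightOneSpectrum (𝓞 K)) : D1 (fun z : K => vl p z ≤ 1) := by
  obtain ⟨A, B, ϖ, π, N, h⟩ := FP p
  have h0 : PolyF (fun x : Unit ⊕ Fin 1 → K => x (Sum.inl ())) := PolyF.var _
  have h1 : PolyF (fun x : Unit ⊕ Fin 1 → K => x (Sum.inr 0)) := PolyF.var _
  have hc : ∀ a : K, PolyF (fun x : Unit ⊕ Fin 1 → K => a) := fun a => PolyF.const a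
  refine (Dio.ex (k := 1) ((Dio_EQ A B ϖ N h1).and ((Dio_EQ A B ϖ N (h0.mul h1)).and (Dio_EQ A B ϖ N ((h1.sub (hc 1)).mul (hc π)))))).congr ?_
  intro x
  refine (h _).trans ?_
  constructor
  · rintro ⟨b, h⟩
    exact ⟨fun _ => b, h⟩
  · rintro ⟨y, h⟩
    exact ⟨_, h⟩

lemma D1_gt (p : HeightOneSpectrum (𝓞 K)) : D1 (fun z : K => 1 < vl p z) := by
  obtain ⟨π, hπ⟩ := exists_unif p
  have h0 : PolyF (fun x : Unit ⊕ Fin 1 → K => x (Sum.inl ())) := PolyF.var _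
  have h1 : PolyF (fun x : Unit ⊕ Fin 1 → K => x (Sum.inr 0)) := PolyF.var _
  have hc : ∀ a : K, PolyF (fun x : Unit ⊕ Fin 1 → K => a) := fun a => PolyF.const a
  refine (Dio.ex (k := 1) ((Dio.eq (h0.mul h1) (hc 1)).and ((D1_le p).app (h1.div (π : K))))).congr ?_
  intro x
  have hd : ∀ w : K, vl p (w / π) ≤ 1 ↔ vl p w ≤ exp (-1) := by
    intro w
    rw [map_div₀, hπ, div_le_one₀ (by simp)]
  constructor
  · intro h
    have hx : x () ≠ 0 := by rintro h0; simp [h0] at h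
    refine ⟨fun _ => (x ())⁻¹, mul_inv_cancel₀ hx, ?_⟩
    refine (hd _).2 ?_
    show vl p ((x ())⁻¹) ≤ _
    rw [map_inv₀, exp_neg]
    exact inv_anti₀ (by simp) (exp_one_le h)
  · rintro ⟨y, h1, h2⟩
    have h2 := (hd _).1 h2
    have h1 : x () * y 0 = 1 := h1
    change vl p (y 0) ≤ _ at h2
    have h3 : vl p (x ()) * vl p (y 0) = 1 := by rw [← map_mul, h1, map_one]
    by_contra hh
    rw [not_lt] at hh
    have : vl p (x ()) * vl p (y 0) ≤ 1 * exp (-1) := mul_le_mul' hh h2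
    rw [h3, one_mul] at this
    exact absurd (lt_of_le_of_lt this em1_lt) (lt_irrefl _)

lemma D1_Cert (S : Finset (HeightOneSpectrum (𝓞 K))) (s0) (c g0 ϖ : K) : D1 (fun y : K => Cert S s0 c g0 ϖ y) := by
  have y : PolyF (fun x : Unit ⊕ Fin 8 → K => x (Sum.inl ())) := PolyF.var _
  have g : PolyF (fun x : Unit ⊕ Fin 8 → K => x (Sum.inr 0)) := PolyF.var _
  have A : PolyF (fun x : Unit ⊕ Fin 8 → K => x (Sum.inr 1)) := PolyF.var _
  have m : PolyF (fun x : Unit ⊕ Fin 8 → K => x (Sum.inr 2)) := PolyF.var _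
  have e : PolyF (fun x : Unit ⊕ Fin 8 → K => x (Sum.inr 3)) := PolyF.var _
  have e' : PolyF (fun x : Unit ⊕ Fin 8 → K => x (Sum.inr 4)) := PolyF.var _
  have α : PolyF (fun x : Unit ⊕ Fin 8 → K => x (Sum.inr 5)) := PolyF.var _
  have β : PolyF (fun x : Unit ⊕ Fin 8 → K => x (Sum.inr 6)) := PolyF.var _
  have γ : PolyF (fun x : Unit ⊕ Fin 8 → K => x (Sum.inr 7)) := PolyF.var _
  have hc : ∀ a : K, PolyF (fun x : Unit ⊕ Fin 8 → K => a) := fun a => PolyF.const a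
  have B := (hc 1).add (g.pow 2)
  have D := (Dio.all S (fun v _ => (D1_le v).app (g.div c))).and <|
    ((D1_le s0).app ((g.sub (hc g0)).div ϖ)).and <| (Dio.eq (A.mul (m.pow 2)) ((hc ϖ).mul e)).and <|
    (Dio.eq (e.mul e') (hc 1)).and <| ((D1_le s0).app e).and <| ((D1_le s0).app e').and <|
    Dio.eq ((((hc 4).mul A).mul B).mul y) ((((hc 1).sub A).pow 2).mul ((hc 1).sub
      (((A.mul (α.pow 2)).add (B.mul (β.pow 2))).sub ((A.mul B).mul (γ.pow 2)))))
  refine (Dio.ex (k := 8) D).congr ?_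
  intro x
  constructor
  · rintro ⟨g, A, m, e, e', α, β, γ, h⟩
    exact ⟨![g, A, m, e, e', α, β, γ], h⟩
  · rintro ⟨y, h⟩
    exact ⟨_, _, _, _, _, _, _, _, h⟩
end UD

end

section
set_option linter.all false
open IsDedekindDomain NumberField WithZero
namespace UD
variable {K : Type*} [Field K] [NumberField K]

lemma exists_CD (T : Finset (HeightOneSpectrum (𝓞 K))) : ∃ S s0, ∃ c g0 ϖ : K, CD S s0 c g0 ϖ ∧ T ⊆ S := by
  classical
  obtain ⟨s0, hs0⟩ := exists_notMem (T ∪ Dy K)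
  have hodd : Odd' s0 := by
    by_contra h
    exact hs0 (Finset.mem_union_right _ (mem_Dy.2 h))
  obtain ⟨g0, hg0⟩ := exists_g hodd
  obtain ⟨ϖ, hϖ⟩ := exists_unif s0
  obtain ⟨n, hn, hp⟩ := exists_prec (T ∪ Dy K)
  choose u hu using fun v : HeightOneSpectrum (𝓞 K) => exists_unif v
  obtain ⟨c, hc⟩ := approx_LS (T ∪ Dy K) (fun v => u v ^ n)
  refine ⟨T ∪ Dy K, s0, c, algebraMap (𝓞 K) K g0, ϖ, ⟨fun v hv => Finset.mem_union_right _ (mem_Dy.2 hv), hs0, c.ne_zero, ?_, hg0, hϖ⟩, Finset.subset_union_left⟩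
  intro v hv
  apply hp v hv
  rw [(hc v hv).2, Units.val_pow_eq_pow_val, map_pow, hu, ← exp_nsmul]
  simp

lemma exists_j (s0 : HeightOneSpectrum (𝓞 K)) : ∃ j : K, 1 < vl s0 j ∧ ∀ v, v ≠ s0 → vl v j ≤ 1 := by
  obtain ⟨x, hx, hx1⟩ := exists_KT_single s0
  rw [mem_KT] at hx
  have hx' : ∀ v, v ≠ s0 → vl v (x : K) = 1 := fun v hv => hx v (by simpa using hv)
  rcases lt_or_gt_of_ne hx1 with h | h
  · refine ⟨(x : K)⁻¹, ?_, fun v hv => ?_⟩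
    · rw [map_inv₀]
      exact (one_lt_inv₀ (by simp [zero_lt_iff])).2 h
    · rw [map_inv₀, hx' v hv]; simp
  · exact ⟨x, h, fun v hv => (hx' v hv).le⟩

theorem D1_pole (T : Finset (HeightOneSpectrum (𝓞 K))) : D1 (fun y : K => ∃ v ∉ T, 1 < vl v y) := by
  classical
  obtain ⟨S, s0, c, g0, ϖ, hCD, hTS⟩ := exists_CD T
  obtain ⟨j, hj, hj'⟩ := exists_j s0
  have y : PolyF (fun x : Unit → K => x ()) := PolyF.var _
  have D := ((D1_Cert S s0 c g0 ϖ).app y).or <| ((D1_Cert S s0 c g0 ϖ).app (y.add (PolyF.const j))).or <|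
    Dio.any (insert s0 S \ T) (fun v _ => (D1_gt v).app y)
  refine D.congr ?_
  intro x
  generalize x () = y
  constructor
  · rintro ⟨p, hpT, hp⟩
    by_cases h : p ∈ insert s0 S
    · exact Or.inr (Or.inr ⟨p, Finset.mem_sdiff.2 ⟨h, hpT⟩, hp⟩)
    · rw [Finset.mem_insert, not_or] at h
      by_cases hs : 1 < vl s0 y
      · exact Or.inl (cert_compl hCD h.2 h.1 hp hs)
      · refine Or.inr (Or.inl (cert_compl hCD h.2 h.1 ?_ ?_))
        · rw [Valuation.map_add_eq_of_lt_left _ (lt_of_le_of_lt (hj' p h.1) hp)]; exact hp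
        · rw [Valuation.map_add_eq_of_lt_right _ (lt_of_le_of_lt (not_lt.1 hs) hj)]; exact hj
  · rintro (h | h | ⟨p, hp, h⟩)
    · obtain ⟨p, hpS, -, hp⟩ := cert_sound hCD h
      exact ⟨p, fun hh => hpS (hTS hh), hp⟩
    · obtain ⟨p, hpS, hps, hp⟩ := cert_sound hCD h
      refine ⟨p, fun hh => hpS (hTS hh), ?_⟩
      by_contra hy
      rw [not_lt] at hy
      exact absurd hp (not_lt.2 (Valuation.map_add_le _ hy (hj' p hps)))
    · exact ⟨p, (Finset.mem_sdiff.1 hp).2, h⟩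
end UD

end

section
set_option linter.all false
open IsDedekindDomain NumberField WithZero
namespace UD
variable {K : Type*} [Field K] [NumberField K]

lemma exists_bd (v : HeightOneSpectrum (𝓞 K)) (x : K) : ∃ n : ℕ, vl v x ≤ exp (n : ℤ) := by
  by_cases hx : x = 0
  · exact ⟨0, by simp [hx]⟩
  · obtain ⟨n, hn⟩ := vl_unit_eq v (Units.mk0 x hx)
    refine ⟨n.toNat, ?_⟩
    rw [Units.val_mk0] at hn
    rw [hn, exp_le_exp]
    exact Int.self_le_toNat n

lemma exists_bd' (P : Finset (HeightOneSpectrum (𝓞 K))) (x : K) : ∃ n : ℕ, ∀ v ∈ P, vl v x ≤ exp (n : ℤ) := by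
  choose f hf using fun v => exists_bd v x
  refine ⟨P.sup f, fun v hv => (hf v).trans ?_⟩
  rw [exp_le_exp]
  exact_mod_cast Finset.le_sup (f := f) hv

lemma exists_clear (P : Finset (HeightOneSpectrum (𝓞 K))) (x : K) (hx : ∀ v ∈ P, vl v x ≤ 1) (n : ℕ) :
    ∃ b o : 𝓞 K, (∀ v ∈ P, vl v (algebraMap (𝓞 K) K b - 1) ≤ exp (-(n : ℤ))) ∧
      algebraMap (𝓞 K) K b * x = algebraMap (𝓞 K) K o := by
  classical
  by_cases hx0 : x = 0
  · exact ⟨1, 0, by simp, by simp [hx0]⟩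
  have hfin : {v : HeightOneSpectrum (𝓞 K) | 1 < vl v x}.Finite :=
    (finite_vl_ne_one (Units.mk0 x hx0)).subset fun v hv => (ne_of_gt hv : vl v x ≠ 1)
  obtain ⟨m, hm⟩ := exists_bd' hfin.toFinset x
  obtain ⟨b, hb⟩ := crt (P ∪ hfin.toFinset) (fun v => if v ∈ P then 1 else 0) (n + m)
  have hInt : ∀ v, vl v (algebraMap (𝓞 K) K b * x) ≤ 1 := by
    intro v
    rw [map_mul]
    by_cases hv : 1 < vl v x
    · have hv' : v ∈ hfin.toFinset := by simpa using hv
      have hvP : v ∉ P := fun h => absurd hv (not_lt.2 (hx v h))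
      have h1 := hb v (Finset.mem_union_right _ hv')
      simp only [if_neg hvP, map_zero, sub_zero] at h1
      calc _ ≤ exp (-((n + m : ℕ) : ℤ)) * exp (m : ℤ) := mul_le_mul' h1 (hm v hv')
        _ ≤ 1 := by
          rw [← exp_add, ← exp_zero, exp_le_exp]; push_cast; omega
    · exact mul_le_one' (v.valuation_le_one b) (not_lt.1 hv)
  obtain ⟨o, ho⟩ := HeightOneSpectrum.mem_integers_of_valuation_le_one K _ hInt
  refine ⟨b, o, fun v hv => ?_, ho.symm⟩
  have h1 := hb v (Finset.mem_union_left _ hv)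
  simp only [if_pos hv, map_one] at h1
  refine h1.trans ?_
  rw [exp_le_exp]; push_cast; omega

lemma exists_poles (R : Subring K) (hfg : ∃ s : Finset K, Subring.closure (s : Set K) = R) :
    ∃ T : Finset (HeightOneSpectrum (𝓞 K)), ∀ v, v ∈ T ↔ ∃ r ∈ R, 1 < vl v r := by
  classical
  obtain ⟨s, hs⟩ := hfg
  have hfin : {v : HeightOneSpectrum (𝓞 K) | ∃ r ∈ R, 1 < vl v r}.Finite := by
    have h1 : (⋃ g ∈ s, {v : HeightOneSpectrum (𝓞 K) | 1 < vl v g}).Finite := by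
      refine Set.Finite.biUnion s.finite_toSet fun g _ => ?_
      by_cases hg : g = 0
      · simp [hg]
      · exact (finite_vl_ne_one (Units.mk0 g hg)).subset fun v hv => (ne_of_gt hv : vl v g ≠ 1)
    refine h1.subset ?_
    rintro v ⟨r, hr, hv⟩
    by_contra hn
    have hle : Subring.closure (s : Set K) ≤ (vl v).integer := by
      rw [Subring.closure_le]
      intro g hg
      by_contra hlt
      have hlt2 : 1 < vl v g := not_le.1 hlt
      exact hn (Set.mem_biUnion hg hlt2)
    rw [hs] at hle
    exact absurd hv (not_lt.2 (hle hr))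
  exact ⟨hfin.toFinset, fun v => by simp⟩

lemma exists_cond (R : Subring K) (hfrac : ∀ x : K, ∃ r s : K, r ∈ R ∧ s ∈ R ∧ s ≠ 0 ∧ x = r / s) :
    ∃ d : 𝓞 K, d ≠ 0 ∧ ∀ a : 𝓞 K, algebraMap (𝓞 K) K (d * a) ∈ R := by
  classical
  have h1 : ∀ F : Finset (𝓞 K), ∃ c : K, c ∈ R ∧ c ≠ 0 ∧ ∀ f ∈ F, c * algebraMap (𝓞 K) K f ∈ R := by
    intro F
    induction F using Finset.induction_on with
    | empty => exact ⟨1, R.one_mem, one_ne_zero, by simp⟩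
    | insert a F ha ih =>
      obtain ⟨c, hc, hc0, h⟩ := ih
      obtain ⟨r, s, hr, hs, hs0, e⟩ := hfrac (algebraMap (𝓞 K) K a)
      refine ⟨c * s, R.mul_mem hc hs, mul_ne_zero hc0 hs0, fun f hf => ?_⟩
      rcases Finset.mem_insert.1 hf with rfl | hf
      · rw [e, show c * s * (r / s) = c * r by field_simp]
        exact R.mul_mem hc hr
      · rw [show c * s * algebraMap (𝓞 K) K f = s * (c * algebraMap (𝓞 K) K f) by ring]
        exact R.mul_mem hs (h f hf)
  obtain ⟨F, hF⟩ := (Module.Finite.fg_top : (⊤ : Submodule ℤ (𝓞 K)).FG)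
  obtain ⟨c, hc, hc0, h⟩ := h1 F
  have h2 : ∀ a : 𝓞 K, c * algebraMap (𝓞 K) K a ∈ R := by
    intro a
    have ha : a ∈ Submodule.span ℤ (F : Set (𝓞 K)) := by rw [hF]; trivial
    induction ha using Submodule.span_induction with
    | mem f hf => exact h f hf
    | zero => simp [R.zero_mem]
    | add x y _ _ hx hy => rw [map_add, mul_add]; exact R.add_mem hx hy
    | smul n x _ hx =>
      rw [map_zsmul, mul_smul_comm]; exact R.zsmul_mem hx n
  obtain ⟨x, y, hy, hxy⟩ := IsFractionRing.div_surjective (A := 𝓞 K) c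
  have hy0 : algebraMap (𝓞 K) K y ≠ 0 := by
    simpa using nonZeroDivisors.ne_zero hy
  refine ⟨x, ?_, fun a => ?_⟩
  · rintro rfl
    apply hc0; rw [← hxy]; simp
  · have := h2 (y * a)
    rwa [← hxy, map_mul, show algebraMap (𝓞 K) K x / algebraMap (𝓞 K) K y * (algebraMap (𝓞 K) K y * algebraMap (𝓞 K) K a) = algebraMap (𝓞 K) K x * algebraMap (𝓞 K) K a by field_simp, ← map_mul] at this

lemma cond_OS (R : Subring K) {d : 𝓞 K} (hd : ∀ a : 𝓞 K, algebraMap (𝓞 K) K (d * a) ∈ R) {x : K}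
    (hx : ∀ v : HeightOneSpectrum (𝓞 K), 1 < vl v x → ∃ r ∈ R, 1 < vl v r) : algebraMap (𝓞 K) K d * x ∈ R := by
  set M : Submodule (𝓞 K) K := Submodule.span (𝓞 K) (R : Set K) with hM
  have h1 : ∀ z ∈ M, ∀ o : 𝓞 K, algebraMap (𝓞 K) K (d * o) * z ∈ R := by
    intro z hz
    induction hz using Submodule.span_induction with
    | mem f hf => exact fun o => R.mul_mem (hd o) hf
    | zero => simp [R.zero_mem]
    | add x y _ _ hx hy => intro o; rw [mul_add]; exact R.add_mem (hx o) (hy o)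
    | smul n x _ hx =>
      intro o
      have := hx (o * n)
      rw [Algebra.smul_def]
      convert this using 1
      simp only [map_mul]; ring
  suffices hxM : x ∈ M by simpa using h1 x hxM 1
  set I : Ideal (𝓞 K) := Submodule.comap (LinearMap.toSpanSingleton (𝓞 K) K x) M with hI
  have memI : ∀ a : 𝓞 K, a ∈ I ↔ algebraMap (𝓞 K) K a * x ∈ M := by
    intro a
    rw [hI, Submodule.mem_comap, LinearMap.toSpanSingleton_apply, Algebra.smul_def]
  by_contra hxM
  have hI1 : I ≠ ⊤ := by
    intro h
    rw [Ideal.eq_top_iff_one, memI] at h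
    simp at h; exact hxM h
  obtain ⟨m, hm, hIm⟩ := Ideal.exists_le_maximal I hI1
  have hRM : ∀ o : 𝓞 K, ∀ r ∈ R, algebraMap (𝓞 K) K o * r ∈ M := by
    intro o r hr
    rw [← Algebra.smul_def]
    exact M.smul_mem _ (Submodule.subset_span hr)
  have hm0 : m ≠ ⊥ := by
    rintro rfl
    obtain ⟨a, b, hb, hab⟩ := IsFractionRing.div_surjective (A := 𝓞 K) x
    have hb0 : b ≠ 0 := nonZeroDivisors.ne_zero hb
    have hb1 : algebraMap (𝓞 K) K b ≠ 0 := by simpa using hb0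
    have : b ∈ I := by
      rw [memI, ← hab, mul_div_cancel₀ _ hb1]
      simpa using hRM a 1 R.one_mem
    exact hb0 (by simpa using hIm this)
  set v : HeightOneSpectrum (𝓞 K) := ⟨m, hm.isPrime, hm0⟩ with hv
  have key : ∀ w r : K, r ∈ R → vl v w ≤ 1 → x = w * r → False := by
    intro w r hr hw e
    obtain ⟨b, o, hb, hbo⟩ := exists_clear {v} w (by simpa using hw) 1
    have hb1 := vl_eq_one_of_sub_lt (lt_of_le_of_lt (hb v (by simp)) em1_lt)
    rw [vl_eq_one_iff] at hb1
    apply hb1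
    apply hIm
    rw [memI, e, ← mul_assoc, hbo]
    exact hRM o r hr
  by_cases hvx : 1 < vl v x
  · obtain ⟨r, hr, hvr⟩ := hx v hvx
    obtain ⟨n, hn⟩ := exists_bd v x
    have hr0 : r ≠ 0 := by rintro rfl; simp at hvr
    refine key (x / r ^ n) (r ^ n) (R.pow_mem hr n) ?_ (by field_simp)
    rw [map_div₀, map_pow, div_le_one₀ (pow_pos (lt_trans one_pos hvr) _)]
    refine hn.trans ?_
    have := pow_le_pow_left' (exp_one_le hvr) n
    rwa [← exp_nsmul, nsmul_eq_mul, mul_one] at this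
  · exact key x 1 R.one_mem (not_lt.1 hvx) (by simp)

theorem D1_notMem (R : Subring K) (hfg : ∃ s : Finset K, Subring.closure (s : Set K) = R)
    (hfrac : ∀ x : K, ∃ r s : K, r ∈ R ∧ s ∈ R ∧ s ≠ 0 ∧ x = r / s) : D1 (fun x : K => x ∉ R) := by
  classical
  obtain ⟨T, hT⟩ := exists_poles R hfg
  obtain ⟨d, hd0, hd⟩ := exists_cond R hfrac
  have hd1 : algebraMap (𝓞 K) K d ≠ 0 := by simpa using hd0
  have hfin := finite_vl_ne_one (Units.mk0 _ hd1)
  set P := hfin.toFinset \ T with hP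
  have memP : ∀ v, v ∉ T → v ∉ P → vl v (algebraMap (𝓞 K) K d) = 1 := by
    intro v h1 h2
    by_contra h
    exact h2 (Finset.mem_sdiff.2 ⟨by simpa using h, h1⟩)
  have : Finite (𝓞 K ⧸ Ideal.span {d}) := Ideal.finiteQuotientOfFreeOfNeBot _ (by simpa using hd0)
  set Rep : Finset (𝓞 K) := (Set.finite_range (Quotient.out : (𝓞 K ⧸ Ideal.span {d}) → 𝓞 K)).toFinset with hRep
  have y : PolyF (fun x : Unit → K => x ()) := PolyF.var _
  have D := ((D1_pole T).app y).or <| Dio.any (Rep.filter (fun a => algebraMap (𝓞 K) K a ∉ R)) (fun a _ =>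
    Dio.all P (fun v _ => (D1_le v).app ((y.sub (PolyF.const (algebraMap (𝓞 K) K a))).div (algebraMap (𝓞 K) K d))))
  refine D.congr ?_
  intro x
  generalize x () = x
  -- the key congruence fact
  have key : ∀ a : 𝓞 K, (∀ v ∉ T, vl v x ≤ 1) → (∀ v ∈ P, vl v ((x - algebraMap (𝓞 K) K a) / algebraMap (𝓞 K) K d) ≤ 1) →
      x - algebraMap (𝓞 K) K a ∈ R := by
    intro a hx ha
    have := cond_OS R hd (x := (x - algebraMap (𝓞 K) K a) / algebraMap (𝓞 K) K d) ?_
    · rwa [mul_div_cancel₀ _ hd1] at this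
    · intro v hv
      by_contra hr
      have hvT : v ∉ T := fun h => hr ((hT v).1 h)
      have hvP : v ∉ P := fun h => absurd hv (not_lt.2 (ha v h))
      rw [map_div₀, memP v hvT hvP, div_one] at hv
      exact absurd hv (not_lt.2 (Valuation.map_sub_le _ (hx v hvT) (v.valuation_le_one a)))
  constructor
  · intro hxR
    by_cases hpole : ∃ v ∉ T, 1 < vl v x
    · exact Or.inl hpole
    right
    have hx : ∀ v ∉ T, vl v x ≤ 1 := by
      intro v hv
      by_contra h
      exact hpole ⟨v, hv, not_le.1 h⟩
    obtain ⟨n, hn⟩ := exists_bd' P (algebraMap (𝓞 K) K d)⁻¹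
    obtain ⟨b, o, hb, hbo⟩ := exists_clear P x (fun v hv => hx v (Finset.mem_sdiff.1 hv).2) n
    set a : 𝓞 K := Quotient.out (Ideal.Quotient.mk (Ideal.span {d}) o) with ha
    have hoa : ∃ t, o - a = d * t := by
      rw [← dvd_def, ← Ideal.mem_span_singleton, ← Ideal.Quotient.eq, ha]
      exact (Quotient.out_eq _).symm
    obtain ⟨t, ht⟩ := hoa
    have hP' : ∀ v ∈ P, vl v ((x - algebraMap (𝓞 K) K a) / algebraMap (𝓞 K) K d) ≤ 1 := by
      intro v hv
      have e : (x - algebraMap (𝓞 K) K a) / algebraMap (𝓞 K) K d =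
          algebraMap (𝓞 K) K t - (algebraMap (𝓞 K) K b - 1) * x * (algebraMap (𝓞 K) K d)⁻¹ := by
        have h1 : algebraMap (𝓞 K) K o - algebraMap (𝓞 K) K a = algebraMap (𝓞 K) K d * algebraMap (𝓞 K) K t := by
          rw [← map_sub, ht, map_mul]
        field_simp
        linear_combination hbo + h1
      rw [e]
      refine Valuation.map_sub_le _ (v.valuation_le_one t) ?_
      rw [map_mul, map_mul]
      calc _ ≤ exp (-(n : ℤ)) * 1 * exp (n : ℤ) :=
            mul_le_mul' (mul_le_mul' (hb v hv) (hx v (Finset.mem_sdiff.1 hv).2)) (hn v hv)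
        _ = 1 := by rw [mul_one, ← exp_add]; simp
    refine ⟨a, Finset.mem_filter.2 ⟨by simp [hRep, ha], fun haR => hxR ?_⟩, hP'⟩
    have := R.add_mem (key a hx hP') haR
    simpa using this
  · rintro (⟨v, hv, h⟩ | ⟨a, ha, h⟩) hxR
    · exact hv ((hT v).2 ⟨x, hxR, h⟩)
    · have hx : ∀ v ∉ T, vl v x ≤ 1 := by
        intro v hv
        by_contra h
        exact hv ((hT v).2 ⟨x, hxR, not_le.1 h⟩)
      have := R.sub_mem hxR (key a hx h)
      rw [sub_sub_cancel] at this
      exact (Finset.mem_filter.1 ha).2 this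
end UD
end

theorem fin_gen_subring_of_number_field_univ_definable
    (K : Type*) [Field K] [NumberField K] (R : Subring K)
    (hfg : ∃ s : Finset K, Subring.closure (s : Set K) = R)
    (hfrac : ∀ x : K, ∃ r s : K, r ∈ R ∧ s ∈ R ∧ s ≠ 0 ∧ x = r / s) :
    ∃ (n : ℕ) (F : MvPolynomial (Fin (n + 1)) K),
      (R : Set K) =
        {x : K | ∀ y : Fin n → K, MvPolynomial.eval (Fin.cons x y) F ≠ 0} := by
  obtain ⟨n, F, h⟩ := (UD.D1_notMem R hfg hfrac).final
  refine ⟨n, F, ?_⟩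
  ext x
  have h := h x
  simp only [SetLike.mem_coe, Set.mem_setOf_eq, ne_eq]
  rw [← not_exists, ← h, not_not]
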